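/- For every real ρ ≥ k·2^{k+3} there is a constant C(ρ) depending only on ρ such that, in the setup below and for all sufficiently large n, Σ_{r∈ℤ_N} |𝔞̃(r)|^ρ ≤ C(ρ)·K. -/

import Mathlib

open Finset

/-- `e(t) = exp(2πit)`. -/
noncomputable def eC (t : ℝ) : ℂ := Complex.exp (2 * Real.pi * Complex.I * t)

/-- `λ_{b,W}(x) = (φ(W)/W)·log(Wx+b)` if `Wx+b` is prime, and `0` otherwise. -/
noncomputable def lam (b W x : ℕ) : ℝ :=
  if Nat.Prime (W * x + b) then ((Nat.totient W : ℝ) / W) * Real.log (W * x + b) else 0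

/-- The (unnormalized) Fourier transform `f̃(r) = Σ_{x=1}^{N} f(x) e(−xr/N)`
of a function `f : ℤ_N → ℝ`. -/
noncomputable def dft (N : ℕ) (f : ZMod N → ℝ) (r : ZMod N) : ℂ :=
  ∑ x ∈ Finset.Icc 1 N, (f ((x : ℕ) : ZMod N) : ℂ) *
    eC (-(((x : ℕ) : ℝ) * ((r.val : ℕ) : ℝ)) / N)

/-! ### The additive character `eC` and the distance to the nearest integer -/

lemma eC_add (x y : ℝ) : eC (x + y) = eC x * eC y := by
  unfold eC; rw [← Complex.exp_add]; push_cast; ring_nf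

lemma eC_zero : eC 0 = 1 := by simp [eC]

lemma eC_eq_exp_I_mul (x : ℝ) : eC x = Complex.exp (Complex.I * ((2 * Real.pi * x : ℝ) : ℂ)) := by
  unfold eC; push_cast; ring_nf

lemma norm_eC (x : ℝ) : ‖eC x‖ = 1 := by
  rw [eC_eq_exp_I_mul, mul_comm, Complex.norm_exp_ofReal_mul_I]

lemma eC_int (n : ℤ) : eC n = 1 := by
  unfold eC
  rw [Complex.exp_eq_one_iff]
  exact ⟨n, by push_cast; ring⟩

lemma eC_add_int (x : ℝ) (n : ℤ) : eC (x + n) = eC x := by rw [eC_add, eC_int, mul_one]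

lemma conj_eC (x : ℝ) : (starRingEnd ℂ) (eC x) = eC (-x) := by
  unfold eC
  rw [← Complex.exp_conj]
  simp [Complex.conj_ofNat]

lemma norm_eC_sub_one_le (x : ℝ) : ‖eC x - 1‖ ≤ 2 * Real.pi * |x| := by
  rw [eC_eq_exp_I_mul]
  refine (Real.norm_exp_I_mul_ofReal_sub_one_le).trans ?_
  rw [Real.norm_eq_abs, abs_mul, abs_of_pos (by positivity)]

lemma norm_eC_sub_eC_le (x y : ℝ) : ‖eC x - eC y‖ ≤ 2 * Real.pi * |x - y| := by
  have h : eC x - eC y = eC y * (eC (x - y) - 1) := by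
    rw [mul_sub, ← eC_add]; simp
  rw [h, norm_mul, norm_eC, one_mul]
  exact norm_eC_sub_one_le _

/-- Distance to the nearest integer. -/
noncomputable def distInt (x : ℝ) : ℝ := |x - round x|

lemma distInt_nonneg (x : ℝ) : 0 ≤ distInt x := abs_nonneg _

lemma distInt_le (x : ℝ) (n : ℤ) : distInt x ≤ |x - n| := round_le x n

lemma distInt_neg (x : ℝ) : distInt (-x) = distInt x := by
  apply le_antisymm
  · refine (distInt_le (-x) (-round x)).trans (le_of_eq ?_)
    unfold distInt
    rw [← abs_neg]; push_cast; ring_nf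
  · refine (distInt_le x (-round (-x))).trans (le_of_eq ?_)
    unfold distInt
    rw [← abs_neg]; push_cast; ring_nf

lemma four_mul_distInt_le (x : ℝ) : 4 * distInt x ≤ ‖eC x - 1‖ := by
  have h1 : eC x = eC (x - round x) := by
    have := eC_add_int (x - round x) (round x)
    rw [← this]; ring_nf
  rw [h1, eC_eq_exp_I_mul, Complex.norm_exp_I_mul_ofReal_sub_one]
  have h2 : ‖2 * Real.sin (2 * Real.pi * (x - round x) / 2)‖
      = 2 * |Real.sin (Real.pi * |x - round x|)| := by
    rw [Real.norm_eq_abs, abs_mul, abs_two]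
    congr 1
    rcases abs_cases (x - round x) with ⟨h, -⟩ | ⟨h, -⟩ <;> rw [h]
    · ring_nf
    · rw [mul_neg, Real.sin_neg, abs_neg]; ring_nf
  rw [h2]
  change 4 * |x - round x| ≤ _
  have h3 : |x - round x| ≤ 1 / 2 := abs_sub_round x
  have h4 := Real.mul_le_sin (x := Real.pi * |x - round x|) (by positivity)
    (by nlinarith [Real.pi_pos])
  have h5 : 2 / Real.pi * (Real.pi * |x - round x|) = 2 * |x - round x| := by
    field_simp
  rw [h5] at h4
  have := le_abs_self (Real.sin (Real.pi * |x - round x|))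
  linarith

/-- A smooth substitute for `min X (1 / distInt γ)`. -/
noncomputable def geomBound (X : ℕ) (γ : ℝ) : ℝ := 2 * X / (1 + X * distInt γ)

lemma geomBound_nonneg (X : ℕ) (γ : ℝ) : 0 ≤ geomBound X γ := by
  have := distInt_nonneg γ
  unfold geomBound; positivity

lemma geomBound_le (X : ℕ) (γ : ℝ) : geomBound X γ ≤ 2 * X := by
  have := distInt_nonneg γ
  unfold geomBound
  apply div_le_self (by positivity)
  have : 0 ≤ X * distInt γ := by positivity
  linarith

lemma geomBound_neg (X : ℕ) (γ : ℝ) : geomBound X (-γ) = geomBound X γ := by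
  unfold geomBound; rw [distInt_neg]

lemma geomBound_le_of_le_distInt {X : ℕ} {γ t : ℝ} (ht : 0 < t) (h : t ≤ distInt γ) :
    geomBound X γ ≤ 2 / t := by
  unfold geomBound
  rw [div_le_div_iff₀ (by have := distInt_nonneg γ; positivity) ht]
  have : (X : ℝ) * t ≤ X * distInt γ := by gcongr
  linarith

lemma norm_sum_eC_linear_le {X : ℕ} {a b : ℤ} (hab : b - a ≤ X) (γ δ : ℝ) :
    ‖∑ z ∈ Ico a b, eC (γ * z + δ)‖ ≤ geomBound X γ := by
  have hd := distInt_nonneg γ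
  by_cases hba : b ≤ a
  · rw [Ico_eq_empty_of_le hba]; simp [geomBound_nonneg]
  push Not at hba
  have hX : 0 < (X : ℝ) := by
    have : (0 : ℤ) < X := by omega
    exact_mod_cast this
  have hbaX : ((b - a : ℤ) : ℝ) ≤ X := by exact_mod_cast hab
  have triv : ‖∑ z ∈ Ico a b, eC (γ * z + δ)‖ ≤ X := by
    refine (norm_sum_le _ _).trans ?_
    simp only [norm_eC, sum_const, Int.card_Ico, nsmul_eq_mul, mul_one]
    refine le_trans (le_of_eq ?_) hbaX
    have : ((b - a).toNat : ℤ) = b - a := by omega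
    exact_mod_cast this
  have tele : (∑ z ∈ Ico a b, eC (γ * z + δ)) * (eC γ - 1)
      = eC (γ * b + δ) - eC (γ * a + δ) := by
    obtain ⟨n, rfl⟩ : ∃ n : ℕ, b = a + n := ⟨(b - a).toNat, by omega⟩
    clear hab hba hbaX triv
    induction n with
    | zero => simp
    | succ n ih =>
      have : Ico a (a + (n + 1 : ℕ)) = insert (a + n : ℤ) (Ico a (a + n)) := by
        ext z; simp; omega
      rw [this, sum_insert (by simp), add_mul, ih, mul_sub, ← eC_add, mul_one]
      have : γ * ((a + n : ℤ) : ℝ) + δ + γ = γ * ((a + (n + 1 : ℕ) : ℤ) : ℝ) + δ := by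
        push_cast; ring
      rw [this]; ring
  have h4 := four_mul_distInt_le γ
  have hS : ‖∑ z ∈ Ico a b, eC (γ * z + δ)‖ * (4 * distInt γ) ≤ 2 := by
    calc _ ≤ ‖∑ z ∈ Ico a b, eC (γ * z + δ)‖ * ‖eC γ - 1‖ := by gcongr
      _ = ‖eC (γ * b + δ) - eC (γ * a + δ)‖ := by rw [← norm_mul, tele]
      _ ≤ 2 := by
        refine (norm_sub_le _ _).trans ?_
        rw [norm_eC, norm_eC]; norm_num
  unfold geomBound
  rw [le_div_iff₀ (by positivity)]
  nlinarith [norm_nonneg (∑ z ∈ Ico a b, eC (γ * z + δ))]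

/-! ### Weyl differencing -/

/-- `f` has vanishing `(k + 1)`-st differences, with leading coefficient `γ` in degree `k`. -/
def HasLead : ℕ → ℝ → (ℤ → ℝ) → Prop
  | 0, γ, f => ∀ z, f z = γ
  | k + 1, γ, f => ∀ h : ℤ, HasLead k ((k + 1) * γ * h) (fun z => f (z + h) - f z)

lemma HasLead.add : ∀ {k : ℕ} {γ γ' : ℝ} {f g : ℤ → ℝ}, HasLead k γ f → HasLead k γ' g →
    HasLead k (γ + γ') (fun z => f z + g z)
  | 0, _, _, _, _, hf, hg => fun z => by
      exact congrArg₂ (· + ·) (hf z) (hg z)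
  | k + 1, γ, γ', f, g, hf, hg => fun h => by
      have := HasLead.add (hf h) (hg h)
      convert this using 1
      · ring
      · funext z; ring

lemma hasLead_zero (k : ℕ) : HasLead k 0 (fun _ => 0) := by
  induction k with
  | zero => intro z; rfl
  | succ k ih => intro h; simpa using ih

lemma HasLead.sum {ι : Type*} (s : Finset ι) {k : ℕ} {γ : ι → ℝ} {f : ι → ℤ → ℝ}
    (h : ∀ i ∈ s, HasLead k (γ i) (f i)) : HasLead k (∑ i ∈ s, γ i) (fun z => ∑ i ∈ s, f i z) := by
  classical
  induction s using Finset.induction_on with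
  | empty => simpa using hasLead_zero k
  | insert a s ha ih =>
    simp only [sum_insert ha]
    exact (h a (mem_insert_self _ _)).add (ih fun i hi => h i (mem_insert_of_mem hi))

lemma hasLead_monomial : ∀ (k : ℕ) {j : ℕ} (_ : j ≤ k) (c : ℝ),
    HasLead k (if j = k then c else 0) (fun z => c * (z : ℝ) ^ j) := by
  intro k
  induction k with
  | zero =>
    intro j hj c z
    obtain rfl : j = 0 := by omega
    simp
  | succ k ih =>
    intro j hj c h
    have hs : HasLead k (∑ i ∈ range j, if i = k then c * (j.choose i) * (h : ℝ) ^ (j - i) else 0)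
        (fun z => ∑ i ∈ range j, (c * (j.choose i) * (h : ℝ) ^ (j - i)) * (z : ℝ) ^ i) := by
      apply HasLead.sum
      intro i hi
      exact ih (by have := mem_range.1 hi; omega) _
    convert hs using 1
    · by_cases hjk : j = k + 1
      · subst hjk
        simp only [sum_ite_eq', mem_range, Nat.lt_succ_self, if_true, Nat.choose_succ_self_right]
        rw [Nat.add_sub_cancel_left]
        push_cast
        ring
      · rw [if_neg hjk]
        symm
        rw [mul_zero, zero_mul]
        apply sum_eq_zero
        intro i hi
        rw [if_neg (by have := mem_range.1 hi; omega)]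
    · funext z
      push_cast
      rw [add_pow, sum_range_succ, mul_add]
      simp only [mul_sum, Nat.sub_self, pow_zero, Nat.choose_self, Nat.cast_one, mul_one,
        add_sub_cancel_right]
      apply sum_congr rfl
      intro i _
      ring

lemma HasLead.eq_linear {γ : ℝ} {f : ℤ → ℝ} (hf : HasLead 1 γ f) (z : ℤ) :
    f z = γ * z + f 0 := by
  have := hf z 0
  simp at this
  linarith

/-- The iterated sum over shifts produced by Weyl differencing in degree `j + 1`. -/
noncomputable def weylSum (X : ℕ) : ℕ → ℝ → ℝ
  | 0, γ => geomBound X γ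
  | j + 1, γ => ∑ h ∈ Ioo (-(X : ℤ)) X, weylSum X j ((j + 2) * γ * h)

lemma weylSum_nonneg (X j : ℕ) (γ : ℝ) : 0 ≤ weylSum X j γ := by
  induction j generalizing γ with
  | zero => exact geomBound_nonneg _ _
  | succ j ih => exact sum_nonneg fun h _ => ih _

lemma norm_sum_sq_le_sum_norm_shift {X : ℕ} {a b : ℤ} (hab : b - a ≤ X) (f : ℤ → ℝ) :
    ‖∑ z ∈ Ico a b, eC (f z)‖ ^ 2 ≤ ∑ h ∈ Ioo (-(X : ℤ)) X,
      ‖∑ z ∈ Ico (max a (a - h)) (min b (b - h)), eC (f (z + h) - f z)‖ := by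
  have key : (∑ z ∈ Ico a b, eC (f z)) * (starRingEnd ℂ) (∑ z ∈ Ico a b, eC (f z))
      = ∑ h ∈ Ioo (-(X : ℤ)) X,
        ∑ z ∈ Ico (max a (a - h)) (min b (b - h)), eC (f (z + h) - f z) := by
    rw [map_sum, sum_mul_sum, sum_sigma', sum_sigma']
    refine sum_bij' (fun p _ => (⟨p.1 - p.2, p.2⟩ : Σ _ : ℤ, ℤ))
      (fun p _ => (⟨p.2 + p.1, p.2⟩ : Σ _ : ℤ, ℤ)) ?_ ?_ ?_ ?_ ?_
    · rintro ⟨x, y⟩ h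
      simp only [mem_sigma, mem_Ico, mem_Ioo] at h ⊢
      omega
    · rintro ⟨x, y⟩ h
      simp only [mem_sigma, mem_Ico, mem_Ioo] at h ⊢
      omega
    · rintro ⟨x, y⟩ h; simp
    · rintro ⟨x, y⟩ h; simp
    · rintro ⟨x, y⟩ h
      simp only [conj_eC, ← eC_add]
      congr 1
      rw [show y + (x - y) = x by ring]
      ring
  rw [Complex.mul_conj, Complex.normSq_eq_norm_sq] at key
  calc ‖∑ z ∈ Ico a b, eC (f z)‖ ^ 2
      = ‖((‖∑ z ∈ Ico a b, eC (f z)‖ ^ 2 : ℝ) : ℂ)‖ := by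
        rw [Complex.norm_real, Real.norm_of_nonneg (by positivity)]
    _ ≤ _ := by rw [key]; exact norm_sum_le _ _

lemma two_mul_card_shifts_le (X : ℕ) : ((#(Ioo (-(X : ℤ)) X) : ℕ) : ℝ) ≤ 2 * X := by
  rw [Int.card_Ioo]
  have : ((X : ℤ) - -(X : ℤ) - 1).toNat ≤ 2 * X := by omega
  exact_mod_cast this

lemma succ_le_two_pow (j : ℕ) : j + 1 ≤ 2 ^ j := Nat.lt_two_pow_self

lemma norm_sum_pow_le_weylSum {X : ℕ} (j : ℕ) : ∀ {a b : ℤ} (_ : b - a ≤ X) {γ : ℝ} {f : ℤ → ℝ}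
    (_ : HasLead (j + 1) γ f),
    ‖∑ z ∈ Ico a b, eC (f z)‖ ^ (2 ^ j) ≤ (2 * X : ℝ) ^ (2 ^ j - (j + 1)) * weylSum X j γ := by
  induction j with
  | zero =>
    intro a b hab γ f hf
    have : ∀ z ∈ Ico a b, eC (f z) = eC (γ * z + f 0) := fun z _ => by rw [hf.eq_linear z]
    rw [sum_congr rfl this]
    simpa [weylSum] using norm_sum_eC_linear_le hab γ (f 0)
  | succ j ih =>
    intro a b hab γ f hf
    set D : ℤ → ℝ := fun h =>
      ‖∑ z ∈ Ico (max a (a - h)) (min b (b - h)), eC (f (z + h) - f z)‖ with hD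
    have h1 : ‖∑ z ∈ Ico a b, eC (f z)‖ ^ (2 ^ (j + 1))
        ≤ (∑ h ∈ Ioo (-(X : ℤ)) X, D h) ^ (2 ^ j) := by
      rw [pow_succ, mul_comm, pow_mul]
      exact pow_le_pow_left₀ (by positivity) (norm_sum_sq_le_sum_norm_shift hab f) _
    have h2 : (∑ h ∈ Ioo (-(X : ℤ)) X, D h) ^ (2 ^ j)
        ≤ (2 * X : ℝ) ^ (2 ^ j - 1) * ∑ h ∈ Ioo (-(X : ℤ)) X, D h ^ (2 ^ j) := by
      obtain ⟨n, hn⟩ : ∃ n, 2 ^ j = n + 1 := ⟨2 ^ j - 1, by have := succ_le_two_pow j; omega⟩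
      rw [hn, Nat.add_sub_cancel]
      have hD0 : ∀ h ∈ Ioo (-(X : ℤ)) X, 0 ≤ D h := fun h _ => norm_nonneg _
      refine (pow_sum_le_card_mul_sum_pow hD0 n).trans ?_
      gcongr
      exact two_mul_card_shifts_le X
    have h3 : ∀ h ∈ Ioo (-(X : ℤ)) X, D h ^ (2 ^ j)
        ≤ (2 * X : ℝ) ^ (2 ^ j - (j + 1)) * weylSum X j ((j + 2) * γ * h) := by
      intro h _
      refine ih (by omega) ?_
      have := hf h
      convert this using 2
      push_cast; ring
    refine h1.trans (h2.trans ?_)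
    calc _ ≤ (2 * X : ℝ) ^ (2 ^ j - 1) * ∑ h ∈ Ioo (-(X : ℤ)) X,
          (2 * X : ℝ) ^ (2 ^ j - (j + 1)) * weylSum X j ((j + 2) * γ * h) := by
          gcongr with h hh
          exact h3 h hh
      _ = _ := by
          rw [← mul_sum, ← mul_assoc, ← pow_add]
          congr 2
          have := succ_le_two_pow j
          rw [pow_succ]; omega

/-! ### The divisor bound -/

lemma add_one_le_mul_rpow {ε : ℝ} (hε : 0 < ε) (a : ℕ) :
    (a + 1 : ℝ) ≤ (1 + 1 / (ε * Real.log 2)) * (2 : ℝ) ^ (a * ε) := by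
  have hl : 0 < Real.log 2 := Real.log_pos (by norm_num)
  set t := ε * Real.log 2 with ht
  have htp : 0 < t := by positivity
  have h1 : 1 + a * t ≤ (2 : ℝ) ^ (a * ε) := by
    rw [Real.rpow_def_of_pos (by norm_num)]
    have := Real.add_one_le_exp (Real.log 2 * (a * ε))
    have h2 : Real.log 2 * (a * ε) = a * t := by rw [ht]; ring
    linarith
  calc (a + 1 : ℝ) ≤ (1 + 1 / t) * (1 + a * t) := by
        have : (1 + 1 / t) * (1 + a * t) = 1 + a * t + 1 / t + a := by field_simp; ring
        rw [this]
        have : 0 < 1 / t := by positivity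
        nlinarith [(by positivity : (0:ℝ) ≤ a * t)]
    _ ≤ _ := by gcongr

lemma add_one_le_two_pow (a : ℕ) : (a + 1 : ℝ) ≤ 2 ^ a := by
  exact_mod_cast succ_le_two_pow a

theorem card_divisors_le_mul_rpow {ε : ℝ} (hε : 0 < ε) :
    ∃ C : ℝ, 1 ≤ C ∧ ∀ n : ℕ, 1 ≤ n → (#n.divisors : ℝ) ≤ C * (n : ℝ) ^ ε := by
  have hl : 0 < Real.log 2 := Real.log_pos (by norm_num)
  set c : ℝ := 1 + 1 / (ε * Real.log 2) with hc
  have hc1 : 1 ≤ c := by rw [hc]; have : 0 < 1 / (ε * Real.log 2) := by positivity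
                         linarith
  set B : ℕ := ⌈(2 : ℝ) ^ (1 / ε)⌉₊ with hB
  refine ⟨c ^ B, one_le_pow₀ hc1, fun n hn => ?_⟩
  have hn0 : n ≠ 0 := by omega
  have hp : ∀ p ∈ n.primeFactors, ((n.factorization p + 1 : ℕ) : ℝ)
      ≤ (if p < B then c else 1) * (((p : ℝ) ^ (n.factorization p)) ^ ε) := by
    intro p hp
    have hpp := Nat.prime_of_mem_primeFactors hp
    have hp2 : (2 : ℝ) ≤ p := by exact_mod_cast hpp.two_le
    have hpow : ((p : ℝ) ^ (n.factorization p)) ^ ε = (p : ℝ) ^ ((n.factorization p : ℝ) * ε) := by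
      rw [← Real.rpow_natCast, ← Real.rpow_mul (by positivity)]
    push_cast
    split_ifs with h
    · refine (add_one_le_mul_rpow hε _).trans ?_
      rw [hpow]
      gcongr
    · rw [one_mul]
      have h1 : (2 : ℝ) ^ (1 / ε) ≤ p := (Nat.le_ceil _).trans (by exact_mod_cast not_lt.1 h)
      have h2 : (2 : ℝ) ≤ (p : ℝ) ^ ε := by
        calc (2 : ℝ) = ((2 : ℝ) ^ (1 / ε)) ^ ε := by
              rw [← Real.rpow_mul (by norm_num), one_div_mul_cancel hε.ne', Real.rpow_one]
          _ ≤ _ := by gcongr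
      refine (add_one_le_two_pow _).trans ?_
      rw [hpow, mul_comm, Real.rpow_mul (by positivity), Real.rpow_natCast]
      gcongr
  rw [Nat.card_divisors hn0]
  push_cast
  calc ∏ p ∈ n.primeFactors, ((n.factorization p : ℝ) + 1)
      ≤ ∏ p ∈ n.primeFactors,
        (if p < B then c else 1) * (((p : ℝ) ^ (n.factorization p)) ^ ε) := by
        apply prod_le_prod
        · intros; positivity
        · intro p h; exact_mod_cast hp p h
    _ = (∏ p ∈ n.primeFactors, (if p < B then c else 1)) * (n : ℝ) ^ ε := by
        rw [prod_mul_distrib]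
        congr 1
        rw [Real.finsetProd_rpow _ _ (by intros; positivity)]
        congr 1
        have := Nat.prod_factorization_pow_eq_self hn0
        rw [Finsupp.prod, Nat.support_factorization] at this
        exact_mod_cast congrArg (Nat.cast (R := ℝ)) this
    _ ≤ _ := by
        gcongr
        rw [prod_ite, prod_const, prod_const_one, mul_one]
        apply pow_le_pow_right₀ hc1
        calc _ ≤ #(range B) := by
              apply card_le_card
              intro p hp
              exact mem_range.2 (mem_filter.1 hp).2
          _ = B := card_range B

/-! ### Weyl's inequality -/

lemma weylSum_neg (X j : ℕ) (γ : ℝ) : weylSum X j (-γ) = weylSum X j γ := by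
  induction j generalizing γ with
  | zero => exact geomBound_neg _ _
  | succ j ih =>
    apply sum_congr rfl
    intro h _
    rw [← ih]
    ring_nf

lemma weylSum_le (X j : ℕ) (γ : ℝ) : weylSum X j γ ≤ (2 * X : ℝ) ^ (j + 1) := by
  induction j generalizing γ with
  | zero => simpa [weylSum] using geomBound_le X γ
  | succ j ih =>
    calc weylSum X (j + 1) γ ≤ ∑ h ∈ Ioo (-(X : ℤ)) X, (2 * X : ℝ) ^ (j + 1) :=
          sum_le_sum fun h _ => ih _
      _ = #(Ioo (-(X : ℤ)) X) * (2 * X : ℝ) ^ (j + 1) := by rw [sum_const, nsmul_eq_mul]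
      _ ≤ (2 * X) * (2 * X : ℝ) ^ (j + 1) := by
          gcongr; exact two_mul_card_shifts_le X
      _ = _ := by ring

lemma sum_Ioo_le_two_mul_sum_Icc {F : ℤ → ℝ} (hF0 : ∀ h, 0 ≤ F h) (hF : ∀ h, F (-h) = F h)
    (X : ℕ) : ∑ h ∈ Ioo (-(X : ℤ)) X, F h ≤ F 0 + 2 * ∑ h ∈ Icc 1 X, F (h : ℤ) := by
  have hsub : Ioo (-(X : ℤ)) X ⊆ insert 0
      ((Icc 1 X).image (fun h : ℕ => (h : ℤ)) ∪ (Icc 1 X).image (fun h : ℕ => -(h : ℤ))) := by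
    intro h hh
    simp only [mem_Ioo, mem_insert, mem_union, mem_image, mem_Icc] at hh ⊢
    rcases lt_trichotomy h 0 with h0 | h0 | h0
    · exact Or.inr (Or.inr ⟨h.natAbs, by omega, by omega⟩)
    · exact Or.inl h0
    · exact Or.inr (Or.inl ⟨h.natAbs, by omega, by omega⟩)
  refine (sum_le_sum_of_subset_of_nonneg hsub fun h _ _ => hF0 h).trans ?_
  rw [sum_insert (by simp), sum_union (disjoint_left.2 (by
      intro h h1 h2
      simp only [mem_image, mem_Icc] at h1 h2
      obtain ⟨a, ha, rfl⟩ := h1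
      obtain ⟨b, hb, hab⟩ := h2
      omega)),
    sum_image (by intro a _ b _ h; simpa using h),
    sum_image (by intro a _ b _ h; simpa using h)]
  simp only [hF]
  rw [two_mul]

lemma sum_mul_le_sum_card_divisors {F : ℕ → ℝ} (hF : ∀ n, 0 ≤ F n) (X H d : ℕ) (hd : 1 ≤ d) :
    ∑ h ∈ Icc 1 X, ∑ m ∈ Icc 1 H, F (m * (d * h)) ≤
      ∑ n ∈ Icc 1 (H * (d * X)), (#n.divisors : ℝ) * F n := by
  rw [← sum_product']
  have hmaps : ∀ p ∈ Icc 1 X ×ˢ Icc 1 H, p.2 * (d * p.1) ∈ Icc 1 (H * (d * X)) := by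
    rintro ⟨h, m⟩ hp
    simp only [mem_product, mem_Icc] at hp ⊢
    constructor
    · exact Nat.mul_pos (by omega) (Nat.mul_pos hd (by omega))
    · exact Nat.mul_le_mul hp.2.2 (Nat.mul_le_mul_left _ hp.1.2)
  rw [← sum_fiberwise_of_maps_to hmaps]
  apply sum_le_sum
  intro n hn
  rw [sum_congr rfl (g := fun _ => F n) (by intro p hp; rw [(mem_filter.1 hp).2]), sum_const,
    nsmul_eq_mul]
  refine mul_le_mul_of_nonneg_right ?_ (hF n)
  norm_cast
  apply card_le_card_of_injOn (fun p => p.1)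
  · rintro ⟨h, m⟩ hp
    have := (mem_filter.1 hp).2
    simp only [mem_coe, Nat.mem_divisors]
    exact ⟨⟨m * d, by rw [← this]; ring⟩, by have := (mem_Icc.1 hn).1; omega⟩
  · rintro ⟨h, m⟩ hp ⟨h', m'⟩ hp' heq
    simp only at heq
    subst heq
    have h1 := mem_filter.1 (mem_coe.1 hp)
    have h2 := mem_filter.1 (mem_coe.1 hp')
    simp only [mem_product, mem_Icc] at h1 h2
    have : m = m' := Nat.eq_of_mul_eq_mul_right (Nat.mul_pos hd (by omega)) (h1.2.trans h2.2.symm)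
    rw [this]

theorem weylSum_le_sum_geomBound (j : ℕ) : ∀ {ε : ℝ} (_ : 0 < ε), ∃ C : ℝ, 1 ≤ C ∧
    ∀ (X : ℕ) (_ : 1 ≤ X) (γ : ℝ), weylSum X j γ ≤ C * X ^ j +
      C * (X : ℝ) ^ ε * ∑ m ∈ Icc 1 ((j + 1).factorial * X ^ j), geomBound X (m * γ) := by
  induction j with
  | zero =>
    intro ε hε
    refine ⟨1, le_rfl, fun X hX γ => ?_⟩
    have : (1 : ℝ) ≤ (X : ℝ) ^ ε := Real.one_le_rpow (by exact_mod_cast hX) hε.le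
    simp [weylSum]
    nlinarith [geomBound_nonneg X γ]
  | succ j ih =>
    intro ε hε
    obtain ⟨C, hC1, hC⟩ := ih (half_pos hε)
    obtain ⟨D, hD1, hD⟩ := card_divisors_le_mul_rpow (ε := ε / (2 * (j + 1))) (by positivity)
    set f : ℝ := ((j + 2).factorial : ℝ) ^ (ε / (2 * (j + 1))) with hf
    have hfac1 : (1 : ℝ) ≤ ((j + 2).factorial : ℝ) := by
      exact_mod_cast Nat.one_le_iff_ne_zero.2 (Nat.factorial_ne_zero _)
    have hf1 : 1 ≤ f := Real.one_le_rpow hfac1 (by positivity)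
    refine ⟨2 ^ (j + 1) + 2 * C * D * f, ?_, fun X hX γ => ?_⟩
    · have : (1 : ℝ) ≤ 2 ^ (j + 1) := one_le_pow₀ (by norm_num)
      have : 0 ≤ 2 * C * D * f := by positivity
      linarith
    have hX1 : (1 : ℝ) ≤ X := by exact_mod_cast hX
    set H := (j + 1).factorial * X ^ j with hH
    have hHX : H * ((j + 2) * X) = (j + 1 + 1).factorial * X ^ (j + 1) := by
      rw [hH, Nat.factorial_succ (j + 1), pow_succ]; ring
    have h1 := sum_Ioo_le_two_mul_sum_Icc (F := fun h => weylSum X j ((j + 2) * γ * h))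
      (fun h => weylSum_nonneg _ _ _) (fun h => by
        rw [← weylSum_neg]; push_cast; ring_nf) X
    have h2 : ∑ h ∈ Icc 1 X, weylSum X j ((j + 2) * γ * ((h : ℤ) : ℝ)) ≤
        C * X ^ (j + 1) + C * (X : ℝ) ^ (ε / 2) *
          ∑ n ∈ Icc 1 (H * ((j + 2) * X)), (#n.divisors : ℝ) * geomBound X (n * γ) := by
      calc _ ≤ ∑ h ∈ Icc 1 X, (C * X ^ j + C * (X : ℝ) ^ (ε / 2) *
              ∑ m ∈ Icc 1 H, geomBound X (((m * ((j + 2) * h) : ℕ) : ℝ) * γ)) := by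
            apply sum_le_sum
            intro h _
            refine (hC X hX _).trans (le_of_eq ?_)
            congr 2
            apply sum_congr rfl
            intro m _
            congr 1
            push_cast; ring
        _ = C * X ^ (j + 1) + C * (X : ℝ) ^ (ε / 2) *
              ∑ h ∈ Icc 1 X, ∑ m ∈ Icc 1 H, geomBound X (((m * ((j + 2) * h) : ℕ) : ℝ) * γ) := by
            rw [sum_add_distrib, sum_const, Nat.card_Icc, nsmul_eq_mul, Nat.add_sub_cancel,
              mul_sum (Icc 1 X)]
            ring
        _ ≤ _ := by
            gcongr
            exact sum_mul_le_sum_card_divisors (F := fun n => geomBound X (n * γ))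
              (fun n => geomBound_nonneg _ _) X H (j + 2) (by omega)
    have h3 : ∑ n ∈ Icc 1 (H * ((j + 2) * X)), (#n.divisors : ℝ) * geomBound X (n * γ)
        ≤ D * f * (X : ℝ) ^ (ε / 2) *
          ∑ n ∈ Icc 1 (H * ((j + 2) * X)), geomBound X (n * γ) := by
      rw [mul_sum]
      apply sum_le_sum
      intro n hn
      rw [mem_Icc] at hn
      refine mul_le_mul_of_nonneg_right ?_ (geomBound_nonneg _ _)
      refine (hD n hn.1).trans ?_
      have : (n : ℝ) ^ (ε / (2 * (j + 1))) ≤ f * (X : ℝ) ^ (ε / 2) := by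
        calc (n : ℝ) ^ (ε / (2 * (j + 1)))
            ≤ (((j + 2).factorial : ℝ) * (X : ℝ) ^ (j + 1)) ^ (ε / (2 * (j + 1))) := by
              gcongr
              have := hn.2
              rw [hHX] at this
              exact_mod_cast this
          _ = _ := by
              rw [Real.mul_rpow (by positivity) (by positivity), ← hf, ← Real.rpow_natCast,
                ← Real.rpow_mul (by positivity)]
              congr 2
              push_cast; field_simp
      calc D * (n : ℝ) ^ (ε / (2 * (j + 1))) ≤ D * (f * (X : ℝ) ^ (ε / 2)) := by gcongr
        _ = _ := by ring
    have h0 : weylSum X j ((j + 2) * γ * ((0 : ℤ) : ℝ)) ≤ 2 ^ (j + 1) * (X : ℝ) ^ (j + 1) := by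
      refine (weylSum_le _ _ _).trans (le_of_eq ?_)
      rw [mul_pow]
    have hXX : (X : ℝ) ^ (ε / 2) * (X : ℝ) ^ (ε / 2) = (X : ℝ) ^ ε := by
      rw [← Real.rpow_add (by positivity)]; ring_nf
    rw [hHX] at h2 h3
    set S := ∑ n ∈ Icc 1 ((j + 1 + 1).factorial * X ^ (j + 1)), geomBound X (n * γ) with hS
    have hS0 : 0 ≤ S := sum_nonneg fun n _ => geomBound_nonneg _ _
    calc weylSum X (j + 1) γ ≤ _ := h1
      _ ≤ 2 ^ (j + 1) * (X : ℝ) ^ (j + 1) + 2 * (C * X ^ (j + 1) + C * (X : ℝ) ^ (ε / 2) *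
          (D * f * (X : ℝ) ^ (ε / 2) * S)) := by
          gcongr
          exact h2.trans (by gcongr)
      _ = (2 ^ (j + 1) + 2 * C) * (X : ℝ) ^ (j + 1) + (2 * C * D * f) * (X : ℝ) ^ ε * S := by
          rw [← hXX]; ring
      _ ≤ _ := by
          have hCD : C ≤ C * D * f := by
            rw [mul_assoc]
            exact le_mul_of_one_le_right (by linarith) (one_le_mul_of_one_le_of_one_le hD1 hf1)
          refine add_le_add (mul_le_mul_of_nonneg_right ?_ (by positivity))
            (mul_le_mul_of_nonneg_right (mul_le_mul_of_nonneg_right ?_ (by positivity)) hS0)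
          · nlinarith
          · linarith [(by positivity : (0:ℝ) ≤ 2 ^ (j + 1))]

lemma sub_two_div_le_distInt {q : ℕ} (hq : 1 ≤ q) {s : ℤ} {n : ℤ} {x e : ℝ}
    (hx : q * x = s + q * n + e) (he : |e| ≤ 2) :
    ((min s (q - s) : ℤ) - 2 : ℝ) / q ≤ distInt x := by
  have hq0 : (0 : ℝ) < q := by exact_mod_cast hq
  rw [div_le_iff₀ hq0, distInt, mul_comm]
  nth_rewrite 1 [← abs_of_pos hq0]
  rw [← abs_mul, mul_sub, hx]
  set t : ℤ := s + q * n - q * round x with ht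
  have h1 : (s : ℝ) + q * n + e - q * round x = t + e := by rw [ht]; push_cast; ring
  have h2 : min s (q - s) ≤ |t| := by
    rcases le_or_gt 0 (n - round x) with h | h
    · have : s ≤ t := by rw [ht]; nlinarith
      exact (min_le_left _ _).trans (this.trans (le_abs_self _))
    · have : q - s ≤ -t := by rw [ht]; nlinarith
      exact (min_le_right _ _).trans (this.trans (neg_le_abs _))
  have h3 : ((min s (q - s) : ℤ) : ℝ) ≤ |(t : ℝ)| := by exact_mod_cast h2
  rw [h1]
  have := abs_sub_abs_le_abs_sub (t : ℝ) (-e)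
  rw [abs_neg, sub_neg_eq_add] at this
  linarith

/-- The value of a bound for `geomBound X γ` when `γ` is within `i / q` of an integer. -/
noncomputable def residueBound (X q i : ℕ) : ℝ := (if i ≤ 2 then 2 * (X : ℝ) else 0) + 6 * q / i

lemma residueBound_nonneg (X q i : ℕ) : 0 ≤ residueBound X q i := by
  unfold residueBound; split_ifs <;> positivity

lemma geomBound_le_residueBound {X q i : ℕ} (hq : 1 ≤ q) {γ : ℝ}
    (h : ((i : ℝ) - 2) / q ≤ distInt γ) : geomBound X γ ≤ residueBound X q i := by
  have hq0 : (0 : ℝ) < q := by exact_mod_cast hq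
  unfold residueBound
  split_ifs with hi
  · have := geomBound_le X γ
    have : (0 : ℝ) ≤ 6 * q / i := by positivity
    linarith
  · have hi3 : (3 : ℝ) ≤ i := by exact_mod_cast not_le.1 hi
    have ht : 0 < ((i : ℝ) - 2) / q := div_pos (by linarith) hq0
    refine (geomBound_le_of_le_distInt ht h).trans ?_
    rw [zero_add, div_div_eq_mul_div, div_le_div_iff₀ (by linarith) (by linarith)]
    nlinarith

lemma sum_residueBound_le (X q : ℕ) (hq : 1 ≤ q) :
    ∑ i ∈ range q, residueBound X q (i + 1) ≤ 4 * X + 6 * q * (1 + Real.log q) := by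
  unfold residueBound
  rw [sum_add_distrib]
  have h1 : ∑ i ∈ range q, (if i + 1 ≤ 2 then 2 * (X : ℝ) else 0) ≤ 4 * X := by
    rw [← sum_filter, sum_const, nsmul_eq_mul]
    have : #{i ∈ range q | i + 1 ≤ 2} ≤ 2 := by
      calc _ ≤ #(range 2) := card_le_card fun i hi => by
            have := (mem_filter.1 hi).2
            exact mem_range.2 (by omega)
        _ = 2 := card_range 2
    have : (#{i ∈ range q | i + 1 ≤ 2} : ℝ) ≤ 2 := by exact_mod_cast this
    nlinarith [(Nat.cast_nonneg X : (0 : ℝ) ≤ X)]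
  have h2 : ∑ i ∈ range q, 6 * (q : ℝ) / ((i + 1 : ℕ) : ℝ) ≤ 6 * q * (1 + Real.log q) := by
    have := harmonic_le_one_add_log q
    rw [harmonic] at this
    push_cast at this
    calc _ = 6 * q * ∑ i ∈ range q, ((i : ℝ) + 1)⁻¹ := by
          rw [mul_sum]; apply sum_congr rfl; intro i _; push_cast; rw [div_eq_mul_inv]
      _ ≤ _ := by gcongr
  exact add_le_add h1 h2

lemma sum_geomBound_block {a : ℤ} {q : ℕ} (hq : 1 ≤ q) (haq : IsCoprime a q) {γ : ℝ}
    (hγ : |γ - a / q| ≤ 1 / (q : ℝ) ^ 2) (X m₀ : ℕ) :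
    ∑ j ∈ range q, geomBound X (((m₀ + j : ℕ) : ℝ) * γ) ≤
      10 * X + 12 * q * (1 + Real.log q) := by
  have hq0 : (0 : ℝ) < q := by exact_mod_cast hq
  have hqz : (0 : ℤ) < q := by exact_mod_cast hq
  set c : ℤ := ⌊(q * m₀ * γ : ℝ)⌋ with hc
  set s : ℕ → ℕ := fun j => ((c + j * a) % q).toNat with hs
  have hs0 : ∀ j, ((s j : ℕ) : ℤ) = (c + j * a) % q := fun j =>
    Int.toNat_of_nonneg (Int.emod_nonneg _ hqz.ne')
  have hslt : ∀ j, s j < q := fun j => by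
    have := Int.emod_lt_of_pos (c + j * a) hqz
    rw [← hs0] at this; exact_mod_cast this
  have hinj : Set.InjOn s (range q : Set ℕ) := by
    intro i hi j hj hij
    have h1 : (c + i * a) % q = (c + j * a) % q := by rw [← hs0, ← hs0, hij]
    have h2 : (q : ℤ) ∣ (i - j) * a := by
      have h3 := Int.ModEq.dvd (a := c + j * a) (b := c + i * a) h1.symm
      convert h3 using 1; ring
    have h3 : (q : ℤ) ∣ (i - j) := haq.symm.dvd_of_dvd_mul_right h2
    simp only [coe_range, Set.mem_Iio] at hi hj
    have := Int.eq_zero_of_abs_lt_dvd h3 (by rw [abs_lt]; omega)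
    omega
  have hpt : ∀ j ∈ range q, geomBound X (((m₀ + j : ℕ) : ℝ) * γ) ≤
      residueBound X q (s j) + residueBound X q (q - s j) := by
    intro j hj
    have hjq : (j : ℝ) ≤ q := by exact_mod_cast (mem_range.1 hj).le
    set e : ℝ := (q * m₀ * γ - c) + q * j * (γ - a / q) with he
    have he2 : |e| ≤ 2 := by
      have h1 : |(q * m₀ * γ - c : ℝ)| ≤ 1 := by
        rw [abs_le]
        constructor
        · linarith [Int.floor_le (q * m₀ * γ : ℝ)]
        · linarith [Int.lt_floor_add_one (q * m₀ * γ : ℝ)]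
      have h2 : |q * j * (γ - a / q)| ≤ 1 := by
        rw [abs_mul, abs_of_nonneg (by positivity)]
        calc q * j * |γ - a / q| ≤ q * q * (1 / (q : ℝ) ^ 2) := by gcongr
          _ = 1 := by field_simp
      calc |e| ≤ _ := abs_add_le _ _
        _ ≤ 2 := by linarith
    have hx : (q : ℝ) * (((m₀ + j : ℕ) : ℝ) * γ) =
        ((s j : ℤ) : ℝ) + q * (((c + j * a) / q : ℤ) : ℝ) + e := by
      have h1 : ((c + j * a : ℤ) : ℝ) = ((s j : ℤ) : ℝ) + q * (((c + j * a) / q : ℤ) : ℝ) := by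
        rw [hs0]
        exact_mod_cast (Int.emod_add_mul_ediv (c + j * a) q).symm
      rw [← h1, he]
      push_cast
      field_simp
      ring
    have hd := sub_two_div_le_distInt hq hx he2
    rcases le_total (s j : ℤ) (q - s j) with h | h
    · rw [min_eq_left h] at hd
      have := geomBound_le_residueBound (X := X) (i := s j) hq (by exact_mod_cast hd)
      exact this.trans (le_add_of_nonneg_right (residueBound_nonneg X q (q - s j)))
    · rw [min_eq_right h] at hd
      have := geomBound_le_residueBound (X := X) (i := q - s j) (γ := ((m₀ + j : ℕ) : ℝ) * γ) hq (by
        rw [Nat.cast_sub (hslt j).le]; push_cast at hd ⊢; exact hd)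
      exact this.trans (le_add_of_nonneg_left (residueBound_nonneg X q (s j)))
  calc _ ≤ ∑ j ∈ range q, (residueBound X q (s j) + residueBound X q (q - s j)) := sum_le_sum hpt
    _ = ∑ i ∈ (range q).image s, (residueBound X q i + residueBound X q (q - i)) := by
        rw [sum_image hinj]
    _ ≤ ∑ i ∈ range q, (residueBound X q i + residueBound X q (q - i)) := by
        apply sum_le_sum_of_subset_of_nonneg
        · intro i hi
          obtain ⟨j, _, rfl⟩ := mem_image.1 hi
          exact mem_range.2 (hslt j)
        · intro i _ _
          exact add_nonneg (residueBound_nonneg _ _ _) (residueBound_nonneg _ _ _)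
    _ ≤ (residueBound X q 0 + ∑ i ∈ range q, residueBound X q (i + 1)) +
        ∑ i ∈ range q, residueBound X q (i + 1) := by
        rw [sum_add_distrib]
        apply add_le_add
        · rw [add_comm, ← sum_range_succ' (residueBound X q), sum_range_succ]
          linarith [residueBound_nonneg X q q]
        · apply le_of_eq
          rw [← sum_range_reflect]
          apply sum_congr rfl
          intro i hi
          have := mem_range.1 hi
          congr 1
          omega
    _ ≤ _ := by
        have h0 : residueBound X q 0 = 2 * X := by simp [residueBound]
        have := sum_residueBound_le X q hq
        rw [h0]
        linarith

lemma sum_geomBound_le {a : ℤ} {q : ℕ} (hq : 1 ≤ q) (haq : IsCoprime a q) {γ : ℝ}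
    (hγ : |γ - a / q| ≤ 1 / (q : ℝ) ^ 2) (X H : ℕ) :
    ∑ m ∈ Icc 1 H, geomBound X (m * γ) ≤
      ((H : ℝ) / q + 1) * (10 * X + 12 * q * (1 + Real.log q)) := by
  have hq0 : (0 : ℝ) < q := by exact_mod_cast hq
  set B : ℝ := 10 * X + 12 * q * (1 + Real.log q) with hB
  have hB0 : 0 ≤ B := by
    have : 0 ≤ Real.log q := Real.log_natCast_nonneg q
    positivity
  have hblocks : ∀ n : ℕ, ∑ m ∈ range (n * q), geomBound X (((1 + m : ℕ) : ℝ) * γ) ≤ n * B := by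
    intro n
    induction n with
    | zero => simp
    | succ n ih =>
      rw [add_mul, one_mul, sum_range_add]
      have := sum_geomBound_block hq haq hγ X (1 + n * q)
      push_cast at this ih ⊢
      simp only [add_assoc] at this ih ⊢
      linarith
  calc ∑ m ∈ Icc 1 H, geomBound X (m * γ)
      = ∑ m ∈ range H, geomBound X (((1 + m : ℕ) : ℝ) * γ) := by
        rw [← Ico_add_one_right_eq_Icc, sum_Ico_eq_sum_range, Nat.add_sub_cancel]
    _ ≤ ∑ m ∈ range ((H / q + 1) * q), geomBound X (((1 + m : ℕ) : ℝ) * γ) := by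
        apply sum_le_sum_of_subset_of_nonneg
        · apply range_subset_range.2
          have := Nat.lt_div_mul_add (a := H) (b := q) hq
          linarith
        · intros; exact geomBound_nonneg _ _
    _ ≤ ((H / q + 1 : ℕ) : ℝ) * B := hblocks _
    _ ≤ _ := by
        gcongr
        push_cast
        gcongr
        exact Nat.cast_div_le

/-- **Weyl's inequality** for phases of degree `j + 1` with leading coefficient `γ`. -/
theorem weyl_inequality {j : ℕ} (hj : 1 ≤ j) {ε : ℝ} (hε : 0 < ε) : ∃ C : ℝ, 1 ≤ C ∧
    ∀ (X : ℕ) (_ : 1 ≤ X) (a : ℤ) (q : ℕ) (_ : 1 ≤ q) (_ : q ≤ X ^ (j + 1))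
      (_ : IsCoprime a q) (γ : ℝ) (_ : |γ - a / q| ≤ 1 / (q : ℝ) ^ 2) (f : ℤ → ℝ)
      (_ : HasLead (j + 1) γ f) (A B : ℤ) (_ : B - A ≤ X),
      ‖∑ z ∈ Ico A B, eC (f z)‖ ^ (2 ^ j) ≤
        C * (X : ℝ) ^ (2 ^ j) * (X : ℝ) ^ ε * (1 / q + 1 / X + q / (X : ℝ) ^ (j + 1)) := by
  obtain ⟨C, hC1, hC⟩ := weylSum_le_sum_geomBound j (half_pos hε)
  set δ : ℝ := ε / (2 * (j + 1)) with hδ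
  have hδ0 : 0 < δ := by positivity
  set F : ℝ := ((j + 1).factorial : ℝ) with hF
  have hF1 : 1 ≤ F := by
    rw [hF]; exact_mod_cast Nat.one_le_iff_ne_zero.2 (Nat.factorial_ne_zero _)
  set D : ℝ := 1 + 1 / δ with hD
  have hD1 : 1 ≤ D := by have : 0 < 1 / δ := by positivity
                         linarith
  refine ⟨2 ^ (2 ^ j - (j + 1)) * (45 * C * F * D), ?_, ?_⟩
  · apply one_le_mul_of_one_le_of_one_le (one_le_pow₀ (by norm_num))
    apply one_le_mul_of_one_le_of_one_le _ hD1
    apply one_le_mul_of_one_le_of_one_le _ hF1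
    linarith
  intro X hX a q hq hqX haq γ hγ f hf A B hAB
  have hX1 : (1 : ℝ) ≤ X := by exact_mod_cast hX
  have hX0 : (0 : ℝ) < X := by linarith
  have hq0 : (0 : ℝ) < q := by exact_mod_cast hq
  have hq1 : (1 : ℝ) ≤ q := by exact_mod_cast hq
  set L : ℝ := (X : ℝ) ^ (ε / 2) with hL
  have hL1 : 1 ≤ L := Real.one_le_rpow hX1 (by positivity)
  have hLL : L * L = (X : ℝ) ^ ε := by
    rw [hL, ← Real.rpow_add hX0]; ring_nf
  have hlog : 1 + Real.log q ≤ D * L := by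
    have h1 : Real.log q ≤ (q : ℝ) ^ δ / δ := Real.log_le_rpow_div hq0.le hδ0
    have h2 : (q : ℝ) ^ δ ≤ L := by
      calc (q : ℝ) ^ δ ≤ ((X : ℝ) ^ (j + 1)) ^ δ := by
            gcongr; exact_mod_cast hqX
        _ = L := by
            rw [← Real.rpow_natCast, ← Real.rpow_mul hX0.le, hL]
            congr 1
            rw [hδ]; push_cast; field_simp
    calc 1 + Real.log q ≤ L + L / δ := by
          gcongr
          exact h1.trans (by gcongr)
      _ = D * L := by rw [hD]; ring
  have hw : weylSum X j γ ≤ (X : ℝ) ^ (j + 1) *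
      (45 * C * F * D * (X : ℝ) ^ ε * (1 / q + 1 / X + q / (X : ℝ) ^ (j + 1))) := by
    have h1 := sum_geomBound_le hq haq hγ X ((j + 1).factorial * X ^ j)
    have hXj : (X : ℝ) ≤ X ^ j := le_self_pow₀ hX1 (by omega)
    have h2 : ((((j + 1).factorial * X ^ j : ℕ) : ℝ) / q + 1) * (10 * X + 12 * q * (1 + Real.log q))
        ≤ F * (X ^ j / q + 1) * ((12 * D * L) * (X + q)) := by
      push_cast
      have hlog0 : 0 ≤ Real.log q := Real.log_natCast_nonneg q
      have hDL : (1 : ℝ) ≤ D * L := one_le_mul_of_one_le_of_one_le hD1 hL1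
      have h3 : 12 * q * (1 + Real.log q) ≤ 12 * q * (D * L) := by gcongr
      refine mul_le_mul ?_ ?_ (by positivity) (by positivity)
      · rw [mul_add, mul_one, mul_div_assoc]
        exact add_le_add le_rfl hF1
      · nlinarith
    calc weylSum X j γ ≤ C * X ^ j + C * L * (F * (X ^ j / q + 1) * ((12 * D * L) * (X + q))) := by
          refine (hC X hX γ).trans ?_
          gcongr
          exact h1.trans h2
      _ ≤ C * F * D * (L * L) * X ^ j + 12 * C * F * D * (L * L) * ((X ^ j / q + 1) * (X + q)) := by
          apply add_le_add
          · rw [mul_assoc C F, mul_assoc C]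
            gcongr
            apply le_mul_of_one_le_right (by linarith)
            exact one_le_mul_of_one_le_of_one_le (one_le_mul_of_one_le_of_one_le hF1 hD1)
              (one_le_mul_of_one_le_of_one_le hL1 hL1)
          · apply le_of_eq; ring
      _ = C * F * D * (L * L) * (X ^ j + 12 * ((X ^ j / q + 1) * (X + q))) := by ring
      _ ≤ C * F * D * (L * L) * (45 * (X ^ (j + 1) / q + X ^ j + q)) := by
          gcongr
          have e1 : ((X : ℝ) ^ j / q + 1) * (X + q) = X ^ (j + 1) / q + X ^ j + X + q := by
            field_simp
            ring
          rw [e1]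
          have : 0 ≤ (X : ℝ) ^ (j + 1) / q := by positivity
          linarith
      _ = _ := by
          rw [hLL]; field_simp; ring
  calc _ ≤ (2 * X : ℝ) ^ (2 ^ j - (j + 1)) * weylSum X j γ := norm_sum_pow_le_weylSum j hAB hf
    _ ≤ (2 * X : ℝ) ^ (2 ^ j - (j + 1)) * ((X : ℝ) ^ (j + 1) *
      (45 * C * F * D * (X : ℝ) ^ ε * (1 / q + 1 / X + q / (X : ℝ) ^ (j + 1)))) := by gcongr
    _ = _ := by
        have hp : (X : ℝ) ^ (2 ^ j) = X ^ (2 ^ j - (j + 1)) * X ^ (j + 1) := by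
          rw [← pow_add, Nat.sub_add_cancel (succ_le_two_pow j)]
        rw [mul_pow, hp]
        ring

/-! ### A Fourier-analytic Selberg majorant -/

lemma eC_eq_one_iff {x : ℝ} : eC x = 1 ↔ ∃ n : ℤ, x = n := by
  constructor
  · intro h
    have h1 := four_mul_distInt_le x
    rw [h, sub_self, norm_zero] at h1
    have h2 : distInt x = 0 := by linarith [distInt_nonneg x]
    exact ⟨round x, by rw [distInt, abs_eq_zero, sub_eq_zero] at h2; exact h2⟩
  · rintro ⟨n, rfl⟩
    exact eC_int n

lemma eC_nat_mul (a : ℕ) (x : ℝ) : eC (a * x) = eC x ^ a := by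
  unfold eC
  rw [← Complex.exp_nat_mul]
  push_cast
  ring_nf

lemma sum_range_eC_eq_zero {d : ℕ} {x : ℝ} (hx : ∃ m : ℤ, d * x = m) (h : ¬ ∃ n : ℤ, x = n) :
    ∑ a ∈ range d, eC (a * x) = 0 := by
  simp only [eC_nat_mul]
  have h1 := geom_sum_mul (eC x) d
  rw [← eC_nat_mul, eC_eq_one_iff.2 hx, sub_self] at h1
  refine (mul_eq_zero.1 h1).resolve_right ?_
  rw [sub_eq_zero]
  exact fun h2 => h (eC_eq_one_iff.1 h2)

/-- The reduced residues modulo `q`. -/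
def reducedResidues (q : ℕ) : Finset ℕ := {a ∈ range q | q.Coprime a}

lemma card_reducedResidues (q : ℕ) : #(reducedResidues q) = q.totient := rfl

open ArithmeticFunction in
lemma sum_divisors_moebius (n : ℕ) :
    ∑ d ∈ n.divisors, moebius d = if n = 1 then 1 else 0 := by
  rw [← coe_mul_zeta_apply, moebius_mul_coe_zeta, one_apply]

open ArithmeticFunction in
/-- The Ramanujan sum at an argument coprime to the modulus. -/
lemma sum_reducedResidues_eC {q n : ℕ} (hq : 1 ≤ q) (hqn : q.Coprime n) :
    ∑ a ∈ reducedResidues q, eC (a * ((n : ℝ) / q)) = (moebius q : ℂ) := by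
  have h1 : ∑ a ∈ reducedResidues q, eC (a * ((n : ℝ) / q)) =
      ∑ d ∈ q.divisors, (moebius d : ℂ) *
        ∑ a ∈ range q with d ∣ a, eC (a * ((n : ℝ) / q)) := by
    rw [reducedResidues, sum_filter]
    simp only [mul_sum, sum_filter]
    rw [sum_comm]
    apply sum_congr rfl
    intro a ha
    have h2 := sum_divisors_moebius (q.gcd a)
    have h3 : q.divisors.filter (· ∣ a) = (q.gcd a).divisors := by
      ext d
      simp only [mem_filter, Nat.mem_divisors, Nat.dvd_gcd_iff, ne_eq, Nat.gcd_eq_zero_iff]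
      constructor
      · rintro ⟨⟨h1, h2⟩, h3⟩; exact ⟨⟨h1, h3⟩, fun h => h2 h.1⟩
      · rintro ⟨⟨h1, h3⟩, _⟩; exact ⟨⟨h1, by omega⟩, h3⟩
    calc (if q.Coprime a then eC (a * ((n : ℝ) / q)) else 0)
        = ((∑ d ∈ (q.gcd a).divisors, moebius d : ℤ) : ℂ) * eC (a * ((n : ℝ) / q)) := by
          rw [h2]
          by_cases h : q.Coprime a
          · rw [if_pos h, if_pos h]; simp
          · rw [if_neg h, if_neg h]; simp
      _ = _ := by
          rw [← h3, sum_filter]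
          push_cast
          rw [sum_mul]
          apply sum_congr rfl
          intro d _
          split_ifs <;> simp
  have h2 : ∀ d ∈ q.divisors, ∑ a ∈ range q with d ∣ a, eC (a * ((n : ℝ) / q)) =
      if d = q then 1 else 0 := by
    intro d hd
    obtain ⟨⟨e, rfl⟩, -⟩ := Nat.mem_divisors.1 hd
    have hd0 : 0 < d := Nat.pos_of_ne_zero (by rintro rfl; simp at hq)
    have he0 : 0 < e := Nat.pos_of_ne_zero (by rintro rfl; simp at hq)
    have hd0' : (d : ℝ) ≠ 0 := by positivity
    have he0' : (e : ℝ) ≠ 0 := by positivity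
    have h3 : ∑ a ∈ range (d * e) with d ∣ a, eC (a * ((n : ℝ) / (d * e : ℕ))) =
        ∑ a ∈ range e, eC (a * ((n : ℝ) / e)) := by
      symm
      apply sum_bij (fun a _ => d * a)
      · intro a ha
        exact mem_filter.2 ⟨mem_range.2 (Nat.mul_lt_mul_of_pos_left (mem_range.1 ha) hd0),
          Dvd.intro _ rfl⟩
      · intro a _ b _ h; exact Nat.eq_of_mul_eq_mul_left hd0 h
      · intro b hb
        obtain ⟨hb1, c, rfl⟩ := mem_filter.1 hb
        exact ⟨c, mem_range.2 (Nat.lt_of_mul_lt_mul_left (mem_range.1 hb1)), rfl⟩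
      · intro a _
        congr 1; push_cast; field_simp
    rw [h3]
    by_cases he : e = 1
    · subst he; simp [eC_zero]
    · have hne : d ≠ d * e := fun h => he (Nat.eq_of_mul_eq_mul_left hd0 (by linarith))
      rw [if_neg hne]
      apply sum_range_eC_eq_zero
      · exact ⟨n, by field_simp; simp⟩
      · rintro ⟨m, hm⟩
        rw [div_eq_iff he0'] at hm
        have hdvd : (e : ℤ) ∣ n := ⟨m, by have : ((n : ℤ) : ℝ) = ((m * e : ℤ) : ℝ) := by
                                            push_cast; exact hm
                                          rw [mul_comm]; exact_mod_cast this⟩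
        have hdvd' : e ∣ n := by exact_mod_cast hdvd
        have := Nat.dvd_gcd (Dvd.intro_left d rfl : e ∣ d * e) hdvd'
        rw [hqn] at this
        exact he (Nat.dvd_one.1 this)
  rw [h1, sum_congr rfl (fun d hd => by rw [h2 d hd])]
  simp [Nat.mem_divisors]
  omega

/-- The squarefree moduli up to `R` coprime to `L`. -/
def sieveModuli (L R : ℕ) : Finset ℕ := {q ∈ Icc 1 R | Squarefree q ∧ q.Coprime L}

noncomputable def sieveMass (L R : ℕ) : ℝ := ∑ q ∈ sieveModuli L R, 1 / (q.totient : ℝ)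

lemma mem_sieveModuli {L R q : ℕ} :
    q ∈ sieveModuli L R ↔ (1 ≤ q ∧ q ≤ R) ∧ Squarefree q ∧ q.Coprime L := by
  simp [sieveModuli]

lemma one_le_sieveMass {L R : ℕ} (hR : 1 ≤ R) : 1 ≤ sieveMass L R := by
  have h1 : 1 ∈ sieveModuli L R := mem_sieveModuli.2 ⟨⟨le_rfl, hR⟩, squarefree_one, by simp⟩
  have := single_le_sum (f := fun q : ℕ => 1 / (q.totient : ℝ)) (fun _ _ => by positivity) h1
  simpa [sieveMass] using this

lemma sum_inv_factoredNumbers_le {n : ℕ} (hn : 1 ≤ n) (s : Finset ℕ)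
    (hs : ∀ m ∈ s, m ≠ 0 ∧ m.primeFactors ⊆ n.primeFactors) :
    ∑ m ∈ s, 1 / (m : ℝ) ≤ n / n.totient := by
  let f : ℕ →* ℝ := ⟨⟨fun m => (m : ℝ)⁻¹, by simp⟩, by intro a b; push_cast; rw [mul_inv]⟩
  have hf : ∀ m, f m = (m : ℝ)⁻¹ := fun m => rfl
  have hlt : ∀ {p : ℕ}, p.Prime → ‖f p‖ < 1 := by
    intro p hp
    rw [hf, norm_inv, Real.norm_natCast]
    exact inv_lt_one_of_one_lt₀ (by exact_mod_cast hp.one_lt)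
  obtain ⟨hsum, hhas⟩ :=
    EulerProduct.summable_and_hasSum_factoredNumbers_prod_filter_prime_geometric (f := f) hlt
      n.primeFactors
  have hprod : ∏ p ∈ n.primeFactors with p.Prime, (1 - f p)⁻¹ = (n : ℝ) / n.totient := by
    rw [filter_true_of_mem (fun p hp => Nat.prime_of_mem_primeFactors hp), prod_inv_distrib]
    have h1 : (n.totient : ℝ) = n * ∏ p ∈ n.primeFactors, (1 - (p : ℝ)⁻¹) := by
      have := congrArg (Rat.cast (K := ℝ)) (Nat.totient_eq_mul_prod_factors n)
      push_cast at this
      exact this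
    have hn0 : (n : ℝ) ≠ 0 := by positivity
    simp only [hf]
    rw [h1, div_mul_eq_div_div, div_self hn0, one_div]
  rw [hprod] at hhas
  have hinj : ∀ m ∈ s, m ∈ Nat.factoredNumbers n.primeFactors := fun m hm =>
    Nat.mem_factoredNumbers_iff_primeFactors_subset.2 (hs m hm)
  have h2 : ∑ m ∈ s, 1 / (m : ℝ) = ∑ m ∈ s.subtype (· ∈ Nat.factoredNumbers n.primeFactors),
      f (m : ℕ) := by
    rw [sum_subtype_of_mem (f := fun m => f m) hinj]
    simp [hf]
  rw [h2]
  exact sum_le_hasSum _ (fun m _ => by rw [hf]; positivity) hhas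

lemma log_le_sum_inv (R : ℕ) : Real.log R ≤ ∑ n ∈ Icc 1 R, 1 / (n : ℝ) := by
  rcases Nat.eq_zero_or_pos R with rfl | hR
  · simp
  have h := log_add_one_le_harmonic R
  rw [harmonic_eq_sum_Icc] at h
  push_cast at h
  simp only [one_div]
  refine le_trans ?_ h
  apply Real.log_le_log (by exact_mod_cast hR)
  linarith

lemma totient_div_mul_log_le_sieveMass {L : ℕ} (hL : 1 ≤ L) (R : ℕ) :
    (L.totient : ℝ) / L * Real.log R ≤ sieveMass L R := by
  set g : ℕ → ℕ := fun n => ∏ p ∈ n.primeFactors \ L.primeFactors, p with hg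
  have hprime : ∀ n : ℕ, ∀ p ∈ n.primeFactors \ L.primeFactors, p.Prime := fun n p hp =>
    Nat.prime_of_mem_primeFactors (mem_sdiff.1 hp).1
  have hgdvd : ∀ n : ℕ, n ≠ 0 → g n ∣ n := fun n hn =>
    (prod_dvd_prod_of_subset _ _ _ sdiff_subset).trans (Nat.prod_primeFactors_dvd n)
  have hgpf : ∀ n : ℕ, (g n).primeFactors = n.primeFactors \ L.primeFactors := fun n =>
    Nat.primeFactors_prod (hprime n)
  have hmaps : ∀ n ∈ Icc 1 R, g n ∈ sieveModuli L R := by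
    intro n hn
    rw [mem_Icc] at hn
    have hd := hgdvd n (by omega)
    have hpos : 0 < g n := Nat.pos_of_dvd_of_pos hd (by omega)
    refine mem_sieveModuli.2 ⟨⟨hpos, (Nat.le_of_dvd (by omega) hd).trans hn.2⟩, ?_, ?_⟩
    · rw [hg]
      apply Finset.squarefree_prod_of_pairwise_isCoprime
      · intro p hp r hr hpr
        exact Nat.coprime_iff_isRelPrime.1
          ((Nat.coprime_primes (hprime n p hp) (hprime n r hr)).2 hpr)
      · exact fun p hp => (hprime n p hp).squarefree
    · rw [← Nat.disjoint_primeFactors hpos.ne' (by omega), hgpf]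
      exact sdiff_disjoint
  have hLt : (0 : ℝ) < L.totient := by exact_mod_cast Nat.totient_pos.2 hL
  have hL0 : (0 : ℝ) < L := by exact_mod_cast hL
  have key : ∑ n ∈ Icc 1 R, 1 / (n : ℝ) ≤ sieveMass L R * (L / L.totient) := by
    rw [← sum_fiberwise_of_maps_to hmaps, sieveMass, sum_mul]
    apply sum_le_sum
    intro q hq
    obtain ⟨⟨hq1, -⟩, -, hqL⟩ := mem_sieveModuli.1 hq
    have hq0 : (0 : ℝ) < q := by exact_mod_cast hq1
    have hqt : (0 : ℝ) < q.totient := by exact_mod_cast Nat.totient_pos.2 hq1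
    set s := (Icc 1 R).filter (fun n => g n = q) with hs
    have hdvd : ∀ n ∈ s, q ∣ n ∧ n ≠ 0 ∧ n.primeFactors \ L.primeFactors = q.primeFactors := by
      intro n hn
      obtain ⟨h1, h2⟩ := mem_filter.1 hn
      rw [mem_Icc] at h1
      exact ⟨h2 ▸ hgdvd n (by omega), by omega, by rw [← h2, hgpf]⟩
    have hinj : Set.InjOn (fun n => n / q) (s : Set ℕ) := by
      intro a ha b hb hab
      have h1 := (hdvd a ha).1
      have h2 := (hdvd b hb).1
      rw [← Nat.div_mul_cancel h1, ← Nat.div_mul_cancel h2]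
      exact congrArg (· * q) hab
    have h1 : ∑ n ∈ s, 1 / (n : ℝ) = 1 / q * ∑ m ∈ s.image (fun n => n / q), 1 / (m : ℝ) := by
      rw [sum_image hinj, mul_sum]
      apply sum_congr rfl
      intro n hn
      rw [Nat.cast_div (hdvd n hn).1 hq0.ne']
      field_simp
    have h2 := sum_inv_factoredNumbers_le (n := L * q) (Nat.mul_pos hL hq1)
      (s.image (fun n => n / q)) (by
        intro m hm
        obtain ⟨n, hn, rfl⟩ := mem_image.1 hm
        obtain ⟨h1, h2, h3⟩ := hdvd n hn
        have h4 : n / q ∣ n := Nat.div_dvd_of_dvd h1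
        refine ⟨fun h => h2 (Nat.eq_zero_of_zero_dvd (h ▸ h4)), ?_⟩
        rw [Nat.primeFactors_mul (by omega) (by omega), ← h3]
        refine (Nat.primeFactors_mono h4 h2).trans ?_
        intro p hp
        by_cases hpL : p ∈ L.primeFactors
        · exact mem_union_left _ hpL
        · exact mem_union_right _ (mem_sdiff.2 ⟨hp, hpL⟩))
    rw [Nat.totient_mul hqL.symm] at h2
    push_cast at h2
    rw [h1]
    calc 1 / (q : ℝ) * _ ≤ 1 / q * (L * q / (L.totient * q.totient)) := by gcongr
      _ = _ := by field_simp
  have h := (log_le_sum_inv R).trans key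
  calc (L.totient : ℝ) / L * Real.log R
      ≤ (L.totient : ℝ) / L * (sieveMass L R * (L / L.totient)) := by
        gcongr
    _ = _ := by field_simp

noncomputable def sieveSum (L R : ℕ) (n : ℕ) : ℂ :=
  ∑ q ∈ sieveModuli L R, ∑ a ∈ reducedResidues q,
    (((ArithmeticFunction.moebius q : ℝ) / q.totient : ℝ) : ℂ) * eC (a * ((n : ℝ) / q))

/-- The Selberg majorant, up to a constant, of the primes exceeding `R`. -/
noncomputable def sieveWeight (L R : ℕ) (n : ℕ) : ℝ := ‖sieveSum L R n‖ ^ 2 / sieveMass L R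

lemma sieveMass_nonneg (L R : ℕ) : 0 ≤ sieveMass L R := sum_nonneg fun _ _ => by positivity

lemma sieveWeight_nonneg (L R n : ℕ) : 0 ≤ sieveWeight L R n :=
  div_nonneg (by positivity) (sieveMass_nonneg L R)

lemma sieveWeight_eq_sieveMass {L R p : ℕ} (hR : 1 ≤ R) (hp : p.Prime) (hpR : R < p) :
    sieveWeight L R p = sieveMass L R := by
  have h1 : sieveSum L R p = (sieveMass L R : ℂ) := by
    rw [sieveSum, sieveMass]
    push_cast
    apply sum_congr rfl
    intro q hq
    obtain ⟨⟨hq1, hqR⟩, hsq, -⟩ := mem_sieveModuli.1 hq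
    have hcop : q.Coprime p := (Nat.coprime_of_lt_prime (by omega) (by omega) hp).symm
    rw [← mul_sum, sum_reducedResidues_eC hq1 hcop]
    have h2 : (ArithmeticFunction.moebius q : ℂ) * ArithmeticFunction.moebius q = 1 := by
      have := ArithmeticFunction.moebius_sq_eq_one_of_squarefree hsq
      rw [sq] at this
      exact_mod_cast this
    rw [div_mul_eq_mul_div, h2]
  have h0 := one_le_sieveMass (L := L) hR
  rw [sieveWeight, h1, Complex.norm_real, Real.norm_of_nonneg (by linarith), sq]
  field_simp

/-- The sum over pairs of reduced fractions with sieve moduli as denominators. -/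
noncomputable def pairSum (L R : ℕ) (F : ℕ → ℕ → ℕ → ℕ → ℝ) : ℝ :=
  ∑ q₁ ∈ sieveModuli L R, ∑ a₁ ∈ reducedResidues q₁, ∑ q₂ ∈ sieveModuli L R,
    ∑ a₂ ∈ reducedResidues q₂, 1 / ((q₁.totient : ℝ) * q₂.totient) * F q₁ a₁ q₂ a₂

lemma pairSum_le_pairSum {L R : ℕ} {F F' : ℕ → ℕ → ℕ → ℕ → ℝ}
    (h : ∀ q₁ ∈ sieveModuli L R, ∀ a₁ ∈ reducedResidues q₁, ∀ q₂ ∈ sieveModuli L R,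
      ∀ a₂ ∈ reducedResidues q₂, F q₁ a₁ q₂ a₂ ≤ F' q₁ a₁ q₂ a₂) :
    pairSum L R F ≤ pairSum L R F' := by
  unfold pairSum
  gcongr with q₁ h₁ a₁ h₂ q₂ h₃ a₂ h₄
  exact h q₁ h₁ a₁ h₂ q₂ h₃ a₂ h₄

lemma pairSum_add (L R : ℕ) (F F' : ℕ → ℕ → ℕ → ℕ → ℝ) :
    pairSum L R (fun q₁ a₁ q₂ a₂ => F q₁ a₁ q₂ a₂ + F' q₁ a₁ q₂ a₂) =
      pairSum L R F + pairSum L R F' := by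
  simp only [pairSum, mul_add, sum_add_distrib]

lemma pairSum_mul_left (L R : ℕ) (c : ℝ) (F : ℕ → ℕ → ℕ → ℕ → ℝ) :
    pairSum L R (fun q₁ a₁ q₂ a₂ => c * F q₁ a₁ q₂ a₂) = c * pairSum L R F := by
  simp only [pairSum, mul_sum]
  refine sum_congr rfl fun _ _ => sum_congr rfl fun _ _ => sum_congr rfl fun _ _ =>
    sum_congr rfl fun _ _ => by ring

lemma pairSum_one_le (L R : ℕ) : pairSum L R (fun _ _ _ _ => 1) ≤ (R : ℝ) ^ 2 := by
  have h1 : pairSum L R (fun _ _ _ _ => 1) = (#(sieveModuli L R) : ℝ) ^ 2 := by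
    unfold pairSum
    have : ∀ q₁ ∈ sieveModuli L R, ∑ a₁ ∈ reducedResidues q₁, ∑ q₂ ∈ sieveModuli L R,
        ∑ a₂ ∈ reducedResidues q₂, 1 / ((q₁.totient : ℝ) * q₂.totient) * 1 =
        #(sieveModuli L R) := by
      intro q₁ hq₁
      have h1 : (0 : ℝ) < q₁.totient := by
        exact_mod_cast Nat.totient_pos.2 (mem_sieveModuli.1 hq₁).1.1
      simp only [sum_const, card_reducedResidues, nsmul_eq_mul, mul_one]
      rw [sum_congr rfl (g := fun _ => 1 / (q₁.totient : ℝ))]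
      · rw [sum_const, nsmul_eq_mul]; field_simp
      · intro q₂ hq₂
        have h2 : (0 : ℝ) < q₂.totient := by
          exact_mod_cast Nat.totient_pos.2 (mem_sieveModuli.1 hq₂).1.1
        field_simp
    rw [sum_congr rfl this, sum_const, nsmul_eq_mul, sq]
  rw [h1]
  have : #(sieveModuli L R) ≤ R := by
    calc _ ≤ #(Icc 1 R) := card_filter_le _ _
      _ = R := by simp
  gcongr

lemma norm_sum_sieveWeight_mul_eC_le (L R c : ℕ) (s : Finset ℕ) (g : ℕ → ℝ) :
    ‖∑ z ∈ s, (sieveWeight L R (L * z + c) : ℂ) * eC (g z)‖ ≤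
      1 / sieveMass L R * pairSum L R (fun q₁ a₁ q₂ a₂ =>
        ‖∑ z ∈ s, eC (g z + L * ((a₁ : ℝ) / q₁ - a₂ / q₂) * z)‖) := by
  set h : ℕ → ℝ := fun q => (ArithmeticFunction.moebius q : ℝ) / q.totient with hh
  have hnorm : ∀ q, |h q| ≤ 1 / (q.totient : ℝ) := by
    intro q
    rw [hh, abs_div, Nat.abs_cast]
    gcongr
    exact_mod_cast ArithmeticFunction.abs_moebius_le_one
  have hexp : ∀ n : ℕ, (sieveWeight L R n : ℂ) = 1 / (sieveMass L R : ℂ) *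
      ∑ q₁ ∈ sieveModuli L R, ∑ a₁ ∈ reducedResidues q₁, ∑ q₂ ∈ sieveModuli L R,
        ∑ a₂ ∈ reducedResidues q₂, ((h q₁ * h q₂ : ℝ) : ℂ) *
          eC (n * ((a₁ : ℝ) / q₁ - a₂ / q₂)) := by
    intro n
    have : (sieveWeight L R n : ℂ) =
        1 / (sieveMass L R : ℂ) * ((starRingEnd ℂ) (sieveSum L R n) * sieveSum L R n) := by
      rw [mul_comm ((starRingEnd ℂ) _), Complex.mul_conj, Complex.normSq_eq_norm_sq, sieveWeight]
      push_cast; ring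
    rw [this]
    congr 1
    simp only [sieveSum, map_sum, map_mul, Complex.conj_ofReal, conj_eC, sum_mul, mul_sum]
    refine sum_congr rfl fun q₁ _ => sum_congr rfl fun a₁ _ => sum_congr rfl fun q₂ _ =>
      sum_congr rfl fun a₂ _ => ?_
    have : (n : ℝ) * ((a₁ : ℝ) / q₁ - a₂ / q₂) = a₁ * ((n : ℝ) / q₁) + -(a₂ * ((n : ℝ) / q₂)) := by
      ring
    rw [this, eC_add]
    push_cast [hh]
    ring
  have hsum : ∑ z ∈ s, (sieveWeight L R (L * z + c) : ℂ) * eC (g z) = 1 / (sieveMass L R : ℂ) *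
      ∑ q₁ ∈ sieveModuli L R, ∑ a₁ ∈ reducedResidues q₁, ∑ q₂ ∈ sieveModuli L R,
        ∑ a₂ ∈ reducedResidues q₂, ((h q₁ * h q₂ : ℝ) : ℂ) *
          (eC (c * ((a₁ : ℝ) / q₁ - a₂ / q₂)) *
            ∑ z ∈ s, eC (g z + L * ((a₁ : ℝ) / q₁ - a₂ / q₂) * z)) := by
    simp only [hexp, mul_sum, sum_mul]
    rw [sum_comm]
    refine sum_congr rfl fun q₁ _ => ?_
    rw [sum_comm]
    refine sum_congr rfl fun a₁ _ => ?_
    rw [sum_comm]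
    refine sum_congr rfl fun q₂ _ => ?_
    rw [sum_comm]
    refine sum_congr rfl fun a₂ _ => sum_congr rfl fun z _ => ?_
    have : ((L * z + c : ℕ) : ℝ) * ((a₁ : ℝ) / q₁ - a₂ / q₂) =
      c * ((a₁ : ℝ) / q₁ - a₂ / q₂) + L * ((a₁ : ℝ) / q₁ - a₂ / q₂) * z := by push_cast; ring
    rw [this, eC_add, eC_add (g z)]
    ring
  rw [hsum, norm_mul]
  refine mul_le_mul (le_of_eq ?_) ?_ (norm_nonneg _) (one_div_nonneg.2 (sieveMass_nonneg L R))
  · rw [norm_div, norm_one, Complex.norm_real, Real.norm_of_nonneg (sieveMass_nonneg L R)]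
  · unfold pairSum
    refine norm_sum_le_of_le _ fun q₁ _ => norm_sum_le_of_le _ fun a₁ _ =>
      norm_sum_le_of_le _ fun q₂ _ => norm_sum_le_of_le _ fun a₂ _ => ?_
    rw [norm_mul, norm_mul, norm_eC, one_mul, Complex.norm_real, Real.norm_eq_abs, abs_mul,
      ← one_div_mul_one_div]
    gcongr <;> exact hnorm _

/-! ### Counting pairs of fractions whose difference is a fraction with given denominator -/

lemma coprime_div_gcd_of_squarefree {m : ℕ} (hm : Squarefree m) (q : ℕ) :
    (m / m.gcd q).Coprime q := by
  have hm0 : m ≠ 0 := hm.ne_zero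
  have hg : m.gcd q ∣ m := Nat.gcd_dvd_left m q
  apply Nat.Coprime.symm
  rw [Nat.coprime_iff_gcd_eq_one] at *
  by_contra h
  obtain ⟨p, hp, hpd⟩ := Nat.exists_prime_and_dvd h
  have h1 : p ∣ q := hpd.trans (Nat.gcd_dvd_left _ _)
  have h2 : p ∣ m / m.gcd q := hpd.trans (Nat.gcd_dvd_right _ _)
  have h3 : p ∣ m.gcd q := Nat.dvd_gcd (h2.trans (Nat.div_dvd_of_dvd hg)) h1
  have h4 : p * p ∣ m := by
    rw [← Nat.div_mul_cancel hg]; exact mul_dvd_mul h2 h3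
  exact hp.one_lt.ne' (Nat.isUnit_iff.1 (hm p h4))

lemma div_gcd_dvd_div_gcd {q q₁ q₂ a₁ : ℕ} {a₂ : ℤ} (h₁ : Squarefree q₁)
    (hc₁ : q₁.Coprime a₁) (h : (q₁ : ℤ) * q₂ ∣ q * (a₁ * q₂ - a₂ * q₁)) :
    q₁ / q₁.gcd q ∣ q₂ / q₂.gcd q := by
  have h2 : (q₁ : ℤ) ∣ (a₁ * (q * q₂) : ℕ) := by
    have h3 := (Dvd.intro _ rfl : (q₁ : ℤ) ∣ q₁ * q₂).trans h
    have h4 : (q₁ : ℤ) ∣ q₁ * (q * a₂) := Dvd.intro _ rfl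
    have h5 : ((a₁ * (q * q₂) : ℕ) : ℤ) = q * (a₁ * q₂ - a₂ * q₁) + q₁ * (q * a₂) := by
      push_cast; ring
    rw [h5]
    exact dvd_add h3 h4
  have h3 : q₁ ∣ q * q₂ := hc₁.dvd_of_dvd_mul_left (by exact_mod_cast h2)
  have hcop := coprime_div_gcd_of_squarefree h₁ q
  have h4 : q₁ / q₁.gcd q ∣ q₂ :=
    hcop.dvd_of_dvd_mul_left ((Nat.div_dvd_of_dvd (Nat.gcd_dvd_left q₁ q)).trans h3)
  rw [← Nat.mul_div_cancel' (Nat.gcd_dvd_left q₂ q)] at h4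
  exact (hcop.coprime_dvd_right (Nat.gcd_dvd_right q₂ q)).dvd_of_dvd_mul_left h4

lemma pairSum_ite_le {L R q : ℕ} (hq : 1 ≤ q) (P : ℕ → ℕ → ℕ → ℕ → Prop)
    [∀ q₁ a₁ q₂ a₂, Decidable (P q₁ a₁ q₂ a₂)] (ν : ℕ → ℝ)
    (hν : ∀ g, 0 ≤ ν g)
    (hP : ∀ q₁ ∈ sieveModuli L R, ∀ a₁ ∈ reducedResidues q₁, ∀ q₂ ∈ sieveModuli L R,
      ∀ a₂ ∈ reducedResidues q₂, P q₁ a₁ q₂ a₂ →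
        (q₁ : ℤ) * q₂ ∣ q * ((a₁ : ℤ) * q₂ - (a₂ : ℤ) * q₁))
    (hcount : ∀ q₁ ∈ sieveModuli L R, ∀ a₁ ∈ reducedResidues q₁, ∀ q₂ ∈ sieveModuli L R,
      (#{a₂ ∈ reducedResidues q₂ | P q₁ a₁ q₂ a₂} : ℝ) ≤ ν (q₂.gcd q)) :
    pairSum L R (fun q₁ a₁ q₂ a₂ => if P q₁ a₁ q₂ a₂ then 1 else 0) ≤
      sieveMass L R * #q.divisors * ∑ g ∈ q.divisors, ν g / g.totient := by
  have htp : ∀ q₁ ∈ sieveModuli L R, (0 : ℝ) < q₁.totient := fun q₁ h => by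
    exact_mod_cast Nat.totient_pos.2 (mem_sieveModuli.1 h).1.1
  set T : Finset (ℕ × ℕ) := {x ∈ sieveModuli L R ×ˢ sieveModuli L R |
    x.1 / x.1.gcd q = x.2 / x.2.gcd q} with hT
  have h1 : pairSum L R (fun q₁ a₁ q₂ a₂ => if P q₁ a₁ q₂ a₂ then 1 else 0) ≤
      ∑ x ∈ T, ν (x.2.gcd q) / x.2.totient := by
    rw [hT, sum_filter, sum_product]
    unfold pairSum
    apply sum_le_sum
    intro q₁ hq₁
    rw [sum_comm]
    apply sum_le_sum
    intro q₂ hq₂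
    simp only
    have hcase : ∀ a₁ ∈ reducedResidues q₁, ∑ a₂ ∈ reducedResidues q₂,
        1 / ((q₁.totient : ℝ) * q₂.totient) * (if P q₁ a₁ q₂ a₂ then 1 else 0) ≤
        if q₁ / q₁.gcd q = q₂ / q₂.gcd q then
          1 / (q₁.totient : ℝ) * (ν (q₂.gcd q) / q₂.totient) else 0 := by
      intro a₁ ha₁
      rw [← mul_sum, ← sum_filter, sum_const, nsmul_eq_mul, mul_one]
      split_ifs with ht
      · calc _ ≤ 1 / ((q₁.totient : ℝ) * q₂.totient) * ν (q₂.gcd q) := by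
              gcongr
              exact hcount q₁ hq₁ a₁ ha₁ q₂ hq₂
          _ = _ := by field_simp
      · have : #{a₂ ∈ reducedResidues q₂ | P q₁ a₁ q₂ a₂} = 0 := by
          rw [card_eq_zero, filter_eq_empty_iff]
          intro a₂ ha₂ hPa
          have hd := hP q₁ hq₁ a₁ ha₁ q₂ hq₂ a₂ ha₂ hPa
          apply ht
          apply Nat.dvd_antisymm
          · exact div_gcd_dvd_div_gcd (mem_sieveModuli.1 hq₁).2.1 (mem_filter.1 ha₁).2 hd
          · refine div_gcd_dvd_div_gcd (a₁ := a₂) (a₂ := a₁) (mem_sieveModuli.1 hq₂).2.1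
              (mem_filter.1 ha₂).2 ?_
            have h5 : (q : ℤ) * ((a₂ : ℤ) * q₁ - a₁ * q₂) = -(q * (a₁ * q₂ - a₂ * q₁)) := by ring
            rw [mul_comm, h5, dvd_neg]
            exact hd
        rw [this]; simp
    refine (sum_le_sum hcase).trans ?_
    rw [sum_const, card_reducedResidues, nsmul_eq_mul]
    split_ifs
    · have := htp q₁ hq₁
      apply le_of_eq; field_simp
    · simp
  refine h1.trans ?_
  have hcop : ∀ q₂ ∈ sieveModuli L R, q₂.totient =
      (q₂ / q₂.gcd q).totient * (q₂.gcd q).totient := by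
    intro q₂ hq₂
    rw [← Nat.totient_mul, Nat.div_mul_cancel (Nat.gcd_dvd_left _ _)]
    exact (coprime_div_gcd_of_squarefree (mem_sieveModuli.1 hq₂).2.1 q).coprime_dvd_right
      (Nat.gcd_dvd_right _ _)
  set f : ℕ × ℕ → ℕ × ℕ × ℕ := fun x => (x.2 / x.2.gcd q, x.1.gcd q, x.2.gcd q) with hf
  have hinj : Set.InjOn f (T : Set (ℕ × ℕ)) := by
    rintro ⟨x, y⟩ hx ⟨x', y'⟩ hx' h
    have e1 := (mem_filter.1 (mem_coe.1 hx)).2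
    have e2 := (mem_filter.1 (mem_coe.1 hx')).2
    simp only [hf, Prod.mk.injEq] at h e1 e2 ⊢
    obtain ⟨h1, h2, h3⟩ := h
    constructor
    · rw [← Nat.div_mul_cancel (Nat.gcd_dvd_left x q), ← Nat.div_mul_cancel (Nat.gcd_dvd_left x' q),
        e1, e2, h1, h2]
    · rw [← Nat.div_mul_cancel (Nat.gcd_dvd_left y q), ← Nat.div_mul_cancel (Nat.gcd_dvd_left y' q),
        h1, h3]
  calc ∑ x ∈ T, ν (x.2.gcd q) / x.2.totient
      = ∑ x ∈ T, (fun y : ℕ × ℕ × ℕ =>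
          1 / (y.1.totient : ℝ) * (ν y.2.2 / y.2.2.totient)) (f x) := by
        apply sum_congr rfl
        intro x hx
        have := hcop x.2 (mem_product.1 (mem_filter.1 hx).1).2
        simp only [hf]
        rw [this]
        push_cast
        rw [one_div, ← div_eq_inv_mul, div_div, mul_comm]
    _ = ∑ y ∈ T.image f, 1 / (y.1.totient : ℝ) * (ν y.2.2 / y.2.2.totient) := by
        rw [sum_image hinj]
    _ ≤ ∑ y ∈ sieveModuli L R ×ˢ (q.divisors ×ˢ q.divisors),
          1 / (y.1.totient : ℝ) * (ν y.2.2 / y.2.2.totient) := by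
        apply sum_le_sum_of_subset_of_nonneg
        · intro y hy
          obtain ⟨x, hx, rfl⟩ := mem_image.1 hy
          have hx2 := mem_product.1 (mem_filter.1 hx).1
          obtain ⟨⟨h1, h2⟩, h3, h4⟩ := mem_sieveModuli.1 hx2.2
          have hd : x.2 / x.2.gcd q ∣ x.2 := Nat.div_dvd_of_dvd (Nat.gcd_dvd_left _ _)
          simp only [hf, mem_product, Nat.mem_divisors]
          refine ⟨mem_sieveModuli.2 ⟨⟨Nat.pos_of_dvd_of_pos hd h1, (Nat.le_of_dvd h1 hd).trans h2⟩,
            h3.squarefree_of_dvd hd, h4.coprime_dvd_left hd⟩,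
            ⟨Nat.gcd_dvd_right _ _, by omega⟩, ⟨Nat.gcd_dvd_right _ _, by omega⟩⟩
        · intro y _ _
          have := hν y.2.2
          positivity
    _ = _ := by
        rw [sum_product]
        simp only [sum_product, ← mul_sum, sum_const, nsmul_eq_mul]
        rw [← sum_mul, sieveMass]
        ring

/-! ### Averages over a period -/

lemma sum_range_add_of_periodic {w : ℕ → ℂ} {D : ℕ} (hw : ∀ z, w (z + D) = w z) (h : ℕ) :
    ∑ z ∈ range D, w (z + h) = ∑ z ∈ range D, w z := by
  induction h with
  | zero => rfl
  | succ h ih =>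
    rw [← ih]
    have h1 := sum_range_succ (fun z => w (z + h)) D
    have h2 := sum_range_succ' (fun z => w (z + h)) D
    have h3 : w (D + h) = w (0 + h) := by rw [add_comm D, hw, zero_add]
    have h4 : ∀ z, z + 1 + h = z + (h + 1) := fun z => by ring
    simp only [h4] at h2
    rw [h1, h3] at h2
    exact (add_right_cancel h2).symm

lemma sum_range_eq_zero_of_shift {w : ℕ → ℂ} {D h : ℕ} {ζ : ℂ} (hw : ∀ z, w (z + D) = w z)
    (hs : ∀ z, w (z + h) = ζ * w z) (hζ : ζ ≠ 1) : ∑ z ∈ range D, w z = 0 := by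
  have h1 := sum_range_add_of_periodic hw h
  simp only [hs, ← mul_sum] at h1
  have h2 : (ζ - 1) * ∑ z ∈ range D, w z = 0 := by rw [sub_mul, h1]; ring
  exact (mul_eq_zero.1 h2).resolve_left (sub_ne_zero.2 hζ)

lemma sum_range_mul_of_periodic {w : ℕ → ℂ} {q : ℕ} (hw : ∀ z, w (z + q) = w z) (n : ℕ) :
    ∑ z ∈ range (q * n), w z = n * ∑ z ∈ range q, w z := by
  induction n with
  | zero => simp
  | succ n ih =>
    have h1 : ∀ m z, w (q * m + z) = w z := by
      intro m
      induction m with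
      | zero => simp
      | succ m ihm =>
        intro z
        rw [← ihm z, ← hw (q * m + z)]; congr 1; ring
    rw [mul_add, mul_one, sum_range_add, ih]
    simp only [h1]
    push_cast; ring

/-! ### Integer polynomials without constant term -/

/-- The polynomial `∑_{1 ≤ j ≤ k} co j * z ^ j`. -/
def polyVal (co : ℕ → ℤ) (k : ℕ) (z : ℤ) : ℤ := ∑ j ∈ Icc 1 k, co j * z ^ j

lemma dvd_polyVal_add_sub (co : ℕ → ℤ) (k : ℕ) (z h : ℤ) :
    h ∣ polyVal co k (z + h) - polyVal co k z := by
  rw [polyVal, polyVal, ← sum_sub_distrib]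
  refine dvd_sum fun j _ => ?_
  rw [← mul_sub]
  refine Dvd.dvd.mul_left ?_ _
  have := sub_dvd_pow_sub_pow (z + h) z j
  simpa using this

lemma mul_dvd_polyVal_add_sub {co : ℕ → ℤ} {k : ℕ} (hk : 1 ≤ k) {p : ℤ}
    (hp : ∀ j, 2 ≤ j → j ≤ k → p ∣ co j) (z h : ℤ) :
    p * h ∣ polyVal co k (z + h) - polyVal co k z - co 1 * h := by
  have h1 : polyVal co k (z + h) - polyVal co k z - co 1 * h =
      ∑ j ∈ Icc 2 k, co j * ((z + h) ^ j - z ^ j) := by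
    rw [polyVal, polyVal, ← sum_sub_distrib, ← Finset.insert_Icc_add_one_left_eq_Icc hk,
      sum_insert (by simp)]
    simp only [← mul_sub]
    ring_nf
  rw [h1]
  refine dvd_sum fun j hj => ?_
  rw [mem_Icc] at hj
  refine mul_dvd_mul (hp j hj.1 hj.2) ?_
  have := sub_dvd_pow_sub_pow (z + h) z j
  simpa using this

lemma hasLead_polyVal (co : ℕ → ℤ) {k : ℕ} (hk : 1 ≤ k) (θ : ℝ) :
    HasLead k (θ * co k) (fun z => θ * polyVal co k z) := by
  have h1 : (fun z => θ * polyVal co k z) =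
      fun z : ℤ => ∑ j ∈ Icc 1 k, (θ * co j) * (z : ℝ) ^ j := by
    funext z
    rw [polyVal]; push_cast; rw [mul_sum]
    refine sum_congr rfl fun j _ => by ring
  rw [h1]
  have h2 := HasLead.sum (k := k) (s := Icc 1 k) (γ := fun j => if j = k then θ * co j else 0)
    (f := fun j (z : ℤ) => (θ * co j) * (z : ℝ) ^ j)
    (fun j hj => hasLead_monomial k (mem_Icc.1 hj).2 _)
  convert h2 using 1
  rw [sum_ite_eq' (Icc 1 k) k]
  simp [hk]

/-- Local conditions on the coefficients `co` of a polynomial of degree `k` with respect to a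
modulus `L`. -/
structure LocallyAdmissible (co : ℕ → ℤ) (k L : ℕ) : Prop where
  pos : 0 < co k
  dvd_of_dvd : ∀ p : ℕ, p.Prime → p ∣ L → ∀ j, 2 ≤ j → j ≤ k → (p : ℤ) ∣ co j
  not_dvd_of_dvd : ∀ p : ℕ, p.Prime → p ∣ L → ¬ (p : ℤ) ∣ co 1
  not_dvd_of_not_dvd : ∀ p : ℕ, p.Prime → ¬ p ∣ L → ¬ (p : ℤ) ∣ co k

/-- The summand `e(a P(z) / q + L τ z)` of a complete exponential sum. -/
noncomputable def twist (co : ℕ → ℤ) (k L : ℕ) (a : ℤ) (q : ℕ) (τ : ℝ) (z : ℕ) : ℂ :=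
  eC (a / q * polyVal co k z + L * τ * z)

/-- The mean of `twist` over a period, when `τ` is a difference of fractions with denominators
`q₁` and `q₂`. -/
noncomputable def twistMean (co : ℕ → ℤ) (k L : ℕ) (a : ℤ) (q q₁ a₁ q₂ a₂ : ℕ) : ℂ :=
  (∑ z ∈ range (q * (q₁ * q₂)), twist co k L a q ((a₁ : ℝ) / q₁ - a₂ / q₂) z) /
    ((q * (q₁ * q₂) : ℕ) : ℂ)

lemma norm_twist (co : ℕ → ℤ) (k L : ℕ) (a : ℤ) (q : ℕ) (τ : ℝ) (z : ℕ) :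
    ‖twist co k L a q τ z‖ = 1 := norm_eC _

lemma twist_add (co : ℕ → ℤ) (k L : ℕ) (a : ℤ) (q : ℕ) (τ : ℝ) (z h : ℕ) :
    twist co k L a q τ (z + h) =
      eC (a / q * ((polyVal co k (z + h) - polyVal co k z : ℤ) : ℝ) + L * τ * h) *
        twist co k L a q τ z := by
  rw [twist, twist, ← eC_add]
  congr 1; push_cast; ring

lemma twist_add_of_dvd (co : ℕ → ℤ) (k L : ℕ) (a : ℤ) {q : ℕ} (hq : 1 ≤ q) (τ : ℝ) (z : ℕ) {h : ℕ}
    (hd : q ∣ h) :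
    twist co k L a q τ (z + h) = eC (L * τ * h) * twist co k L a q τ z := by
  rw [twist_add]
  obtain ⟨m, hm⟩ := (Int.natCast_dvd_natCast.2 hd).trans (dvd_polyVal_add_sub co k z h)
  rw [hm]
  have hq0 : (q : ℝ) ≠ 0 := by positivity
  have : (a : ℝ) / q * ((q * m : ℤ) : ℝ) + L * τ * h = ((a * m : ℤ) : ℝ) + L * τ * h := by
    push_cast; field_simp
  rw [this, eC_add, eC_int, one_mul]

lemma norm_twistMean_le_one (co : ℕ → ℤ) (k L : ℕ) (a : ℤ) (q q₁ a₁ q₂ a₂ : ℕ) :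
    ‖twistMean co k L a q q₁ a₁ q₂ a₂‖ ≤ 1 := by
  rw [twistMean, norm_div, Complex.norm_natCast]
  refine div_le_one_of_le₀ ?_ (by positivity)
  refine (norm_sum_le _ _).trans ?_
  simp [norm_twist]

lemma twist_periodic (co : ℕ → ℤ) (k L : ℕ) (a : ℤ) {q q₁ q₂ : ℕ} (a₁ a₂ : ℕ) (hq : 1 ≤ q)
    (hq₁ : 1 ≤ q₁) (hq₂ : 1 ≤ q₂) (z : ℕ) :
    twist co k L a q ((a₁ : ℝ) / q₁ - a₂ / q₂) (z + q * (q₁ * q₂)) =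
      twist co k L a q ((a₁ : ℝ) / q₁ - a₂ / q₂) z := by
  rw [twist_add_of_dvd co k L a hq _ _ (Dvd.intro _ rfl)]
  have h1 : (L : ℝ) * ((a₁ : ℝ) / q₁ - a₂ / q₂) * ((q * (q₁ * q₂) : ℕ) : ℝ) =
      ((L * q * (a₁ * q₂ - a₂ * q₁) : ℤ) : ℝ) := by
    push_cast
    have : (q₁ : ℝ) ≠ 0 := by positivity
    have : (q₂ : ℝ) ≠ 0 := by positivity
    field_simp
  rw [h1, eC_int, one_mul]

/-- `n (a₁ / q₁ - a₂ / q₂)` is an integer. -/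
lemma mul_sub_eq_int_iff {q₁ q₂ : ℕ} (a₁ a₂ : ℕ) (n : ℤ) (hq₁ : 1 ≤ q₁) (hq₂ : 1 ≤ q₂) :
    (∃ m : ℤ, (n : ℝ) * ((a₁ : ℝ) / q₁ - a₂ / q₂) = m) ↔
      (q₁ : ℤ) * q₂ ∣ n * ((a₁ : ℤ) * q₂ - (a₂ : ℤ) * q₁) := by
  have h1 : (q₁ : ℝ) ≠ 0 := by positivity
  have h2 : (q₂ : ℝ) ≠ 0 := by positivity
  constructor
  · rintro ⟨m, hm⟩
    refine ⟨m, ?_⟩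
    field_simp at hm
    have h3 : ((n * ((a₁ : ℤ) * q₂ - (a₂ : ℤ) * q₁) : ℤ) : ℝ) = ((q₁ * q₂ * m : ℤ) : ℝ) := by
      push_cast; linear_combination hm
    exact_mod_cast h3
  · rintro ⟨m, hm⟩
    refine ⟨m, ?_⟩
    have h3 : (n : ℝ) * ((a₁ : ℝ) * q₂ - (a₂ : ℝ) * q₁) = q₁ * q₂ * m := by exact_mod_cast hm
    field_simp
    linear_combination h3

lemma twistMean_eq_zero (co : ℕ → ℤ) (k : ℕ) {L : ℕ} (a : ℤ) {q q₁ a₁ q₂ a₂ : ℕ} (hq : 1 ≤ q)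
    (hq₁ : 1 ≤ q₁) (hq₂ : 1 ≤ q₂) (hL₁ : q₁.Coprime L) (hL₂ : q₂.Coprime L)
    (h : ¬ (q₁ : ℤ) * q₂ ∣ q * ((a₁ : ℤ) * q₂ - (a₂ : ℤ) * q₁)) :
    twistMean co k L a q q₁ a₁ q₂ a₂ = 0 := by
  rw [twistMean, sum_range_eq_zero_of_shift (h := q)
    (twist_periodic co k L a a₁ a₂ hq hq₁ hq₂)
    (fun z => twist_add_of_dvd co k L a hq _ z dvd_rfl), zero_div]
  rw [Ne, eC_eq_one_iff]
  rintro ⟨m, hm⟩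
  have h1 : (((L * q : ℤ) : ℝ)) * ((a₁ : ℝ) / q₁ - a₂ / q₂) = m := by
    rw [← hm]; push_cast; ring
  have h2 := (mul_sub_eq_int_iff a₁ a₂ (L * q) hq₁ hq₂).1 ⟨m, h1⟩
  rw [mul_assoc] at h2
  refine h (IsCoprime.dvd_of_dvd_mul_left ?_ h2)
  exact IsCoprime.mul_left (Nat.isCoprime_iff_coprime.2 hL₁) (Nat.isCoprime_iff_coprime.2 hL₂)

lemma twist_periodic_of_dvd (co : ℕ → ℤ) (k L : ℕ) (a : ℤ) {q q₁ a₁ q₂ a₂ : ℕ} (hq : 1 ≤ q)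
    (hq₁ : 1 ≤ q₁) (hq₂ : 1 ≤ q₂)
    (h : (q₁ : ℤ) * q₂ ∣ q * ((a₁ : ℤ) * q₂ - (a₂ : ℤ) * q₁)) (z : ℕ) :
    twist co k L a q ((a₁ : ℝ) / q₁ - a₂ / q₂) (z + q) =
      twist co k L a q ((a₁ : ℝ) / q₁ - a₂ / q₂) z := by
  rw [twist_add_of_dvd co k L a hq _ _ dvd_rfl]
  obtain ⟨m, hm⟩ := (mul_sub_eq_int_iff a₁ a₂ q hq₁ hq₂).2 h
  have h1 : (L : ℝ) * ((a₁ : ℝ) / q₁ - a₂ / q₂) * q = ((L * m : ℤ) : ℝ) := by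
    push_cast; rw [← hm]; push_cast; ring
  rw [h1, eC_int, one_mul]

lemma twistMean_eq_of_dvd (co : ℕ → ℤ) (k L : ℕ) (a : ℤ) {q q₁ a₁ q₂ a₂ : ℕ} (hq : 1 ≤ q)
    (hq₁ : 1 ≤ q₁) (hq₂ : 1 ≤ q₂) (h : (q₁ : ℤ) * q₂ ∣ q * ((a₁ : ℤ) * q₂ - (a₂ : ℤ) * q₁)) :
    twistMean co k L a q q₁ a₁ q₂ a₂ =
      (∑ z ∈ range q, twist co k L a q ((a₁ : ℝ) / q₁ - a₂ / q₂) z) / q := by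
  rw [twistMean, sum_range_mul_of_periodic (twist_periodic_of_dvd co k L a hq hq₁ hq₂ h)]
  push_cast
  have h1 : (q₁ : ℂ) ≠ 0 := by exact_mod_cast (by omega : q₁ ≠ 0)
  have h2 : (q₂ : ℂ) ≠ 0 := by exact_mod_cast (by omega : q₂ ≠ 0)
  have h3 : (q : ℂ) ≠ 0 := by exact_mod_cast (by omega : q ≠ 0)
  field_simp

lemma twistMean_eq_zero_of_prime_dvd {co : ℕ → ℤ} {k L : ℕ} (hk : 1 ≤ k)
    (hco : LocallyAdmissible co k L) {a : ℤ} {q q₁ a₁ q₂ a₂ p : ℕ} (hq : 1 ≤ q)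
    (haq : IsCoprime a (q : ℤ)) (hq₁ : 1 ≤ q₁) (hq₂ : 1 ≤ q₂)
    (h : (q₁ : ℤ) * q₂ ∣ q * ((a₁ : ℤ) * q₂ - (a₂ : ℤ) * q₁)) (hp : p.Prime) (hpq : p ∣ q)
    (hpL : p ∣ L) : twistMean co k L a q q₁ a₁ q₂ a₂ = 0 := by
  rw [twistMean_eq_of_dvd co k L a hq hq₁ hq₂ h]
  obtain ⟨d, rfl⟩ := hpq
  obtain ⟨l, hl⟩ := hpL
  have hp0 : (p : ℝ) ≠ 0 := by exact_mod_cast hp.ne_zero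
  have hd0 : (d : ℝ) ≠ 0 := by
    rintro h; have : d = 0 := by exact_mod_cast h
    simp [this] at hq
  rw [sum_range_eq_zero_of_shift (h := d) (ζ := eC ((a * co 1 : ℤ) / p))
    (twist_periodic_of_dvd co k L a hq hq₁ hq₂ h), zero_div]
  · intro z
    rw [twist_add]
    congr 1
    obtain ⟨m, hm⟩ := mul_dvd_polyVal_add_sub hk
      (fun j hj hjk => hco.dvd_of_dvd p hp ⟨l, hl⟩ j hj hjk) z d
    obtain ⟨m', hm'⟩ := (mul_sub_eq_int_iff a₁ a₂ _ hq₁ hq₂).2 h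
    have e1 : polyVal co k (z + d) - polyVal co k z = co 1 * d + p * d * m := by linarith
    rw [e1]
    have e2 : (a : ℝ) / ((p * d : ℕ) : ℝ) * ((co 1 * d + p * d * m : ℤ) : ℝ) +
        L * ((a₁ : ℝ) / q₁ - a₂ / q₂) * d =
          ((a * co 1 : ℤ) : ℝ) / p + ((a * m + l * m' : ℤ) : ℝ) := by
      push_cast at hm' ⊢
      rw [← hm', hl]
      push_cast
      field_simp
      ring
    rw [e2, eC_add_int]
  · rw [Ne, eC_eq_one_iff]
    rintro ⟨m, hm⟩
    rw [div_eq_iff hp0] at hm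
    have h1 : (p : ℤ) ∣ a * co 1 := ⟨m, by rw [mul_comm (p : ℤ)]; exact_mod_cast hm⟩
    rcases (Nat.prime_iff_prime_int.1 hp).dvd_or_dvd h1 with h2 | h2
    · have := haq.isUnit_of_dvd' h2 ⟨d, by push_cast; ring⟩
      exact (Nat.prime_iff_prime_int.1 hp).not_isUnit this
    · exact hco.not_dvd_of_dvd p hp ⟨l, hl⟩ h2

lemma sum_range_eq_sum_Ico_int (F : ℤ → ℂ) (n : ℕ) :
    ∑ z ∈ range n, F z = ∑ z ∈ Ico (0 : ℤ) n, F z := by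
  refine sum_nbij' (fun z => (z : ℤ)) Int.toNat ?_ ?_ ?_ ?_ ?_
  · intro z hz; simpa using hz
  · intro z hz; rw [mem_Ico] at hz; rw [mem_range]; omega
  · intro z _; simp
  · intro z hz; rw [mem_Ico] at hz; simp [hz.1]
  · intro z _; rfl

lemma LocallyAdmissible.isCoprime_of_coprime {co : ℕ → ℤ} {k L : ℕ}
    (hco : LocallyAdmissible co k L) {q : ℕ} (hq : q.Coprime L) : IsCoprime (co k) (q : ℤ) := by
  rw [Int.isCoprime_iff_gcd_eq_one]
  by_contra h
  obtain ⟨p, hp, hpd⟩ := Nat.exists_prime_and_dvd h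
  have h1 : p ∣ q := by
    have := hpd.trans (Int.gcd_dvd_natAbs_right _ _)
    simpa using this
  have h2 : (p : ℤ) ∣ co k := (Int.natCast_dvd_natCast.2 hpd).trans (Int.gcd_dvd_left _ _)
  refine hco.not_dvd_of_not_dvd p hp (fun h3 => ?_) h2
  exact hp.one_lt.ne' (Nat.eq_one_of_dvd_coprimes hq h1 h3)

open Classical in
lemma exists_norm_twistMean_le {k : ℕ} (hk : 2 ≤ k) : ∃ C : ℝ, 1 ≤ C ∧
    ∀ (co : ℕ → ℤ) (L : ℕ), LocallyAdmissible co k L → ∀ (a : ℤ) (q q₁ a₁ q₂ a₂ : ℕ), 1 ≤ q →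
      IsCoprime a (q : ℤ) → 1 ≤ q₁ → 1 ≤ q₂ → q₁.Coprime L → q₂.Coprime L →
      ‖twistMean co k L a q q₁ a₁ q₂ a₂‖ ≤ C * (q : ℝ) ^ (-(1 / 2 ^ k : ℝ)) *
        if (q₁ : ℤ) * q₂ ∣ q * ((a₁ : ℤ) * q₂ - (a₂ : ℤ) * q₁) then 1 else 0 := by
  obtain ⟨j, rfl⟩ : ∃ j, k = j + 1 := ⟨k - 1, by omega⟩
  obtain ⟨C, hC, hW⟩ := weyl_inequality (j := j) (by omega) (ε := 1 / 2) (by norm_num)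
  refine ⟨3 * C, by linarith, ?_⟩
  intro co L hco a q q₁ a₁ q₂ a₂ hq haq hq₁ hq₂ hL₁ hL₂
  have hqr : (1 : ℝ) ≤ q := by exact_mod_cast hq
  split_ifs with h
  swap
  · rw [twistMean_eq_zero co _ a hq hq₁ hq₂ hL₁ hL₂ h]; simp
  rw [mul_one]
  by_cases hqL : q.Coprime L
  swap
  · obtain ⟨p, hp, hpd⟩ := Nat.exists_prime_and_dvd hqL
    rw [twistMean_eq_zero_of_prime_dvd (by omega) hco hq haq hq₁ hq₂ h hp
      (hpd.trans (Nat.gcd_dvd_left _ _)) (hpd.trans (Nat.gcd_dvd_right _ _)), norm_zero]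
    positivity
  rw [twistMean_eq_of_dvd co _ L a hq hq₁ hq₂ h, norm_div, Complex.norm_natCast]
  set τ : ℝ := (a₁ : ℝ) / q₁ - a₂ / q₂ with hτ
  have hlead : HasLead (j + 1) ((a / q : ℝ) * co (j + 1) + 0)
      (fun z : ℤ => (a / q : ℝ) * polyVal co (j + 1) z + L * τ * (z : ℝ) ^ 1) := by
    refine (hasLead_polyVal co (by omega) _).add ?_
    have := hasLead_monomial (j + 1) (j := 1) (by omega) (L * τ)
    rwa [if_neg (by omega)] at this
  have h1 := hW q hq (a * co (j + 1)) q hq (Nat.le_self_pow (by omega) q)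
    (haq.mul_left (hco.isCoprime_of_coprime hqL)) ((a / q : ℝ) * co (j + 1) + 0) (by
      have : (a / q : ℝ) * co (j + 1) + 0 - ((a * co (j + 1) : ℤ) : ℝ) / q = 0 := by
        push_cast; ring
      rw [this, abs_zero]; positivity) _ hlead 0 q (by simp)
  have h2 : ∑ z ∈ Ico (0 : ℤ) q, eC ((a / q : ℝ) * polyVal co (j + 1) z + L * τ * (z : ℝ) ^ 1) =
      ∑ z ∈ range q, twist co (j + 1) L a q τ z := by
    rw [← sum_range_eq_sum_Ico_int]
    refine sum_congr rfl fun z _ => ?_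
    rw [twist]; push_cast; rw [pow_one]
  rw [h2] at h1
  set S := ‖∑ z ∈ range q, twist co (j + 1) L a q τ z‖ with hS
  have h3 : (1 / (q : ℝ) + 1 / q + q / (q : ℝ) ^ (j + 1)) ≤ 3 * (q : ℝ)⁻¹ := by
    have : (q : ℝ) / (q : ℝ) ^ (j + 1) ≤ (q : ℝ)⁻¹ := by
      rw [pow_succ, ← div_div, div_le_iff₀ (by positivity), inv_mul_cancel₀ (by positivity)]
      rw [div_le_one (by positivity)]
      exact le_self_pow₀ hqr (by omega)
    rw [one_div]; linarith
  have h4 : (q : ℝ) ^ (1 / 2 : ℝ) * (q : ℝ)⁻¹ = (q : ℝ) ^ (-(1 / 2) : ℝ) := by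
    rw [← Real.rpow_neg_one, ← Real.rpow_add (by positivity)]; norm_num
  refine le_of_pow_le_pow_left₀ (n := 2 ^ j) (by positivity) (by positivity) ?_
  rw [div_pow, div_le_iff₀ (by positivity)]
  calc S ^ 2 ^ j ≤ C * (q : ℝ) ^ 2 ^ j * (q : ℝ) ^ (1 / 2 : ℝ) * (3 * (q : ℝ)⁻¹) :=
        h1.trans (by gcongr)
    _ = (3 * C) * ((q : ℝ) ^ (1 / 2 : ℝ) * (q : ℝ)⁻¹) * (q : ℝ) ^ 2 ^ j := by ring
    _ ≤ (3 * C) ^ 2 ^ j * (q : ℝ) ^ (-(1 / 2) : ℝ) * (q : ℝ) ^ 2 ^ j := by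
        rw [h4]
        gcongr
        exact le_self_pow₀ (by linarith) (by positivity)
    _ = _ := by
        rw [mul_pow (3 * C), ← Real.rpow_natCast ((q : ℝ) ^ (-(1 / 2 ^ (j + 1) : ℝ))),
          ← Real.rpow_mul
          (by positivity)]
        congr 3
        push_cast; rw [pow_succ]; field_simp

lemma le_totient_mul_card_divisors (n : ℕ) : n ≤ n.totient * #n.divisors := by
  rcases Nat.eq_zero_or_pos n with rfl | hn
  · simp
  calc n = ∑ d ∈ n.divisors, d.totient := (Nat.sum_totient n).symm
    _ ≤ ∑ _d ∈ n.divisors, n.totient := by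
        refine sum_le_sum fun d hd => ?_
        exact Nat.le_of_dvd (Nat.totient_pos.2 hn)
          (Nat.totient_dvd_of_dvd (Nat.dvd_of_mem_divisors hd))
    _ = _ := by rw [sum_const, smul_eq_mul, mul_comm]

lemma div_totient_le_card_divisors {g q : ℕ} (hg : g ∈ q.divisors) :
    (g : ℝ) / g.totient ≤ #q.divisors := by
  have hg' := Nat.mem_divisors.1 hg
  have h0 : 0 < g := Nat.pos_of_dvd_of_pos hg'.1 (by omega)
  rw [div_le_iff₀ (by exact_mod_cast Nat.totient_pos.2 h0), mul_comm]
  exact_mod_cast (le_totient_mul_card_divisors g).trans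
    (Nat.mul_le_mul_left _ (card_le_card (Nat.divisors_subset_of_dvd hg'.2 hg'.1)))

lemma card_filter_modEq_le {d m : ℕ} (hd : d ∣ m) (s : Finset ℕ) (hs : s ⊆ range m)
    (h : ∀ x ∈ s, ∀ y ∈ s, ((d : ℕ) : ℤ) ∣ (x : ℤ) - y) (hm : 1 ≤ m) : #s ≤ m / d := by
  have hd0 : 0 < d := Nat.pos_of_dvd_of_pos hd (by omega)
  calc #s ≤ #(range (m / d)) := by
        refine card_le_card_of_injOn (fun x => x / d) ?_ ?_
        · intro x hx
          have := mem_range.1 (hs hx)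
          simp only [coe_range, Set.mem_Iio]
          exact Nat.div_lt_div_of_lt_of_dvd hd this
        · intro x hx y hy hxy
          simp only at hxy
          have h1 : x % d = y % d :=
            ((Nat.modEq_iff_dvd).2 (h y hy x hx) : x ≡ y [MOD d])
          rw [← Nat.div_add_mod x d, ← Nat.div_add_mod y d, hxy, h1]
    _ = m / d := card_range _

open Classical in
lemma pairSum_dvd_le (L R : ℕ) {q : ℕ} (hq : 1 ≤ q) :
    pairSum L R (fun q₁ a₁ q₂ a₂ =>
      if (q₁ : ℤ) * q₂ ∣ q * ((a₁ : ℤ) * q₂ - (a₂ : ℤ) * q₁) then 1 else 0) ≤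
      sieveMass L R * (#q.divisors : ℝ) ^ 3 := by
  refine (pairSum_ite_le hq (fun q₁ a₁ q₂ a₂ =>
    (q₁ : ℤ) * q₂ ∣ q * ((a₁ : ℤ) * q₂ - (a₂ : ℤ) * q₁)) (fun g => g) (fun g => by positivity)
    (fun _ _ _ _ _ _ _ _ h => h) ?_).trans ?_
  · intro q₁ hq₁ a₁ _ q₂ hq₂
    have h1 := (mem_sieveModuli.1 hq₁).1.1
    have h2 := (mem_sieveModuli.1 hq₂).1.1
    have hg : 0 < q₂.gcd q := Nat.gcd_pos_of_pos_left _ h2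
    have := card_filter_modEq_le (Nat.div_dvd_of_dvd (Nat.gcd_dvd_left q₂ q))
      ({a₂ ∈ reducedResidues q₂ | (q₁ : ℤ) * q₂ ∣ q * ((a₁ : ℤ) * q₂ - (a₂ : ℤ) * q₁)})
      ((filter_subset _ _).trans (filter_subset _ _)) ?_ h2
    · rw [Nat.div_div_self (Nat.gcd_dvd_left q₂ q) (by omega)] at this
      exact_mod_cast this
    · intro x hx y hy
      have hx' := (mem_filter.1 hx).2
      have hy' := (mem_filter.1 hy).2
      have h3 : (q₁ : ℤ) * q₂ ∣ q₁ * (q * ((x : ℤ) - y)) := by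
        have := dvd_sub hy' hx'
        have e : (q₁ : ℤ) * (q * ((x : ℤ) - y)) =
          q * ((a₁ : ℤ) * q₂ - (y : ℤ) * q₁) - q * ((a₁ : ℤ) * q₂ - (x : ℤ) * q₁) := by ring
        rw [e]; exact this
      have h4 : (q₂ : ℤ) ∣ q * ((x : ℤ) - y) :=
        (mul_dvd_mul_iff_left (by exact_mod_cast (by omega : q₁ ≠ 0))).1 h3
      have h5 : IsCoprime ((q₂ / q₂.gcd q : ℕ) : ℤ) ((q / q₂.gcd q : ℕ) : ℤ) :=
        Nat.isCoprime_iff_coprime.2 (Nat.coprime_div_gcd_div_gcd hg)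
      refine h5.dvd_of_dvd_mul_left ?_
      refine (mul_dvd_mul_iff_left (a := ((q₂.gcd q : ℕ) : ℤ))
        (by exact_mod_cast (by omega : q₂.gcd q ≠ 0))).1 ?_
      rw [← mul_assoc, ← Nat.cast_mul, ← Nat.cast_mul,
        Nat.mul_div_cancel' (Nat.gcd_dvd_left q₂ q), Nat.mul_div_cancel' (Nat.gcd_dvd_right q₂ q)]
      exact h4
  · rw [mul_assoc]
    refine mul_le_mul_of_nonneg_left ?_ (sieveMass_nonneg L R)
    calc (#q.divisors : ℝ) * ∑ g ∈ q.divisors, (g : ℝ) / g.totient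
        ≤ #q.divisors * ∑ _g ∈ q.divisors, (#q.divisors : ℝ) := by
          gcongr with g hg
          exact div_totient_le_card_divisors hg
      _ = _ := by rw [sum_const, nsmul_eq_mul]; ring

lemma exists_card_divisors_pow_mul_le {x : ℝ} {y : ℝ} (hxy : x < y) : ∃ C : ℝ, 1 ≤ C ∧
    ∀ q : ℕ, 1 ≤ q → (#q.divisors : ℝ) ^ 3 * (q : ℝ) ^ x ≤ C * (q : ℝ) ^ y := by
  obtain ⟨C, hC, h⟩ := card_divisors_le_mul_rpow (ε := (y - x) / 3) (by linarith)
  refine ⟨C ^ 3, one_le_pow₀ hC, fun q hq => ?_⟩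
  have hq0 : (0 : ℝ) < q := by exact_mod_cast hq
  calc (#q.divisors : ℝ) ^ 3 * (q : ℝ) ^ x ≤ (C * (q : ℝ) ^ ((y - x) / 3)) ^ 3 * (q : ℝ) ^ x := by
        gcongr; exact h q hq
    _ = C ^ 3 * (q : ℝ) ^ y := by
        rw [mul_pow, ← Real.rpow_natCast ((q : ℝ) ^ _), ← Real.rpow_mul hq0.le, mul_assoc,
          ← Real.rpow_add hq0]
        congr 2; push_cast; ring

open Classical in
lemma exists_pairSum_twistMean_le_of_two_le {k : ℕ} (hk : 2 ≤ k) : ∃ C : ℝ, 1 ≤ C ∧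
    ∀ (co : ℕ → ℤ) (L : ℕ), LocallyAdmissible co k L → ∀ (R : ℕ) (a : ℤ) (q : ℕ), 1 ≤ q →
      IsCoprime a (q : ℤ) →
      pairSum L R (fun q₁ a₁ q₂ a₂ => ‖twistMean co k L a q q₁ a₁ q₂ a₂‖) ≤
        C * sieveMass L R * (q : ℝ) ^ (-(1 / 2 ^ (k + 1) : ℝ)) := by
  obtain ⟨C, hC, h⟩ := exists_norm_twistMean_le hk
  obtain ⟨C', hC', h'⟩ := exists_card_divisors_pow_mul_le (x := -(1 / 2 ^ k : ℝ))
    (y := -(1 / 2 ^ (k + 1) : ℝ)) (by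
      rw [neg_lt_neg_iff]
      exact one_div_lt_one_div_of_lt (by positivity) (pow_lt_pow_right₀ (by norm_num) (by omega)))
  refine ⟨C * C', by nlinarith, fun co L hco R a q hq haq => ?_⟩
  calc pairSum L R (fun q₁ a₁ q₂ a₂ => ‖twistMean co k L a q q₁ a₁ q₂ a₂‖)
      ≤ pairSum L R (fun q₁ a₁ q₂ a₂ => C * (q : ℝ) ^ (-(1 / 2 ^ k : ℝ)) *
        if (q₁ : ℤ) * q₂ ∣ q * ((a₁ : ℤ) * q₂ - (a₂ : ℤ) * q₁) then 1 else 0) := by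
        refine pairSum_le_pairSum fun q₁ hq₁ a₁ ha₁ q₂ hq₂ a₂ ha₂ => ?_
        have h1 := mem_sieveModuli.1 hq₁
        have h2 := mem_sieveModuli.1 hq₂
        exact h co L hco a q q₁ a₁ q₂ a₂ hq haq h1.1.1 h2.1.1 h1.2.2 h2.2.2
    _ ≤ C * (q : ℝ) ^ (-(1 / 2 ^ k : ℝ)) * (sieveMass L R * (#q.divisors : ℝ) ^ 3) := by
        rw [pairSum_mul_left]
        gcongr
        exact pairSum_dvd_le L R hq
    _ = C * sieveMass L R * ((#q.divisors : ℝ) ^ 3 * (q : ℝ) ^ (-(1 / 2 ^ k : ℝ))) := by ring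
    _ ≤ C * sieveMass L R * (C' * (q : ℝ) ^ (-(1 / 2 ^ (k + 1) : ℝ))) := by
        have := sieveMass_nonneg L R
        exact mul_le_mul_of_nonneg_left (h' q hq) (by positivity)
    _ = _ := by ring

/-! ### The linear case -/

lemma pairSum_swap (L R : ℕ) (F : ℕ → ℕ → ℕ → ℕ → ℝ) :
    pairSum L R (fun q₁ a₁ q₂ a₂ => F q₂ a₂ q₁ a₁) = pairSum L R F := by
  have h : ∀ F : ℕ → ℕ → ℕ → ℕ → ℝ, pairSum L R F =
      ∑ x ∈ (sieveModuli L R).sigma reducedResidues, ∑ y ∈ (sieveModuli L R).sigma reducedResidues,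
        1 / ((x.1.totient : ℝ) * y.1.totient) * F x.1 x.2 y.1 y.2 := by
    intro F
    rw [pairSum, sum_sigma]
    refine sum_congr rfl fun _ _ => sum_congr rfl fun _ _ => ?_
    rw [sum_sigma]
  rw [h, h, sum_comm]
  refine sum_congr rfl fun _ _ => sum_congr rfl fun _ _ => ?_
  rw [mul_comm (Nat.cast _ : ℝ)]

lemma LocallyAdmissible.coeff_eq_one {co : ℕ → ℤ} {L : ℕ} (h : LocallyAdmissible co 1 L) :
    co 1 = 1 := by
  have h0 := h.pos
  by_contra h1
  obtain ⟨p, hp, hpd⟩ := Nat.exists_prime_and_dvd (n := (co 1).natAbs) (by omega)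
  have h2 : (p : ℤ) ∣ co 1 := Int.natCast_dvd.2 hpd
  by_cases hpL : p ∣ L
  · exact h.not_dvd_of_dvd p hp hpL h2
  · exact h.not_dvd_of_not_dvd p hp hpL h2

/-- The relation `a / q + L (a₁ / q₁ - a₂ / q₂) ∈ ℤ`. -/
def IsResonant (L : ℕ) (a : ℤ) (q q₁ a₁ q₂ a₂ : ℕ) : Prop :=
  ∃ m : ℤ, (a : ℝ) / q + L * ((a₁ : ℝ) / q₁ - a₂ / q₂) = m

lemma IsResonant.swap {L : ℕ} {a : ℤ} {q q₁ a₁ q₂ a₂ : ℕ} (h : IsResonant L a q q₁ a₁ q₂ a₂) :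
    IsResonant L (-a) q q₂ a₂ q₁ a₁ := by
  obtain ⟨m, hm⟩ := h
  refine ⟨-m, ?_⟩
  push_cast
  rw [← hm]; ring

lemma IsResonant.eq_int {L : ℕ} {a : ℤ} {q q₁ a₁ q₂ a₂ : ℕ} (h : IsResonant L a q q₁ a₁ q₂ a₂)
    (hq : 1 ≤ q) (hq₁ : 1 ≤ q₁) (hq₂ : 1 ≤ q₂) :
    ∃ m : ℤ, a * (q₁ * q₂) + L * q * (a₁ * q₂ - a₂ * q₁) = q * (q₁ * q₂) * m := by
  obtain ⟨m, hm⟩ := h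
  refine ⟨m, ?_⟩
  have h0 : (q : ℝ) ≠ 0 := by positivity
  have h1 : (q₁ : ℝ) ≠ 0 := by positivity
  have h2 : (q₂ : ℝ) ≠ 0 := by positivity
  field_simp at hm
  have h3 : ((a * (q₁ * q₂) + L * q * (a₁ * q₂ - a₂ * q₁) : ℤ) : ℝ) =
      ((q * (q₁ * q₂) * m : ℤ) : ℝ) := by
    push_cast; linear_combination hm
  exact_mod_cast h3

lemma norm_twistMean_le_of_linear {co : ℕ → ℤ} {L : ℕ} (hco : LocallyAdmissible co 1 L)
    {a : ℤ} {q q₁ a₁ q₂ a₂ : ℕ} (hq : 1 ≤ q) (hq₁ : 1 ≤ q₁) (hq₂ : 1 ≤ q₂)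
    (h : ¬ IsResonant L a q q₁ a₁ q₂ a₂) : twistMean co 1 L a q q₁ a₁ q₂ a₂ = 0 := by
  rw [twistMean, sum_range_eq_zero_of_shift (h := 1)
    (ζ := eC ((a : ℝ) / q + L * ((a₁ : ℝ) / q₁ - a₂ / q₂)))
    (twist_periodic co 1 L a a₁ a₂ hq hq₁ hq₂), zero_div]
  · intro z
    rw [twist_add]
    congr 2
    simp [polyVal, hco.coeff_eq_one]
  · rw [Ne, eC_eq_one_iff]; exact h

open Classical in
lemma pairSum_isResonant_le (L R : ℕ) {a : ℤ} {q : ℕ} (hq : 1 ≤ q) :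
    pairSum L R (fun q₁ a₁ q₂ a₂ =>
      if IsResonant L a q q₁ a₁ q₂ a₂ ∧ q ≤ (q₂.gcd q) ^ 2 then 1 else 0) ≤
      sieveMass L R * ((#q.divisors : ℝ) ^ 3 * (q : ℝ) ^ (-(1 / 2) : ℝ)) := by
  have hqr : (0 : ℝ) < q := by exact_mod_cast hq
  refine (pairSum_ite_le hq (fun q₁ a₁ q₂ a₂ =>
    IsResonant L a q q₁ a₁ q₂ a₂ ∧ q ≤ (q₂.gcd q) ^ 2) (fun g => if q ≤ g ^ 2 then 1 else 0)
    (fun g => by positivity) ?_ ?_).trans ?_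
  · intro q₁ hq₁ a₁ _ q₂ hq₂ a₂ _ h
    have h1 := mem_sieveModuli.1 hq₁
    have h2 := mem_sieveModuli.1 hq₂
    obtain ⟨m, hm⟩ := h.1.eq_int hq h1.1.1 h2.1.1
    have hcop : IsCoprime ((q₁ : ℤ) * q₂) L :=
      IsCoprime.mul_left (Nat.isCoprime_iff_coprime.2 h1.2.2) (Nat.isCoprime_iff_coprime.2 h2.2.2)
    refine hcop.dvd_of_dvd_mul_left ⟨q * m - a, ?_⟩
    linear_combination hm
  · intro q₁ hq₁ a₁ _ q₂ hq₂
    have h1 := mem_sieveModuli.1 hq₁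
    have h2 := mem_sieveModuli.1 hq₂
    split_ifs with hg
    swap
    · simp [hg]
    have := card_filter_modEq_le (dvd_refl q₂)
      ({a₂ ∈ reducedResidues q₂ | IsResonant L a q q₁ a₁ q₂ a₂ ∧ q ≤ q₂.gcd q ^ 2})
      ((filter_subset _ _).trans (filter_subset _ _)) ?_ h2.1.1
    · rw [Nat.div_self h2.1.1] at this
      exact_mod_cast this
    · intro x hx y hy
      obtain ⟨m, hm⟩ := (mem_filter.1 hx).2.1.eq_int hq h1.1.1 h2.1.1
      obtain ⟨m', hm'⟩ := (mem_filter.1 hy).2.1.eq_int hq h1.1.1 h2.1.1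
      have hcop : IsCoprime (q₂ : ℤ) L := Nat.isCoprime_iff_coprime.2 h2.2.2
      refine hcop.dvd_of_dvd_mul_left ⟨m' - m, ?_⟩
      have hne : (q : ℤ) * q₁ ≠ 0 := by
        have := h1.1.1
        positivity
      apply mul_left_cancel₀ hne
      linear_combination hm' - hm
  · rw [mul_assoc]
    refine mul_le_mul_of_nonneg_left ?_ (sieveMass_nonneg L R)
    calc (#q.divisors : ℝ) * ∑ g ∈ q.divisors, (if q ≤ g ^ 2 then (1 : ℝ) else 0) / g.totient
        ≤ #q.divisors * ∑ _g ∈ q.divisors, ((#q.divisors : ℝ) * (q : ℝ) ^ (-(1 / 2) : ℝ)) := by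
          gcongr with g hg
          have h0 : 0 < g := Nat.pos_of_mem_divisors hg
          have h1 := div_totient_le_card_divisors hg
          have h2 : (0 : ℝ) < g.totient := by exact_mod_cast Nat.totient_pos.2 h0
          split_ifs with h
          swap
          · rw [zero_div]; positivity
          have h3 : (1 : ℝ) / g ≤ (q : ℝ) ^ (-(1 / 2) : ℝ) := by
            rw [Real.rpow_neg hqr.le, one_div, ← Real.sqrt_eq_rpow]
            refine inv_anti₀ (Real.sqrt_pos.2 hqr) ?_
            rw [Real.sqrt_le_left (by positivity)]
            exact_mod_cast h
          calc 1 / (g.totient : ℝ) = g / g.totient * (1 / g) := by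
                have : (g : ℝ) ≠ 0 := by positivity
                field_simp
            _ ≤ _ := by gcongr
      _ = _ := by rw [sum_const, nsmul_eq_mul]; ring

open Classical in
lemma exists_pairSum_twistMean_le {k : ℕ} (hk : 1 ≤ k) : ∃ C : ℝ, 1 ≤ C ∧
    ∀ (co : ℕ → ℤ) (L : ℕ), LocallyAdmissible co k L → ∀ (R : ℕ) (a : ℤ) (q : ℕ), 1 ≤ q →
      IsCoprime a (q : ℤ) →
      pairSum L R (fun q₁ a₁ q₂ a₂ => ‖twistMean co k L a q q₁ a₁ q₂ a₂‖) ≤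
        C * sieveMass L R * (q : ℝ) ^ (-(1 / 2 ^ (k + 1) : ℝ)) := by
  rcases hk.eq_or_lt with rfl | hk
  swap
  · exact exists_pairSum_twistMean_le_of_two_le hk
  obtain ⟨C, hC, h⟩ := exists_card_divisors_pow_mul_le (x := -(1 / 2 : ℝ))
    (y := -(1 / 2 ^ (1 + 1) : ℝ)) (by norm_num)
  refine ⟨2 * C, by linarith, fun co L hco R a q hq haq => ?_⟩
  have hm := sieveMass_nonneg L R
  calc pairSum L R (fun q₁ a₁ q₂ a₂ => ‖twistMean co 1 L a q q₁ a₁ q₂ a₂‖)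
      ≤ pairSum L R (fun q₁ a₁ q₂ a₂ =>
          (if IsResonant L a q q₁ a₁ q₂ a₂ ∧ q ≤ (q₂.gcd q) ^ 2 then 1 else 0) +
          (if IsResonant L (-a) q q₂ a₂ q₁ a₁ ∧ q ≤ (q₁.gcd q) ^ 2 then 1 else 0)) := by
        refine pairSum_le_pairSum fun q₁ hq₁ a₁ ha₁ q₂ hq₂ a₂ ha₂ => ?_
        have h1 := (mem_sieveModuli.1 hq₁).1.1
        have h2 := (mem_sieveModuli.1 hq₂).1.1
        by_cases hr : IsResonant L a q q₁ a₁ q₂ a₂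
        swap
        · rw [norm_twistMean_le_of_linear hco hq h1 h2 hr, norm_zero]
          positivity
        have hle := norm_twistMean_le_one co 1 L a q q₁ a₁ q₂ a₂
        have hdvd : q ∣ q₁ * q₂ := by
          obtain ⟨m, hm⟩ := hr.eq_int hq h1 h2
          have : (q : ℤ) ∣ ((q₁ * q₂ : ℕ) : ℤ) := by
            refine haq.symm.dvd_of_dvd_mul_left ⟨q₁ * q₂ * m - L * (a₁ * q₂ - a₂ * q₁), ?_⟩
            push_cast
            linear_combination hm
          exact_mod_cast this
        have hgg : q ≤ q₁.gcd q * q₂.gcd q := by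
          have h3 := Nat.gcd_mul_right_dvd_mul_gcd q q₁ q₂
          rw [Nat.gcd_eq_left hdvd, Nat.gcd_comm q q₁, Nat.gcd_comm q q₂] at h3
          exact Nat.le_of_dvd (Nat.mul_pos (Nat.gcd_pos_of_pos_left _ h1)
            (Nat.gcd_pos_of_pos_left _ h2)) h3
        rcases le_total (q₁.gcd q) (q₂.gcd q) with h3 | h3
        · rw [if_pos ⟨hr, by nlinarith⟩]
          have : (0 : ℝ) ≤
              if IsResonant L (-a) q q₂ a₂ q₁ a₁ ∧ q ≤ (q₁.gcd q) ^ 2 then 1 else 0 := by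
            positivity
          linarith
        · rw [if_pos (⟨hr.swap, by nlinarith⟩ :
            IsResonant L (-a) q q₂ a₂ q₁ a₁ ∧ q ≤ (q₁.gcd q) ^ 2)]
          have : (0 : ℝ) ≤ if IsResonant L a q q₁ a₁ q₂ a₂ ∧ q ≤ (q₂.gcd q) ^ 2 then 1 else 0 := by
            positivity
          linarith
    _ ≤ sieveMass L R * ((#q.divisors : ℝ) ^ 3 * (q : ℝ) ^ (-(1 / 2) : ℝ)) +
        sieveMass L R * ((#q.divisors : ℝ) ^ 3 * (q : ℝ) ^ (-(1 / 2) : ℝ)) := by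
        rw [pairSum_add]
        gcongr
        · exact pairSum_isResonant_le L R hq
        · rw [pairSum_swap L R (fun q₁ a₁ q₂ a₂ =>
            if IsResonant L (-a) q q₁ a₁ q₂ a₂ ∧ q ≤ (q₂.gcd q) ^ 2 then 1 else 0)]
          exact pairSum_isResonant_le L R hq
    _ ≤ 2 * (sieveMass L R * (C * (q : ℝ) ^ (-(1 / 2 ^ (1 + 1) : ℝ)))) := by
        rw [← two_mul]
        exact mul_le_mul_of_nonneg_left (mul_le_mul_of_nonneg_left (h q hq) hm) (by norm_num)
    _ = _ := by ring

/-! ### Comparison of a sum with periodic coefficients to its mean -/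

lemma sum_range_succ_mul_eq (u v : ℕ → ℂ) (X : ℕ) :
    ∑ z ∈ range (X + 1), u z * v z = (∑ z ∈ range (X + 1), u z) * v X -
      ∑ z ∈ range X, (∑ y ∈ range (z + 1), u y) * (v (z + 1) - v z) := by
  induction X with
  | zero => simp
  | succ X ih =>
    rw [sum_range_succ (fun z => u z * v z) (X + 1), ih, sum_range_succ u (X + 1),
      sum_range_succ (fun z => (∑ y ∈ range (z + 1), u y) * (v (z + 1) - v z)) X]
    ring

lemma norm_sum_periodic_mul_sub_le {w v : ℕ → ℂ} {D X : ℕ} {ℓ : ℝ} (hD : 1 ≤ D)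
    (hw : ∀ z, w (z + D) = w z) (hw1 : ∀ z, ‖w z‖ ≤ 1) (hv : ∀ z, ‖v z‖ ≤ 1) (hℓ : 0 ≤ ℓ)
    (hvl : ∀ z, z + 1 < X → ‖v (z + 1) - v z‖ ≤ ℓ) :
    ‖∑ z ∈ range X, w z * v z - (∑ z ∈ range D, w z) / D * ∑ z ∈ range X, v z‖ ≤
      2 * D * (1 + X * ℓ) := by
  have hD0 : (D : ℝ) ≠ 0 := by positivity
  have hDC : (D : ℂ) ≠ 0 := by exact_mod_cast hD0
  set E : ℂ := (∑ z ∈ range D, w z) / D with hE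
  have hE1 : ‖E‖ ≤ 1 := by
    rw [hE, norm_div, Complex.norm_natCast]
    refine div_le_one_of_le₀ ?_ (by positivity)
    refine (norm_sum_le_of_le _ fun z _ => hw1 z).trans ?_
    simp
  set S : ℕ → ℂ := fun n => ∑ z ∈ range n, (w z - E) with hS
  have hSper : Function.Periodic S D := by
    intro n
    simp only [hS]
    rw [sum_range_add]
    have h1 : ∑ z ∈ range D, (w (n + z) - E) = 0 := by
      have h2 := sum_range_add_of_periodic hw n
      simp only [add_comm n]
      rw [sum_sub_distrib, h2, sum_const, card_range, nsmul_eq_mul, hE, mul_div_cancel₀ _ hDC,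
        sub_self]
    rw [h1, add_zero]
  have hSn : ∀ n, ‖S n‖ ≤ 2 * D := by
    intro n
    rw [← hSper.map_mod_nat n]
    have h1 : n % D ≤ D := (Nat.mod_lt _ hD).le
    calc ‖S (n % D)‖ ≤ ∑ z ∈ range (n % D), (2 : ℝ) := by
          refine norm_sum_le_of_le _ fun z _ => ?_
          calc ‖w z - E‖ ≤ ‖w z‖ + ‖E‖ := norm_sub_le _ _
            _ ≤ 2 := by linarith [hw1 z]
      _ = 2 * (n % D : ℕ) := by rw [sum_const, card_range, nsmul_eq_mul, mul_comm]
      _ ≤ 2 * D := by gcongr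
  have h0 : ∑ z ∈ range X, w z * v z - E * ∑ z ∈ range X, v z =
      ∑ z ∈ range X, (w z - E) * v z := by
    rw [mul_sum, ← sum_sub_distrib]
    exact sum_congr rfl fun z _ => by ring
  rw [h0]
  rcases X with _ | X
  · simp
  rw [sum_range_succ_mul_eq]
  have h1 : ‖S (X + 1) * v X‖ ≤ 2 * D := by
    rw [norm_mul]
    calc _ ≤ (2 * D : ℝ) * 1 := by gcongr; exacts [hSn _, hv _]
      _ = _ := mul_one _
  have h2 : ‖∑ z ∈ range X, S (z + 1) * (v (z + 1) - v z)‖ ≤ ∑ _z ∈ range X, 2 * D * ℓ := by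
    refine norm_sum_le_of_le _ fun z hz => ?_
    rw [norm_mul]
    have := hvl z (by have := mem_range.1 hz; omega)
    gcongr
    exact hSn _
  rw [sum_const, card_range, nsmul_eq_mul] at h2
  refine (norm_sub_le _ _).trans ((add_le_add h1 h2).trans ?_)
  push_cast
  have : 0 ≤ 2 * (D : ℝ) * ℓ := by positivity
  nlinarith

/-! ### A Kuzmin-Landau estimate -/

lemma distInt_eq_self {x : ℝ} (h0 : 0 ≤ x) (h1 : x ≤ 1 / 2) : distInt x = x := by
  rw [distInt, abs_sub_round_eq_min, Int.fract_eq_self.2 ⟨h0, by linarith⟩]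
  exact min_eq_left (by linarith)

lemma norm_sum_eC_le_of_monotone {g : ℕ → ℝ} {Y X : ℕ} (h0 : 0 < g (Y + 1) - g Y)
    (hm : ∀ z, Y ≤ z → g (z + 1) - g z ≤ g (z + 2) - g (z + 1))
    (h1 : ∀ z, Y ≤ z → z < X → g (z + 1) - g z ≤ 1 / 2) :
    ‖∑ z ∈ Ico Y X, eC (g z)‖ ≤ 1 / (g (Y + 1) - g Y) := by
  set d : ℕ → ℝ := fun z => g (z + 1) - g z with hd
  have hpos : ∀ z, Y ≤ z → 0 < d z := by
    intro z hz
    induction z, hz using Nat.le_induction with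
    | base => exact h0
    | succ z hz ih => exact ih.trans_le (hm z hz)
  have hne : ∀ z, Y ≤ z → z < X → 4 * d z ≤ ‖eC (d z) - 1‖ := by
    intro z hz hzX
    have := four_mul_distInt_le (d z)
    rwa [distInt_eq_self (hpos z hz).le (h1 z hz hzX)] at this
  have hne0 : ∀ z, Y ≤ z → z < X → eC (d z) - 1 ≠ 0 := by
    intro z hz hzX h
    have := hne z hz hzX
    rw [h, norm_zero] at this
    linarith [hpos z hz]
  set c : ℕ → ℂ := fun z => 1 / (eC (d z) - 1) with hc
  have hcn : ∀ z, Y ≤ z → z < X → ‖c z‖ ≤ 1 / (4 * d z) := by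
    intro z hz hzX
    rw [hc, norm_div, norm_one]
    have := hpos z hz
    exact one_div_le_one_div_of_le (by positivity) (hne z hz hzX)
  have hstep : ∀ z, Y ≤ z → z < X → eC (g z) + eC (g z) * c z = eC (g (z + 1)) * c z := by
    intro z hz hzX
    have : g (z + 1) = g z + d z := by simp [hd]
    rw [this, eC_add, hc]
    have := hne0 z hz hzX
    field_simp
    ring
  have hπ := Real.pi_pos
  have key : ∀ x, Y ≤ x → x < X →
      ‖∑ z ∈ Ico Y (x + 1), eC (g z) - eC (g (x + 1)) * c x‖ ≤
        1 / (4 * d Y) + Real.pi / 8 * (1 / d Y - 1 / d x) := by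
    intro x hx
    induction x, hx using Nat.le_induction with
    | base =>
      intro hX
      rw [← hstep Y le_rfl hX]
      simp only [Nat.Ico_succ_singleton, sum_singleton, sub_self, mul_zero, add_zero]
      rw [sub_add_cancel_left, norm_neg, norm_mul, norm_eC, one_mul]
      exact hcn Y le_rfl hX
    | succ x hx ih =>
      intro hX
      have ih := ih (by omega)
      rw [sum_Ico_succ_top (by omega), ← hstep (x + 1) (by omega) hX]
      have e1 : ∑ z ∈ Ico Y (x + 1), eC (g z) + eC (g (x + 1)) -
          (eC (g (x + 1)) + eC (g (x + 1)) * c (x + 1)) =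
          (∑ z ∈ Ico Y (x + 1), eC (g z) - eC (g (x + 1)) * c x) +
          eC (g (x + 1)) * (c x - c (x + 1)) := by ring
      rw [e1]
      have hdx := hpos x hx
      have hdx1 := hpos (x + 1) (by omega)
      have e2 : ‖c x - c (x + 1)‖ ≤ Real.pi / 8 * (1 / d x - 1 / d (x + 1)) := by
        have n1 := hne x hx (by omega)
        have n2 := hne (x + 1) (by omega) hX
        have e3 : c x - c (x + 1) = (eC (d (x + 1)) - eC (d x)) /
            ((eC (d x) - 1) * (eC (d (x + 1)) - 1)) := by
          have := hne0 x hx (by omega)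
          have := hne0 (x + 1) (by omega) hX
          simp only [hc]
          field_simp
          ring
        rw [e3, norm_div, norm_mul]
        have e4 := norm_eC_sub_eC_le (d (x + 1)) (d x)
        rw [abs_of_nonneg (sub_nonneg.2 (hm x hx))] at e4
        calc _ ≤ (2 * Real.pi * (d (x + 1) - d x)) / ((4 * d x) * (4 * d (x + 1))) := by
              have : 0 ≤ d (x + 1) - d x := sub_nonneg.2 (hm x hx)
              gcongr
          _ = _ := by field_simp; ring
      calc _ ≤ _ := norm_add_le _ _
        _ ≤ (1 / (4 * d Y) + Real.pi / 8 * (1 / d Y - 1 / d x)) +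
            Real.pi / 8 * (1 / d x - 1 / d (x + 1)) := by
            gcongr
            rw [norm_mul, norm_eC, one_mul]; exact e2
        _ = _ := by ring
  rcases le_or_gt X Y with hXY | hXY
  · rw [Ico_eq_empty (by omega), sum_empty, norm_zero]
    exact (one_div_pos.2 h0).le
  obtain ⟨x, rfl⟩ : ∃ x, X = x + 1 := ⟨X - 1, by omega⟩
  have hk := key x (by omega) (by omega)
  have hcx := hcn x (by omega) (by omega)
  have hx := hpos x (by omega)
  have hY := hpos Y le_rfl
  have h3 := Real.pi_gt_three
  have h4 := Real.pi_lt_d2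
  calc ‖∑ z ∈ Ico Y (x + 1), eC (g z)‖
      = ‖(∑ z ∈ Ico Y (x + 1), eC (g z) - eC (g (x + 1)) * c x) + eC (g (x + 1)) * c x‖ := by
        rw [sub_add_cancel]
    _ ≤ (1 / (4 * d Y) + Real.pi / 8 * (1 / d Y - 1 / d x)) + 1 / (4 * d x) := by
        refine (norm_add_le _ _).trans (add_le_add hk ?_)
        rw [norm_mul, norm_eC, one_mul]; exact hcx
    _ = (1 / 4 + Real.pi / 8) * (1 / d Y) - (Real.pi / 8 - 1 / 4) * (1 / d x) := by
        field_simp; ring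
    _ ≤ 1 * (1 / d Y) - 0 := by
        gcongr
        · linarith
        · have : 0 < 1 / d x := by positivity
          exact mul_nonneg (by linarith) this.le
    _ = _ := by rw [one_mul, sub_zero]

/-! ### Sums of `e(Λ z ^ k)` with small `Λ` -/

lemma add_one_pow_sub_pow (k : ℕ) (z : ℝ) :
    (z + 1) ^ k - z ^ k = ∑ i ∈ range k, (z + 1) ^ i * z ^ (k - 1 - i) := by
  have := geom_sum₂_mul (z + 1) z k
  rw [← this]; ring

lemma add_one_pow_sub_pow_le (k : ℕ) {z : ℝ} (hz : 0 ≤ z) :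
    (z + 1) ^ k - z ^ k ≤ k * (z + 1) ^ (k - 1) := by
  rw [add_one_pow_sub_pow]
  calc ∑ i ∈ range k, (z + 1) ^ i * z ^ (k - 1 - i)
      ≤ ∑ i ∈ range k, (z + 1) ^ (k - 1) := by
        refine sum_le_sum fun i hi => ?_
        have hi := mem_range.1 hi
        calc (z + 1) ^ i * z ^ (k - 1 - i) ≤ (z + 1) ^ i * (z + 1) ^ (k - 1 - i) := by
              gcongr; linarith
          _ = _ := by rw [← pow_add]; congr 1; omega
    _ = _ := by rw [sum_const, card_range, nsmul_eq_mul]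

lemma pow_le_add_one_pow_sub_pow {k : ℕ} (hk : 1 ≤ k) {z : ℝ} (hz : 0 ≤ z) :
    z ^ (k - 1) ≤ (z + 1) ^ k - z ^ k := by
  rw [add_one_pow_sub_pow]
  have := single_le_sum (f := fun i => (z + 1) ^ i * z ^ (k - 1 - i)) (s := range k)
    (fun i _ => by positivity) (mem_range.2 (by omega : 0 < k))
  simpa using this

lemma add_one_pow_sub_pow_mono (k : ℕ) {z y : ℝ} (hz : 0 ≤ z) (hzy : z ≤ y) :
    (z + 1) ^ k - z ^ k ≤ (y + 1) ^ k - y ^ k := by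
  rw [add_one_pow_sub_pow, add_one_pow_sub_pow]
  have : 0 ≤ y := hz.trans hzy
  gcongr

lemma norm_sum_eC_monomial_le_of_pos {k X : ℕ} (hk : 1 ≤ k) {Λ : ℝ} (hΛ : 0 < Λ)
    (hs : Λ * k * (X : ℝ) ^ (k - 1) ≤ 1 / 2) :
    ‖∑ z ∈ range X, eC (Λ * (z : ℝ) ^ k)‖ ≤ 2 * Λ ^ (-(1 / k : ℝ)) + 1 := by
  have hk0 : (k : ℝ) ≠ 0 := by positivity
  set y : ℝ := Λ ^ (-(1 / k : ℝ)) with hy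
  have hy0 : 0 < y := Real.rpow_pos_of_pos hΛ _
  set Y := ⌈y⌉₊ with hY
  have hYy : y ≤ Y := Nat.le_ceil y
  have hYle : (Y : ℝ) < y + 1 := Nat.ceil_lt_add_one hy0.le
  have hY0 : (0 : ℝ) < Y := hy0.trans_le hYy
  have hyk : Λ * y ^ k = 1 := by
    rw [hy, ← Real.rpow_natCast, ← Real.rpow_mul hΛ.le]
    have : -(1 / k : ℝ) * k = -1 := by field_simp
    rw [this, Real.rpow_neg_one, mul_inv_cancel₀ hΛ.ne']
  rcases le_or_gt X Y with hXY | hXY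
  · have h1 : ‖∑ z ∈ range X, eC (Λ * (z : ℝ) ^ k)‖ ≤ ∑ z ∈ range X, (1 : ℝ) :=
      norm_sum_le_of_le _ fun z _ => (norm_eC _).le
    have h2 : (X : ℝ) ≤ Y := by exact_mod_cast hXY
    simp only [sum_const, card_range, nsmul_eq_mul, mul_one] at h1
    linarith
  have hd : ∀ z : ℕ, Λ * ((z + 1 : ℕ) : ℝ) ^ k - Λ * (z : ℝ) ^ k =
      Λ * (((z : ℝ) + 1) ^ k - (z : ℝ) ^ k) := fun z => by push_cast; ring
  have hdY : 1 / y ≤ Λ * ((Y + 1 : ℕ) : ℝ) ^ k - Λ * (Y : ℝ) ^ k := by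
    rw [hd]
    calc 1 / y = Λ * y ^ (k - 1) := by
          rw [div_eq_iff hy0.ne', mul_assoc, ← pow_succ, Nat.sub_add_cancel hk, hyk]
      _ ≤ Λ * (Y : ℝ) ^ (k - 1) := by gcongr
      _ ≤ _ := by
          gcongr
          exact pow_le_add_one_pow_sub_pow hk hY0.le
  have h2 := norm_sum_eC_le_of_monotone (g := fun z : ℕ => Λ * (z : ℝ) ^ k) (Y := Y) (X := X)
    ((one_div_pos.2 hy0).trans_le hdY) (by
      intro z _
      have h1 := hd z
      have h2 := hd (z + 1)
      rw [h1, h2]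
      gcongr ?_ * ?_
      exact add_one_pow_sub_pow_mono k (by positivity) (by push_cast; linarith)) (by
      intro z _ hz
      rw [hd z]
      have hzX : (z : ℝ) + 1 ≤ X := by exact_mod_cast hz
      calc Λ * (((z : ℝ) + 1) ^ k - (z : ℝ) ^ k) ≤ Λ * (k * ((z : ℝ) + 1) ^ (k - 1)) := by
            gcongr
            exact add_one_pow_sub_pow_le k (by positivity)
        _ ≤ Λ * (k * (X : ℝ) ^ (k - 1)) := by gcongr
        _ ≤ 1 / 2 := by rw [← mul_assoc]; exact hs)
  have h3 : 1 / (Λ * ((Y + 1 : ℕ) : ℝ) ^ k - Λ * (Y : ℝ) ^ k) ≤ y := by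
    rw [one_div_le ((one_div_pos.2 hy0).trans_le hdY) hy0]; exact hdY
  rw [range_eq_Ico, ← sum_Ico_consecutive _ (Nat.zero_le Y) hXY.le]
  have h1 : ‖∑ z ∈ Ico 0 Y, eC (Λ * (z : ℝ) ^ k)‖ ≤ ∑ z ∈ Ico 0 Y, (1 : ℝ) :=
    norm_sum_le_of_le _ fun z _ => (norm_eC _).le
  simp only [sum_const, Nat.card_Ico, tsub_zero, nsmul_eq_mul, mul_one] at h1
  refine (norm_add_le _ _).trans ?_
  linarith [h2.trans h3]

lemma norm_sum_eC_neg (g : ℕ → ℝ) (s : Finset ℕ) :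
    ‖∑ z ∈ s, eC (-g z)‖ = ‖∑ z ∈ s, eC (g z)‖ := by
  rw [← Complex.norm_conj (∑ z ∈ s, eC (g z)), map_sum]
  simp only [conj_eC]

lemma norm_sum_eC_monomial_le {k X : ℕ} (hk : 1 ≤ k) (hX : 1 ≤ X) {Λ : ℝ}
    (hs : |Λ| * k * (X : ℝ) ^ (k - 1) ≤ 1 / 2) :
    ‖∑ z ∈ range X, eC (Λ * (z : ℝ) ^ k)‖ ≤
      4 * X * (1 + |Λ| * (X : ℝ) ^ k) ^ (-(1 / k : ℝ)) + 1 := by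
  have hk0 : (0 : ℝ) < k := by positivity
  have hX0 : (0 : ℝ) < X := by positivity
  have hk1 : (1 : ℝ) / k ≤ 1 := by
    rw [div_le_one hk0]; exact_mod_cast hk
  have h2k : (2 : ℝ) ^ (1 / k : ℝ) ≤ 2 := by
    calc (2 : ℝ) ^ (1 / k : ℝ) ≤ 2 ^ (1 : ℝ) := Real.rpow_le_rpow_of_exponent_le (by norm_num) hk1
      _ = 2 := Real.rpow_one 2
  have htriv : ‖∑ z ∈ range X, eC (Λ * (z : ℝ) ^ k)‖ ≤ X := by
    have h1 : ‖∑ z ∈ range X, eC (Λ * (z : ℝ) ^ k)‖ ≤ ∑ z ∈ range X, (1 : ℝ) :=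
      norm_sum_le_of_le _ fun z _ => (norm_eC _).le
    simpa using h1
  set s : ℝ := |Λ| * (X : ℝ) ^ k with hsdef
  have hs0 : 0 ≤ s := by positivity
  have hhalf : (1 / 2 : ℝ) * (max 1 s) ^ (-(1 / k : ℝ)) ≤ (1 + s) ^ (-(1 / k : ℝ)) := by
    have h1 : 1 + s ≤ 2 * max 1 s := by
      have := le_max_left 1 s
      have := le_max_right 1 s
      linarith
    have h2 : (0 : ℝ) < max 1 s := lt_max_of_lt_left one_pos
    calc (1 / 2 : ℝ) * (max 1 s) ^ (-(1 / k : ℝ))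
        ≤ (2 : ℝ) ^ (-(1 / k : ℝ)) * (max 1 s) ^ (-(1 / k : ℝ)) := by
          gcongr
          rw [Real.rpow_neg (by norm_num), one_div]
          exact inv_anti₀ (by positivity) h2k
      _ = (2 * max 1 s) ^ (-(1 / k : ℝ)) := by rw [Real.mul_rpow (by norm_num) h2.le]
      _ ≤ _ := Real.rpow_le_rpow_of_nonpos (by linarith) h1 (by
          rw [neg_nonpos]; positivity)
  rcases le_or_gt s 1 with h1 | h1
  · rw [max_eq_left h1, Real.one_rpow] at hhalf
    nlinarith
  · rw [max_eq_right h1.le] at hhalf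
    have hΛ : 0 < |Λ| := by
      by_contra h
      have : |Λ| = 0 := le_antisymm (not_lt.1 h) (abs_nonneg _)
      rw [hsdef, this, zero_mul] at h1
      linarith
    have hb : ‖∑ z ∈ range X, eC (Λ * (z : ℝ) ^ k)‖ ≤ 2 * |Λ| ^ (-(1 / k : ℝ)) + 1 := by
      rcases lt_or_gt_of_ne (abs_pos.1 hΛ) with h | h
      · have := norm_sum_eC_monomial_le_of_pos hk (neg_pos.2 h) (X := X)
          (by rwa [abs_of_neg h] at hs)
        rw [abs_of_neg h]
        simp only [neg_mul] at this
        rwa [norm_sum_eC_neg (fun z : ℕ => Λ * (z : ℝ) ^ k)] at this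
      · rw [abs_of_pos h] at hs ⊢
        exact norm_sum_eC_monomial_le_of_pos hk h hs
    have hrel : |Λ| ^ (-(1 / k : ℝ)) = X * s ^ (-(1 / k : ℝ)) := by
      have h3 : ((X : ℝ) ^ k) ^ (-(1 / k : ℝ)) = (X : ℝ)⁻¹ := by
        rw [← Real.rpow_natCast, ← Real.rpow_mul hX0.le]
        have : (k : ℝ) * -(1 / k : ℝ) = -1 := by field_simp
        rw [this, Real.rpow_neg_one]
      rw [hsdef, Real.mul_rpow hΛ.le (by positivity), h3]
      field_simp
    rw [hrel] at hb
    nlinarith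

lemma abs_polyVal_add_one_sub_le {co : ℕ → ℤ} {k X : ℕ} {H : ℝ} (hX : 1 ≤ X)
    (hH : ∀ j ∈ Icc 1 k, |(co j : ℝ)| ≤ H) {z : ℕ} (hz : z + 1 ≤ X) :
    |((polyVal co k (z + 1) - polyVal co k z : ℤ) : ℝ)| ≤ k ^ 2 * H * (X : ℝ) ^ (k - 1) := by
  have hX1 : (1 : ℝ) ≤ X := by exact_mod_cast hX
  have hz' : (z : ℝ) + 1 ≤ X := by exact_mod_cast hz
  have h1 : ((polyVal co k (z + 1) - polyVal co k z : ℤ) : ℝ) =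
      ∑ j ∈ Icc 1 k, (co j : ℝ) * (((z : ℝ) + 1) ^ j - (z : ℝ) ^ j) := by
    rw [polyVal, polyVal, ← sum_sub_distrib]
    push_cast
    exact sum_congr rfl fun j _ => by ring
  rw [h1]
  calc _ ≤ ∑ j ∈ Icc 1 k, H * (k * (X : ℝ) ^ (k - 1)) := by
        refine (abs_sum_le_sum_abs _ _).trans (sum_le_sum fun j hj => ?_)
        have hH0 : 0 ≤ H := (abs_nonneg _).trans (hH j hj)
        have hj' := mem_Icc.1 hj
        have h0 : (0 : ℝ) ≤ ((z : ℝ) + 1) ^ j - (z : ℝ) ^ j := by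
          rw [sub_nonneg]; gcongr; linarith
        rw [abs_mul, abs_of_nonneg h0]
        gcongr
        · exact hH j hj
        · calc _ ≤ (j : ℝ) * ((z : ℝ) + 1) ^ (j - 1) := add_one_pow_sub_pow_le j (by positivity)
            _ ≤ (k : ℝ) * (X : ℝ) ^ (j - 1) := by
                have : (j : ℝ) ≤ k := by exact_mod_cast hj'.2
                gcongr
            _ ≤ _ := by
                gcongr
                omega
    _ = _ := by rw [sum_const, Nat.card_Icc, nsmul_eq_mul]; push_cast; ring

lemma abs_polyVal_sub_le {co : ℕ → ℤ} {k X : ℕ} {H : ℝ} (hk : 1 ≤ k) (hX : 1 ≤ X)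
    (hH : ∀ j ∈ Icc 1 k, |(co j : ℝ)| ≤ H) {z : ℕ} (hz : z ≤ X) :
    |(polyVal co k z : ℝ) - co k * (z : ℝ) ^ k| ≤ k * H * (X : ℝ) ^ (k - 1) := by
  have hX1 : (1 : ℝ) ≤ X := by exact_mod_cast hX
  have hz' : (z : ℝ) ≤ X := by exact_mod_cast hz
  obtain ⟨d, rfl⟩ : ∃ d, k = d + 1 := ⟨k - 1, by omega⟩
  have hH0 : 0 ≤ H := (abs_nonneg _).trans (hH 1 (by simp))
  have h1 : (polyVal co (d + 1) z : ℝ) - co (d + 1) * (z : ℝ) ^ (d + 1) =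
      ∑ j ∈ Icc 1 d, (co j : ℝ) * (z : ℝ) ^ j := by
    rw [polyVal, sum_Icc_succ_top (by omega)]
    push_cast
    ring
  rw [h1]
  calc _ ≤ ∑ j ∈ Icc 1 d, H * (X : ℝ) ^ d := by
        refine (abs_sum_le_sum_abs _ _).trans (sum_le_sum fun j hj => ?_)
        have hj' := mem_Icc.1 hj
        rw [abs_mul, abs_of_nonneg (by positivity : (0 : ℝ) ≤ (z : ℝ) ^ j)]
        gcongr
        · exact hH j (mem_Icc.2 ⟨hj'.1, by omega⟩)
        · calc (z : ℝ) ^ j ≤ (X : ℝ) ^ j := by gcongr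
            _ ≤ _ := by gcongr; exact hj'.2
    _ = d * H * (X : ℝ) ^ d := by rw [sum_const, Nat.card_Icc, nsmul_eq_mul]; push_cast; ring
    _ ≤ _ := by
        rw [Nat.add_sub_cancel]
        gcongr
        linarith

/-- The major arc approximation to a twisted polynomial exponential sum. -/
lemma norm_sum_twist_major_le {co : ℕ → ℤ} {k L X : ℕ} {H : ℝ} (hk : 1 ≤ k) (hX : 1 ≤ X)
    (hH : ∀ j ∈ Icc 1 k, |(co j : ℝ)| ≤ H) (a : ℤ) {q q₁ q₂ : ℕ} (a₁ a₂ : ℕ) (hq : 1 ≤ q)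
    (hq₁ : 1 ≤ q₁) (hq₂ : 1 ≤ q₂) (β : ℝ) (hβ : |β| * H * (X : ℝ) ^ k * k ≤ X / 2) :
    ‖∑ z ∈ range X, eC ((a / q + β) * polyVal co k z + L * ((a₁ : ℝ) / q₁ - a₂ / q₂) * z)‖ ≤
      4 * X * (1 + |β * co k| * (X : ℝ) ^ k) ^ (-(1 / k : ℝ)) *
          ‖twistMean co k L a q q₁ a₁ q₂ a₂‖ +
        50 * k ^ 2 * (q * (q₁ * q₂) : ℕ) * (1 + |β| * H * (X : ℝ) ^ k) := by
  have hX0 : (0 : ℝ) < X := by exact_mod_cast hX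
  have hk1 : (1 : ℝ) ≤ k := by exact_mod_cast hk
  have hH0 : 0 ≤ H := (abs_nonneg _).trans (hH 1 (by simp [hk]))
  have hπ := Real.pi_lt_d2
  have hπ0 := Real.pi_pos
  set D := q * (q₁ * q₂) with hD
  have hD1 : 1 ≤ D := Nat.mul_pos hq (Nat.mul_pos hq₁ hq₂)
  set b := |β| * H * (X : ℝ) ^ k with hb
  have hb0 : 0 ≤ b := by positivity
  have hXk : (X : ℝ) ^ k = X * (X : ℝ) ^ (k - 1) := by
    rw [← pow_succ', Nat.sub_add_cancel hk]
  set E := twistMean co k L a q q₁ a₁ q₂ a₂ with hE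
  have hE1 : ‖E‖ ≤ 1 := norm_twistMean_le_one ..
  set v : ℕ → ℂ := fun z => eC (β * polyVal co k z) with hv
  set ℓ : ℝ := 2 * Real.pi * (|β| * (k ^ 2 * H * (X : ℝ) ^ (k - 1))) with hℓ
  have hXℓ : X * ℓ = 2 * Real.pi * (k ^ 2 * b) := by rw [hℓ, hb, hXk]; ring
  have hmain := norm_sum_periodic_mul_sub_le (X := X) (v := v) (ℓ := ℓ) hD1
    (twist_periodic co k L a a₁ a₂ hq hq₁ hq₂) (fun z => (norm_twist ..).le)
    (fun z => (norm_eC _).le) (by positivity) (by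
      intro z hz
      refine (norm_eC_sub_eC_le _ _).trans ?_
      rw [hℓ, ← mul_sub, abs_mul]
      have := abs_polyVal_add_one_sub_le (co := co) (k := k) hX hH (z := z) (by omega)
      push_cast at this ⊢
      gcongr)
  have hsum : ∑ z ∈ range X,
      eC ((a / q + β) * polyVal co k z + L * ((a₁ : ℝ) / q₁ - a₂ / q₂) * z) =
      ∑ z ∈ range X, twist co k L a q ((a₁ : ℝ) / q₁ - a₂ / q₂) z * v z := by
    refine sum_congr rfl fun z _ => ?_
    rw [twist, hv, ← eC_add]
    congr 1; ring
  have hV : ‖∑ z ∈ range X, v z‖ ≤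
      4 * X * (1 + |β * co k| * (X : ℝ) ^ k) ^ (-(1 / k : ℝ)) + 1 + 2 * Real.pi * (k * b) := by
    have h1 := norm_sum_eC_monomial_le (k := k) hk hX (Λ := β * co k) (by
      have h2 : |β * co k| ≤ |β| * H := by
        rw [abs_mul]
        gcongr
        exact hH k (by simp [hk])
      have h3 : |β| * H * k * (X : ℝ) ^ (k - 1) ≤ 1 / 2 := by
        have : X * (|β| * H * k * (X : ℝ) ^ (k - 1)) ≤ X * (1 / 2) := by
          rw [hb, hXk] at hβ
          linarith
        exact le_of_mul_le_mul_left this hX0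
      refine le_trans ?_ h3
      gcongr)
    have h2 : ‖∑ z ∈ range X, v z - ∑ z ∈ range X, eC (β * co k * (z : ℝ) ^ k)‖ ≤
        2 * Real.pi * (k * b) := by
      rw [← sum_sub_distrib]
      calc _ ≤ ∑ _z ∈ range X, 2 * Real.pi * (|β| * (k * H * (X : ℝ) ^ (k - 1))) := by
            refine norm_sum_le_of_le _ fun z hz => ?_
            refine (norm_eC_sub_eC_le _ _).trans ?_
            rw [mul_assoc β, ← mul_sub, abs_mul]
            have := abs_polyVal_sub_le hk hX hH (mem_range.1 hz).le
            gcongr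
        _ = _ := by rw [sum_const, card_range, nsmul_eq_mul, hb, hXk]; ring
    have h3 : ∑ z ∈ range X, v z = ∑ z ∈ range X, eC (β * co k * (z : ℝ) ^ k) +
      (∑ z ∈ range X, v z - ∑ z ∈ range X, eC (β * co k * (z : ℝ) ^ k)) := by ring
    rw [h3]
    refine (norm_add_le _ _).trans ?_
    linarith
  set T := 4 * X * (1 + |β * co k| * (X : ℝ) ^ k) ^ (-(1 / k : ℝ)) with hT
  rw [hsum]
  set S := ∑ z ∈ range X, twist co k L a q ((a₁ : ℝ) / q₁ - a₂ / q₂) z * v z with hS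
  have h5 : S = (S - E * ∑ z ∈ range X, v z) + E * ∑ z ∈ range X, v z := by ring
  rw [h5]
  have hDr : (1 : ℝ) ≤ D := by exact_mod_cast hD1
  have hkk : (k : ℝ) ≤ k ^ 2 := by nlinarith
  have hbk : b ≤ k ^ 2 * b := by nlinarith
  have hkb : k * b ≤ k ^ 2 * b := by gcongr
  calc _ ≤ ‖S - E * ∑ z ∈ range X, v z‖ + ‖E‖ * ‖∑ z ∈ range X, v z‖ := by
        refine (norm_add_le _ _).trans ?_
        rw [norm_mul]
    _ ≤ 2 * D * (1 + 2 * Real.pi * (k ^ 2 * b)) +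
        ‖E‖ * (T + 1 + 2 * Real.pi * (k * b)) := by
        rw [← hXℓ]
        gcongr
        exact hmain
    _ ≤ 2 * D * (1 + 2 * Real.pi * (k ^ 2 * b)) +
        (T * ‖E‖ + 1 * (1 + 2 * Real.pi * (k ^ 2 * b))) := by
        have h6 : 2 * Real.pi * (k * b) ≤ 2 * Real.pi * (k ^ 2 * b) := by gcongr
        have : ‖E‖ * (1 + 2 * Real.pi * (k * b)) ≤ 1 * (1 + 2 * Real.pi * (k ^ 2 * b)) :=
          mul_le_mul hE1 (by linarith) (by positivity) zero_le_one
        linarith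
    _ ≤ T * ‖E‖ + D * (3 * (1 + 2 * Real.pi * (k ^ 2 * b))) := by
        have : 1 * (1 + 2 * Real.pi * (k ^ 2 * b)) ≤ D * (1 + 2 * Real.pi * (k ^ 2 * b)) := by
          gcongr
        linarith
    _ ≤ T * ‖E‖ + D * (50 * k ^ 2 * (1 + b)) := by
        have h6 : Real.pi * (k ^ 2 * b) ≤ 3.15 * (k ^ 2 * b) := by gcongr
        have h7 : 3 * (1 + 2 * Real.pi * (k ^ 2 * b)) ≤ 50 * k ^ 2 * (1 + b) := by nlinarith
        have h8 := mul_le_mul_of_nonneg_left h7 (by positivity : (0 : ℝ) ≤ D)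
        linarith
    _ = _ := by ring

/-- The weighted exponential sum on a major arc. -/
lemma exists_norm_sum_sieveWeight_major_le {k : ℕ} (hk : 1 ≤ k) : ∃ C : ℝ, 1 ≤ C ∧
    ∀ (co : ℕ → ℤ) (L : ℕ), LocallyAdmissible co k L → ∀ (R : ℕ) (a : ℤ) (q : ℕ), 1 ≤ R → 1 ≤ q →
      IsCoprime a (q : ℤ) → ∀ (c X : ℕ) (H β : ℝ), 1 ≤ X → (∀ j ∈ Icc 1 k, |(co j : ℝ)| ≤ H) →
      |β| * H * (X : ℝ) ^ k * k ≤ X / 2 →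
      ‖∑ z ∈ range X, (sieveWeight L R (L * z + c) : ℂ) * eC ((a / q + β) * polyVal co k z)‖ ≤
        C * X * (q : ℝ) ^ (-(1 / 2 ^ (k + 1) : ℝ)) *
            (1 + |β * co k| * (X : ℝ) ^ k) ^ (-(1 / k : ℝ)) +
          C * q * (R : ℝ) ^ 4 * (1 + |β| * H * (X : ℝ) ^ k) := by
  obtain ⟨C, hC, h⟩ := exists_pairSum_twistMean_le hk
  have hk1 : (1 : ℝ) ≤ k := by exact_mod_cast hk
  refine ⟨4 * C + 50 * k ^ 2, by nlinarith, ?_⟩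
  intro co L hco R a q hR hq haq c X H β hX hH hβ
  have hH0 : 0 ≤ H := (abs_nonneg _).trans (hH 1 (by simp [hk]))
  have hmass := one_le_sieveMass (L := L) hR
  have hmass0 : 0 < sieveMass L R := by linarith
  set T := (1 + |β * co k| * (X : ℝ) ^ k) ^ (-(1 / k : ℝ)) with hT
  have hT0 : 0 ≤ T := by positivity
  set B := 1 + |β| * H * (X : ℝ) ^ k with hB
  have hB0 : 0 ≤ B := by positivity
  have h1 := norm_sum_sieveWeight_mul_eC_le L R c (range X)
    (fun z : ℕ => (a / q + β) * polyVal co k z)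
  refine h1.trans ?_
  have h2 : pairSum L R (fun q₁ a₁ q₂ a₂ => ‖∑ z ∈ range X,
      eC ((a / q + β) * polyVal co k z + L * ((a₁ : ℝ) / q₁ - a₂ / q₂) * z)‖) ≤
      pairSum L R (fun q₁ a₁ q₂ a₂ => 4 * X * T * ‖twistMean co k L a q q₁ a₁ q₂ a₂‖ +
        50 * k ^ 2 * q * (R : ℝ) ^ 2 * B * 1) := by
    refine pairSum_le_pairSum fun q₁ hq₁ a₁ ha₁ q₂ hq₂ a₂ ha₂ => ?_
    have h1 := (mem_sieveModuli.1 hq₁).1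
    have h2 := (mem_sieveModuli.1 hq₂).1
    refine (norm_sum_twist_major_le hk hX hH a a₁ a₂ hq h1.1 h2.1 β hβ).trans ?_
    rw [mul_one]
    refine add_le_add (le_of_eq (by ring)) (mul_le_mul_of_nonneg_right ?_ hB0)
    have h3 : (q₁ : ℝ) ≤ R := by exact_mod_cast h1.2
    have h4 : (q₂ : ℝ) ≤ R := by exact_mod_cast h2.2
    calc (50 * (k : ℝ) ^ 2 * ((q * (q₁ * q₂) : ℕ) : ℝ)) =
          50 * (k : ℝ) ^ 2 * (q : ℝ) * ((q₁ : ℝ) * (q₂ : ℝ)) := by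
          push_cast; ring
      _ ≤ 50 * (k : ℝ) ^ 2 * (q : ℝ) * ((R : ℝ) * (R : ℝ)) := by gcongr
      _ = _ := by ring
  have h3 := h co L hco R a q hq haq
  have h4 := pairSum_one_le L R
  rw [pairSum_add, pairSum_mul_left, pairSum_mul_left] at h2
  calc _ ≤ 1 / sieveMass L R * (4 * X * T * (C * sieveMass L R * (q : ℝ) ^ (-(1 / 2 ^ (k + 1) : ℝ)))
        + 50 * k ^ 2 * q * (R : ℝ) ^ 2 * B * (R : ℝ) ^ 2) := by
        gcongr
        refine h2.trans ?_
        gcongr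
    _ = 4 * C * X * (q : ℝ) ^ (-(1 / 2 ^ (k + 1) : ℝ)) * T +
        1 / sieveMass L R * (50 * k ^ 2 * q * (R : ℝ) ^ 4 * B) := by
        field_simp
    _ ≤ 4 * C * X * (q : ℝ) ^ (-(1 / 2 ^ (k + 1) : ℝ)) * T +
        1 * (50 * k ^ 2 * q * (R : ℝ) ^ 4 * B) := by
        gcongr
        rw [div_le_one hmass0]; exact hmass
    _ ≤ (4 * C + 50 * k ^ 2) * X * (q : ℝ) ^ (-(1 / 2 ^ (k + 1) : ℝ)) * T +
        (4 * C + 50 * k ^ 2) * q * (R : ℝ) ^ 4 * B := by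
        rw [one_mul]
        gcongr
        · have : (0 : ℝ) ≤ 50 * k ^ 2 := by positivity
          linarith
        · linarith

/-- The polynomial exponential sum weighted by the sieve majorant of the primes. -/
noncomputable def sievePolySum (co : ℕ → ℤ) (k L R c X : ℕ) (θ : ℝ) : ℂ :=
  ∑ z ∈ range X, (sieveWeight L R (L * z + c) : ℂ) * eC (θ * polyVal co k z)

lemma eventually_const_mul_rpow_le (C : ℝ) {a b : ℝ} (hab : a < b) :
    ∀ᶠ M : ℕ in Filter.atTop, C * (M : ℝ) ^ a ≤ (M : ℝ) ^ b := by
  have h1 := (tendsto_rpow_atTop (sub_pos.2 hab)).comp (tendsto_natCast_atTop_atTop (R := ℝ))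
  filter_upwards [h1.eventually_ge_atTop C, Filter.eventually_ge_atTop 1] with M hM hM1
  have hM0 : (0 : ℝ) < M := by exact_mod_cast hM1
  calc C * (M : ℝ) ^ a ≤ (M : ℝ) ^ (b - a) * (M : ℝ) ^ a := by
        gcongr
        exact hM
    _ = (M : ℝ) ^ b := by rw [← Real.rpow_add hM0]; ring_nf

lemma norm_sievePolySum_le_of_twists {co : ℕ → ℤ} {k L R : ℕ} (hR : 1 ≤ R) (c X : ℕ) (θ B : ℝ)
    (hB : ∀ q₁ ∈ sieveModuli L R, ∀ a₁ : ℕ, ∀ q₂ ∈ sieveModuli L R, ∀ a₂ : ℕ,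
      ‖∑ z ∈ Ico (0 : ℤ) X, eC (θ * polyVal co k z + L * ((a₁ : ℝ) / q₁ - a₂ / q₂) * z)‖ ≤ B) :
    ‖sievePolySum co k L R c X θ‖ ≤ B * (R : ℝ) ^ 2 := by
  have hmass := one_le_sieveMass (L := L) hR
  have h1mem : 1 ∈ sieveModuli L R := mem_sieveModuli.2 ⟨⟨le_rfl, hR⟩, squarefree_one, by simp⟩
  have hB0 : 0 ≤ B := (norm_nonneg _).trans (hB 1 h1mem 0 1 h1mem 0)
  refine (norm_sum_sieveWeight_mul_eC_le L R c (range X)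
    (fun z : ℕ => θ * polyVal co k z)).trans ?_
  have h2 : pairSum L R (fun q₁ a₁ q₂ a₂ => ‖∑ z ∈ range X,
      eC (θ * polyVal co k z + L * ((a₁ : ℝ) / q₁ - a₂ / q₂) * z)‖) ≤
      pairSum L R (fun q₁ a₁ q₂ a₂ => B * 1) := by
    refine pairSum_le_pairSum fun q₁ hq₁ a₁ _ q₂ hq₂ a₂ _ => ?_
    rw [mul_one]
    refine le_trans (le_of_eq ?_) (hB q₁ hq₁ a₁ q₂ hq₂ a₂)
    rw [← sum_range_eq_sum_Ico_int
      (fun z : ℤ => eC (θ * polyVal co k z + L * ((a₁ : ℝ) / q₁ - a₂ / q₂) * z))]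
    simp
  rw [pairSum_mul_left] at h2
  have h3 := pairSum_one_le L R
  calc _ ≤ 1 * (B * (R : ℝ) ^ 2) := by
        refine mul_le_mul ?_ (h2.trans (by gcongr)) ?_ zero_le_one
        · rw [div_le_one (by linarith)]; exact hmass
        · unfold pairSum; positivity
    _ = _ := one_mul _

/-- Minor arc estimate in degree at least two. -/
lemma eventually_norm_sievePolySum_minor_le {k : ℕ} (hk : 2 ≤ k) :
    ∀ᶠ M : ℕ in Filter.atTop, ∀ (co : ℕ → ℤ) (L R c : ℕ), 1 ≤ R →
      (R : ℝ) ≤ (M : ℝ) ^ (1 / 2 ^ (k + 10) : ℝ) → ∀ (θ : ℝ) (a : ℤ) (q : ℕ), 1 ≤ q →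
      IsCoprime a (q : ℤ) → (M : ℝ) ^ (1 / 8 : ℝ) ≤ q → (q : ℝ) ≤ (M : ℝ) ^ (k - 1 / 8 : ℝ) →
      |co k * θ - a / q| ≤ 1 / (q : ℝ) ^ 2 →
      ‖sievePolySum co k L R c (M + 1) θ‖ ≤ (M : ℝ) ^ (1 - 1 / (5 * 2 ^ k) : ℝ) := by
  obtain ⟨j, rfl⟩ : ∃ j, k = j + 1 := ⟨k - 1, by omega⟩
  have hj : 1 ≤ j := by omega
  obtain ⟨C, hC1, hC⟩ := weyl_inequality hj (ε := 1 / 100) (by norm_num)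
  set J : ℝ := 2 ^ j with hJ
  have hJ1 : (1 : ℝ) ≤ J := one_le_pow₀ (by norm_num)
  filter_upwards [Filter.eventually_ge_atTop 1,
    eventually_const_mul_rpow_le (C * 2 ^ (2 ^ j) * 2 * 3)
      (show J + 1 / 100 - 1 / 8 < J - 1 / 9 by linarith)] with M hM hM1
  intro co L R c hR hRM θ a q hq haq hqM hqM' hθ
  have hM0 : (0 : ℝ) < M := by exact_mod_cast hM
  have hM1' : (1 : ℝ) ≤ M := by exact_mod_cast hM
  have hMX : (((M + 1 : ℕ) : ℝ)) ≤ 2 * M := by push_cast; linarith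
  have hqX : q ≤ (M + 1) ^ (j + 1) := by
    have : (q : ℝ) ≤ ((M + 1 : ℕ) : ℝ) ^ (j + 1) := by
      calc (q : ℝ) ≤ (M : ℝ) ^ (((j + 1 : ℕ) : ℝ) - 1 / 8) := hqM'
        _ ≤ (M : ℝ) ^ ((j + 1 : ℕ) : ℝ) := Real.rpow_le_rpow_of_exponent_le hM1' (by linarith)
        _ = (M : ℝ) ^ (j + 1) := Real.rpow_natCast ..
        _ ≤ _ := by gcongr; linarith
    exact_mod_cast this
  have htw : ∀ q₁ ∈ sieveModuli L R, ∀ a₁ : ℕ, ∀ q₂ ∈ sieveModuli L R, ∀ a₂ : ℕ,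
      ‖∑ z ∈ Ico (0 : ℤ) ((M + 1 : ℕ) : ℤ), eC (θ * polyVal co (j + 1) z +
        L * ((a₁ : ℝ) / q₁ - a₂ / q₂) * z)‖ ≤ (M : ℝ) ^ (1 - 1 / (9 * J)) := by
    intro q₁ _ a₁ q₂ _ a₂
    have hl : HasLead (j + 1) (θ * co (j + 1)) (fun z => θ * polyVal co (j + 1) z +
        L * ((a₁ : ℝ) / q₁ - a₂ / q₂) * z) := by
      have h1 := (hasLead_polyVal co (by omega : 1 ≤ j + 1) θ).add
        (hasLead_monomial (j + 1) (j := 1) (by omega) (L * ((a₁ : ℝ) / q₁ - a₂ / q₂)))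
      rw [if_neg (by omega), add_zero] at h1
      simpa using h1
    have h2 := hC (M + 1) (by omega) a q hq hqX haq (θ * co (j + 1)) (by rwa [mul_comm]) _ hl
      0 ((M + 1 : ℕ) : ℤ) (by simp)
    set S := ‖∑ z ∈ Ico (0 : ℤ) ((M + 1 : ℕ) : ℤ), eC (θ * polyVal co (j + 1) z +
        L * ((a₁ : ℝ) / q₁ - a₂ / q₂) * z)‖ with hS
    have h3 : 1 / (q : ℝ) ≤ (M : ℝ) ^ (-(1 / 8) : ℝ) := by
      rw [Real.rpow_neg hM0.le, ← one_div]
      exact one_div_le_one_div_of_le (by positivity) hqM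
    have h4 : 1 / ((M + 1 : ℕ) : ℝ) ≤ (M : ℝ) ^ (-(1 / 8) : ℝ) := by
      rw [Real.rpow_neg hM0.le, ← one_div]
      refine one_div_le_one_div_of_le (by positivity) ?_
      calc (M : ℝ) ^ (1 / 8 : ℝ) ≤ (M : ℝ) ^ (1 : ℝ) :=
            Real.rpow_le_rpow_of_exponent_le hM1' (by norm_num)
        _ ≤ _ := by rw [Real.rpow_one]; push_cast; linarith
    have h5 : (q : ℝ) / ((M + 1 : ℕ) : ℝ) ^ (j + 1) ≤ (M : ℝ) ^ (-(1 / 8) : ℝ) := by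
      rw [div_le_iff₀ (by positivity)]
      calc (q : ℝ) ≤ (M : ℝ) ^ (((j + 1 : ℕ) : ℝ) - 1 / 8) := hqM'
        _ = (M : ℝ) ^ (-(1 / 8) : ℝ) * (M : ℝ) ^ (j + 1) := by
            rw [← Real.rpow_natCast, ← Real.rpow_add hM0]; ring_nf
        _ ≤ _ := by gcongr; linarith
    have h6 : S ^ (2 ^ j) ≤ (M : ℝ) ^ (J - 1 / 9) := by
      refine h2.trans (le_trans ?_ hM1)
      calc _ ≤ C * (2 * M : ℝ) ^ (2 ^ j) * (2 * M : ℝ) ^ (1 / 100 : ℝ) *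
            ((M : ℝ) ^ (-(1 / 8) : ℝ) + (M : ℝ) ^ (-(1 / 8) : ℝ) + (M : ℝ) ^ (-(1 / 8) : ℝ)) := by
              gcongr
        _ = C * 2 ^ (2 ^ j) * 2 ^ (1 / 100 : ℝ) * 3 *
            ((M : ℝ) ^ (2 ^ j) * (M : ℝ) ^ (1 / 100 : ℝ) * (M : ℝ) ^ (-(1 / 8) : ℝ)) := by
              rw [Real.mul_rpow (by norm_num) hM0.le]; ring
        _ = C * 2 ^ (2 ^ j) * 2 ^ (1 / 100 : ℝ) * 3 * (M : ℝ) ^ (J + 1 / 100 - 1 / 8) := by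
              rw [← Real.rpow_natCast (M : ℝ), ← Real.rpow_add hM0, ← Real.rpow_add hM0, hJ]
              push_cast
              ring_nf
        _ ≤ _ := by
              gcongr
              calc (2 : ℝ) ^ (1 / 100 : ℝ) ≤ 2 ^ (1 : ℝ) :=
                    Real.rpow_le_rpow_of_exponent_le (by norm_num) (by norm_num)
                _ = 2 := Real.rpow_one _
    have h7 : ((M : ℝ) ^ (1 - 1 / (9 * J))) ^ (2 ^ j) = (M : ℝ) ^ (J - 1 / 9) := by
      rw [← Real.rpow_natCast, ← Real.rpow_mul hM0.le]
      congr 1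
      push_cast
      rw [← hJ]
      field_simp
    rw [← h7] at h6
    exact le_of_pow_le_pow_left₀ (by positivity) (by positivity) h6
  refine (norm_sievePolySum_le_of_twists hR c (M + 1) θ _ htw).trans ?_
  calc _ ≤ (M : ℝ) ^ (1 - 1 / (9 * J)) * ((M : ℝ) ^ (1 / 2 ^ (j + 1 + 10) : ℝ)) ^ 2 := by gcongr
    _ = (M : ℝ) ^ (1 - 1 / (9 * J) + 1 / 2 ^ (j + 1 + 10) * 2 : ℝ) := by
        rw [← Real.rpow_natCast, ← Real.rpow_mul hM0.le, ← Real.rpow_add hM0]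
        norm_num
    _ ≤ _ := by
        refine Real.rpow_le_rpow_of_exponent_le hM1' ?_
        have e1 : (1 / 2 ^ (j + 1 + 10) * 2 : ℝ) = 1 / 1024 * (1 / J) := by
          rw [hJ, pow_add, pow_add]; field_simp; norm_num
        have e2 : (1 / (5 * 2 ^ (j + 1)) : ℝ) = 1 / 10 * (1 / J) := by
          rw [hJ, pow_succ]; field_simp; norm_num
        have e3 : (1 / (9 * J) : ℝ) = 1 / 9 * (1 / J) := by field_simp
        rw [e1, e2, e3]
        have : 0 < 1 / J := by positivity
        linarith

/-- Minor arc estimate in degree one. -/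
lemma eventually_norm_sievePolySum_minor_le_of_linear :
    ∀ᶠ M : ℕ in Filter.atTop, ∀ (co : ℕ → ℤ) (L R c : ℕ), co 1 = 1 → 1 ≤ R →
      (R : ℝ) ≤ (M : ℝ) ^ (1 / 2 ^ (1 + 10) : ℝ) → ∀ (θ : ℝ) (a : ℤ) (q : ℕ), 1 ≤ q →
      IsCoprime a (q : ℤ) → (M : ℝ) ^ (1 / 8 : ℝ) ≤ q → (q : ℝ) ≤ (M : ℝ) ^ (1 - 1 / 8 : ℝ) →
      |co 1 * θ - a / q| * (q * (M : ℝ) ^ (1 - 1 / 8 : ℝ)) ≤ 1 →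
      ‖sievePolySum co 1 L R c (M + 1) θ‖ ≤ (M : ℝ) ^ (1 - 1 / (5 * 2 ^ 1) : ℝ) := by
  filter_upwards [Filter.eventually_ge_atTop 1,
    eventually_const_mul_rpow_le 2 (show 1 / 2 ^ 10 < (1 / 8 : ℝ) by norm_num),
    eventually_const_mul_rpow_le 2 (show 1 / 2 ^ 10 < (1 - 1 / 8 : ℝ) by norm_num),
    eventually_const_mul_rpow_le 4
      (show 1 - 1 / 8 + 1 / 2 ^ 9 < (1 - 1 / (5 * 2 ^ 1) : ℝ) by norm_num)] with M hM hM1 hM2 hM3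
  intro co L R c hco hR hRM θ a q hq haq hqM hqM' hθ
  have hM0 : (0 : ℝ) < M := by exact_mod_cast hM
  have hq0 : (0 : ℝ) < q := by exact_mod_cast hq
  have hR1 : (1 : ℝ) ≤ R := by exact_mod_cast hR
  have hR2 : (R : ℝ) ^ 2 ≤ (M : ℝ) ^ (1 / 2 ^ 10 : ℝ) := by
    calc (R : ℝ) ^ 2 ≤ ((M : ℝ) ^ (1 / 2 ^ (1 + 10) : ℝ)) ^ 2 := by gcongr
      _ = _ := by rw [← Real.rpow_natCast, ← Real.rpow_mul hM0.le]; norm_num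
  have hR4 : (R : ℝ) ^ 4 ≤ (M : ℝ) ^ (1 / 2 ^ 9 : ℝ) := by
    calc (R : ℝ) ^ 4 ≤ ((M : ℝ) ^ (1 / 2 ^ (1 + 10) : ℝ)) ^ 4 := by gcongr
      _ = _ := by rw [← Real.rpow_natCast, ← Real.rpow_mul hM0.le]; norm_num
  have hqR : (R : ℝ) ^ 2 < q := by
    have : 0 < (M : ℝ) ^ (1 / 2 ^ 10 : ℝ) := by positivity
    linarith
  rw [hco, Int.cast_one, one_mul] at hθ
  have htw : ∀ q₁ ∈ sieveModuli L R, ∀ a₁ : ℕ, ∀ q₂ ∈ sieveModuli L R, ∀ a₂ : ℕ,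
      ‖∑ z ∈ Ico (0 : ℤ) ((M + 1 : ℕ) : ℤ), eC (θ * polyVal co 1 z +
        L * ((a₁ : ℝ) / q₁ - a₂ / q₂) * z)‖ ≤ 4 * (M : ℝ) ^ (1 - 1 / 8 : ℝ) * (R : ℝ) ^ 2 := by
    intro q₁ hq₁ a₁ q₂ hq₂ a₂
    have h1 := (mem_sieveModuli.1 hq₁).1
    have h2 := (mem_sieveModuli.1 hq₂).1
    have h10 : (0 : ℝ) < q₁ := by exact_mod_cast h1.1
    have h20 : (0 : ℝ) < q₂ := by exact_mod_cast h2.1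
    have h12 : (q₁ : ℝ) * q₂ ≤ (R : ℝ) ^ 2 := by
      rw [sq]
      have h3 : (q₁ : ℝ) ≤ R := by exact_mod_cast h1.2
      have h4 : (q₂ : ℝ) ≤ R := by exact_mod_cast h2.2
      gcongr
    set γ : ℝ := θ + L * ((a₁ : ℝ) / q₁ - a₂ / q₂) with hγ
    have e1 : ∀ z ∈ Ico (0 : ℤ) ((M + 1 : ℕ) : ℤ), eC (θ * polyVal co 1 z +
        L * ((a₁ : ℝ) / q₁ - a₂ / q₂) * z) = eC (γ * z + 0) := by
      intro z _
      congr 1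
      simp [polyVal, hco, hγ]
      ring
    rw [sum_congr rfl e1]
    refine (norm_sum_eC_linear_le (X := M + 1) (by simp) γ 0).trans ?_
    have hd : 1 / (2 * q * (R : ℝ) ^ 2) ≤ distInt γ := by
      unfold distInt
      set n := round γ
      set s : ℤ := a * (q₁ * q₂) + q * (L * (a₁ * q₂ - a₂ * q₁)) - n * (q * (q₁ * q₂)) with hs
      have h5 : (a : ℝ) / q + L * ((a₁ : ℝ) / q₁ - a₂ / q₂) - n = s / (q * (q₁ * q₂)) := by
        rw [hs]; push_cast; field_simp
      have hs0 : s ≠ 0 := by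
        intro h0
        have h6 : (q : ℤ) ∣ a * (q₁ * q₂) := by
          refine ⟨n * (q₁ * q₂) - L * (a₁ * q₂ - a₂ * q₁), ?_⟩
          linarith
        have h7 : (q : ℤ) ∣ (q₁ * q₂ : ℕ) := by
          push_cast
          exact (IsCoprime.symm haq).dvd_of_dvd_mul_left h6
        have h8 := Nat.le_of_dvd (Nat.mul_pos h1.1 h2.1) (Int.natCast_dvd_natCast.1 h7)
        have h9 : (q : ℝ) ≤ q₁ * q₂ := by exact_mod_cast h8
        linarith
      have hs1 : (1 : ℝ) ≤ |(s : ℝ)| := by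
        rw [← Int.cast_abs]; exact_mod_cast Int.one_le_abs hs0
      have h6 : 1 / (q * (R : ℝ) ^ 2) ≤ |(s : ℝ) / (q * (q₁ * q₂))| := by
        rw [abs_div, abs_of_pos (by positivity : (0 : ℝ) < q * (q₁ * q₂))]
        gcongr
      have h7 : |θ - a / q| ≤ 1 / (2 * q * (R : ℝ) ^ 2) := by
        rw [le_div_iff₀ (by positivity)]
        refine le_trans ?_ hθ
        have : 2 * q * (R : ℝ) ^ 2 ≤ q * (M : ℝ) ^ (1 - 1 / 8 : ℝ) := by
          have : q * (2 * (R : ℝ) ^ 2) ≤ q * (M : ℝ) ^ (1 - 1 / 8 : ℝ) := by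
            gcongr; linarith
          linarith
        gcongr
      have h8 : γ - n = s / (q * (q₁ * q₂)) + (θ - a / q) := by
        rw [← h5, hγ]; ring
      have h9 : |(s : ℝ) / (q * (q₁ * q₂))| - |θ - a / q| ≤ |γ - n| := by
        rw [h8]
        have := abs_sub_abs_le_abs_sub ((s : ℝ) / (q * (q₁ * q₂))) (-(θ - a / q))
        rw [abs_neg, sub_neg_eq_add] at this
        exact this
      have h10 : 1 / (q * (R : ℝ) ^ 2) = 2 * (1 / (2 * q * (R : ℝ) ^ 2)) := by field_simp
      linarith
    refine (geomBound_le_of_le_distInt (by positivity) hd).trans ?_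
    rw [div_div_eq_mul_div, div_one]
    have : 2 * (2 * q * (R : ℝ) ^ 2) = 4 * q * (R : ℝ) ^ 2 := by ring
    rw [this]
    gcongr
  refine (norm_sievePolySum_le_of_twists hR c (M + 1) θ _ htw).trans ?_
  refine le_trans ?_ hM3
  calc _ = 4 * ((M : ℝ) ^ (1 - 1 / 8 : ℝ) * (R : ℝ) ^ 4) := by ring
    _ ≤ 4 * ((M : ℝ) ^ (1 - 1 / 8 : ℝ) * (M : ℝ) ^ (1 / 2 ^ 9 : ℝ)) := by gcongr
    _ = _ := by rw [← Real.rpow_add hM0]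

set_option maxHeartbeats 1000000 in
/-- Major/minor arc dichotomy for the weighted polynomial exponential sum. -/
lemma exists_norm_sievePolySum_le {k : ℕ} (hk : 1 ≤ k) : ∃ C : ℝ, 1 ≤ C ∧
    ∀ᶠ M : ℕ in Filter.atTop, ∀ (co : ℕ → ℤ) (L R c : ℕ), LocallyAdmissible co k L → 1 ≤ R →
      (R : ℝ) ≤ (M : ℝ) ^ (1 / 2 ^ (k + 10) : ℝ) →
      (∀ j ∈ Icc 1 k, |(co j : ℝ)| ≤ (M : ℝ) ^ (1 / 2 ^ (k + 10) : ℝ)) → ∀ θ : ℝ, |θ| ≤ 1 →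
      ‖sievePolySum co k L R c (M + 1) θ‖ ≤ (M : ℝ) ^ (1 - 1 / (5 * 2 ^ k) : ℝ) ∨
      ∃ (a : ℤ) (q : ℕ), 1 ≤ q ∧ q ≤ M ∧ |a| ≤ 2 * q ∧
        ‖sievePolySum co k L R c (M + 1) θ‖ ≤
          C * M * (q : ℝ) ^ (-(1 / 2 ^ (k + 1) : ℝ)) *
            (1 + co k * (M : ℝ) ^ k * |θ - a / q|) ^ (-(1 / k : ℝ)) +
          (M : ℝ) ^ (1 - 1 / (5 * 2 ^ k) : ℝ) := by
  obtain ⟨C, hC1, hC⟩ := exists_norm_sum_sieveWeight_major_le hk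
  have hminor : ∀ᶠ M : ℕ in Filter.atTop, ∀ (co : ℕ → ℤ) (L R c : ℕ), LocallyAdmissible co k L →
      1 ≤ R → (R : ℝ) ≤ (M : ℝ) ^ (1 / 2 ^ (k + 10) : ℝ) → ∀ (θ : ℝ) (a : ℤ) (q : ℕ), 1 ≤ q →
      IsCoprime a (q : ℤ) → (M : ℝ) ^ (1 / 8 : ℝ) ≤ q → (q : ℝ) ≤ (M : ℝ) ^ (k - 1 / 8 : ℝ) →
      |co k * θ - a / q| ≤ 1 / (q : ℝ) ^ 2 →
      |co k * θ - a / q| * (q * (M : ℝ) ^ (k - 1 / 8 : ℝ)) ≤ 1 →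
      ‖sievePolySum co k L R c (M + 1) θ‖ ≤ (M : ℝ) ^ (1 - 1 / (5 * 2 ^ k) : ℝ) := by
    rcases hk.eq_or_lt with rfl | hk2
    · filter_upwards [eventually_norm_sievePolySum_minor_le_of_linear] with M hM
      intro co L R c hco hR hRM θ a q hq haq h1 h2 _ h3
      rw [Nat.cast_one] at h2 h3
      exact hM co L R c hco.coeff_eq_one hR hRM θ a q hq haq h1 h2 h3
    · filter_upwards [eventually_norm_sievePolySum_minor_le hk2] with M hM
      intro co L R c _ hR hRM θ a q hq haq h1 h2 h3 _
      exact hM co L R c hR hRM θ a q hq haq h1 h2 h3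
  have hk1 : (1 : ℝ) ≤ k := by exact_mod_cast hk
  have h2k : (2 : ℝ) ^ 1 ≤ 2 ^ k := pow_le_pow_right₀ (by norm_num) hk
  set κ : ℝ := 1 / 2 ^ (k + 10) with hκ
  set η : ℝ := 1 / (5 * 2 ^ k) with hη
  have hκ0 : 0 < κ := by positivity
  have hκ1 : κ ≤ 1 / 2048 := by
    rw [hκ, pow_add]
    refine one_div_le_one_div_of_le (by norm_num) ?_
    linarith
  have hη1 : η ≤ 1 / 10 := by
    refine one_div_le_one_div_of_le (by norm_num) ?_
    linarith
  refine ⟨2 * C, by linarith, ?_⟩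
  filter_upwards [hminor, Filter.eventually_ge_atTop 1,
    eventually_const_mul_rpow_le (2 ^ k * k * 2) (show 1 / 8 + κ < 1 by linarith),
    eventually_const_mul_rpow_le (C * (1 + 2 ^ k)) (show 1 / 4 + 6 * κ < 1 - η by linarith)]
    with M hmin hM hM1 hM2
  intro co L R c hco hR hRM hH θ hθ
  have hM0 : (0 : ℝ) < M := by exact_mod_cast hM
  have hM1' : (1 : ℝ) ≤ M := by exact_mod_cast hM
  have hck : 1 ≤ co k := hco.pos
  have hckr : (1 : ℝ) ≤ co k := by exact_mod_cast hck
  set P : ℝ := (M : ℝ) ^ (k - 1 / 8 : ℝ) with hP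
  have hP1 : 1 ≤ P := Real.one_le_rpow hM1' (by linarith)
  set n := ⌊P⌋₊ with hn
  have hn1 : 1 ≤ n := Nat.le_floor (by simpa using hP1)
  have hnP : (n : ℝ) ≤ P := Nat.floor_le (by linarith)
  have hPn : P < n + 1 := Nat.lt_floor_add_one P
  obtain ⟨s, hs, hsn⟩ := Real.exists_rat_abs_sub_le_and_den_le (co k * θ) hn1
  set d := s.den with hd
  have hd1 : 1 ≤ d := s.den_pos
  have hd0 : (0 : ℝ) < d := by exact_mod_cast hd1
  have hdn : (d : ℝ) ≤ n := by exact_mod_cast hsn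
  have hscast : (s : ℝ) = s.num / d := Rat.cast_def s
  have hs1 : |co k * θ - s| * (d * P) ≤ 1 := by
    calc |co k * θ - s| * (d * P) ≤ 1 / ((n + 1) * d) * (d * (n + 1)) := by gcongr
      _ = 1 := by field_simp
  by_cases hcase : (M : ℝ) ^ (1 / 8 : ℝ) ≤ d
  · left
    refine hmin co L R c hco hR hRM θ s.num d hd1 ?_ hcase (hdn.trans hnP) ?_ ?_
    · rw [Int.isCoprime_iff_gcd_eq_one, Int.gcd, Int.natAbs_natCast]
      exact s.reduced
    · rw [← hscast]
      refine hs.trans (one_div_le_one_div_of_le (by positivity) ?_)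
      rw [sq]
      gcongr
      linarith
    · rw [← hscast]; exact hs1
  · right
    push Not at hcase
    set t : ℚ := s / (co k : ℚ) with ht
    have hck0 : (co k : ℚ) ≠ 0 := by exact_mod_cast (by omega : co k ≠ 0)
    set q := t.den with hq
    have hq1 : 1 ≤ q := t.den_pos
    have hq0 : (0 : ℝ) < q := by exact_mod_cast hq1
    have hqd : (q : ℝ) ≤ co k * d := by
      have e1 : t = ((s.num : ℤ) : ℚ) / ((co k * d : ℤ) : ℚ) := by
        rw [ht]
        conv_lhs => rw [← Rat.num_div_den s]
        push_cast
        field_simp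
        rw [← hd]
      have h1 : (q : ℤ) ∣ co k * d := by
        rw [hq, e1, ← Rat.divInt_eq_div]; exact Rat.den_dvd _ _
      have h2 := Int.le_of_dvd (by positivity) h1
      exact_mod_cast h2
    have htcast : (t : ℝ) = t.num / q := Rat.cast_def t
    have hckM : (co k : ℝ) ≤ (M : ℝ) ^ κ := (le_abs_self _).trans (hH k (by simp [hk]))
    have hqM : (q : ℝ) ≤ (M : ℝ) ^ (1 / 8 + κ) := by
      rw [Real.rpow_add hM0, mul_comm ((M : ℝ) ^ (1 / 8 : ℝ))]
      refine hqd.trans ?_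
      gcongr
    set β : ℝ := θ - t with hβ
    have hβ1 : co k * |β| = |co k * θ - s| := by
      have : (co k : ℝ) * θ - s = co k * β := by
        rw [hβ, ht]; push_cast; field_simp
      rw [this, abs_mul, abs_of_pos (by linarith : (0 : ℝ) < co k)]
    have hβ2 : co k * |β| ≤ (M : ℝ) ^ (-(k - 1 / 8) : ℝ) := by
      rw [hβ1, Real.rpow_neg hM0.le, ← hP, ← one_div, le_div_iff₀ (by linarith)]
      refine le_trans ?_ hs1
      have : (1 : ℝ) ≤ d := by exact_mod_cast hd1
      gcongr
      nlinarith
    have hβ3 : |β| ≤ (M : ℝ) ^ (-(k - 1 / 8) : ℝ) := by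
      refine le_trans ?_ hβ2
      nlinarith [abs_nonneg β]
    have hX : ((M + 1 : ℕ) : ℝ) ≤ 2 * M := by push_cast; linarith
    have hbig : |β| * (M : ℝ) ^ κ * ((M + 1 : ℕ) : ℝ) ^ k ≤ 2 ^ k * (M : ℝ) ^ (1 / 8 + κ) := by
      calc _ ≤ (M : ℝ) ^ (-(k - 1 / 8) : ℝ) * (M : ℝ) ^ κ * (2 * M : ℝ) ^ k := by gcongr
        _ = 2 ^ k * ((M : ℝ) ^ (-(k - 1 / 8) : ℝ) * (M : ℝ) ^ κ * (M : ℝ) ^ k) := by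
            rw [mul_pow]; ring
        _ = _ := by
            rw [← Real.rpow_natCast (M : ℝ), ← Real.rpow_add hM0, ← Real.rpow_add hM0]
            congr 2
            ring
    have hbound := hC co L hco R t.num q hR hq1
      (by rw [Int.isCoprime_iff_gcd_eq_one, Int.gcd, Int.natAbs_natCast]; exact t.reduced)
      c (M + 1) ((M : ℝ) ^ κ) β (by omega) hH (by
        calc _ ≤ 2 ^ k * (M : ℝ) ^ (1 / 8 + κ) * k := by gcongr
          _ ≤ (M : ℝ) / 2 := by rw [Real.rpow_one] at hM1; linarith
          _ ≤ _ := by gcongr; omega)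
    refine ⟨t.num, q, hq1, ?_, ?_, ?_⟩
    · have : (q : ℝ) ≤ M := by
        refine hqM.trans ?_
        calc (M : ℝ) ^ (1 / 8 + κ) ≤ (M : ℝ) ^ (1 : ℝ) :=
              Real.rpow_le_rpow_of_exponent_le hM1' (by linarith)
          _ = M := Real.rpow_one _
      exact_mod_cast this
    · have h1 : |(t : ℝ)| ≤ 2 := by
        have h2 : |β| ≤ 1 := hβ3.trans (Real.rpow_le_one_of_one_le_of_nonpos hM1' (by linarith))
        have h3 : (t : ℝ) = θ - β := by rw [hβ]; ring
        rw [h3]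
        exact (abs_sub _ _).trans (by linarith)
      rw [htcast, abs_div, abs_of_pos hq0, div_le_iff₀ hq0] at h1
      exact_mod_cast h1
    · have hθ' : θ = t.num / q + β := by rw [← htcast, hβ]; ring
      have hβ' : θ - t.num / q = β := by rw [← htcast]
      have hsum : sievePolySum co k L R c (M + 1) θ =
          ∑ z ∈ range (M + 1), (sieveWeight L R (L * z + c) : ℂ) *
            eC ((t.num / q + β) * polyVal co k z) := by
        rw [sievePolySum, hθ']
      rw [hsum, hβ']
      refine hbound.trans (add_le_add ?_ ?_)
      · have h1 : (1 + |β * co k| * ((M + 1 : ℕ) : ℝ) ^ k) ^ (-(1 / k : ℝ)) ≤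
            (1 + co k * (M : ℝ) ^ k * |β|) ^ (-(1 / k : ℝ)) := by
          refine Real.rpow_le_rpow_of_nonpos (by positivity) ?_ (by
            rw [neg_nonpos]; positivity)
          rw [abs_mul, abs_of_pos (by linarith : (0 : ℝ) < co k)]
          have : (M : ℝ) ^ k ≤ ((M + 1 : ℕ) : ℝ) ^ k := by gcongr; omega
          have h2 : co k * |β| * (M : ℝ) ^ k ≤ co k * |β| * ((M + 1 : ℕ) : ℝ) ^ k := by gcongr
          linarith
        calc _ ≤ C * (2 * M) * (q : ℝ) ^ (-(1 / 2 ^ (k + 1) : ℝ)) *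
              (1 + co k * (M : ℝ) ^ k * |β|) ^ (-(1 / k : ℝ)) := by gcongr
          _ = _ := by ring
      · calc _ ≤ C * (M : ℝ) ^ (1 / 8 + κ) * ((M : ℝ) ^ κ) ^ 4 *
              ((M : ℝ) ^ (1 / 8 + κ) + 2 ^ k * (M : ℝ) ^ (1 / 8 + κ)) := by
              gcongr
              exact Real.one_le_rpow hM1' (by linarith)
          _ = C * (1 + 2 ^ k) * ((M : ℝ) ^ (1 / 8 + κ) * ((M : ℝ) ^ κ) ^ 4 *
              (M : ℝ) ^ (1 / 8 + κ)) := by ring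
          _ = C * (1 + 2 ^ k) * (M : ℝ) ^ (1 / 4 + 6 * κ) := by
              rw [← Real.rpow_natCast ((M : ℝ) ^ κ), ← Real.rpow_mul hM0.le, ← Real.rpow_add hM0,
                ← Real.rpow_add hM0]
              congr 2
              push_cast
              ring
          _ ≤ _ := hM2

lemma exists_sum_one_div_one_add_abs_sub_sq_le : ∃ C : ℝ, 1 ≤ C ∧ ∀ (N : ℕ) (x : ℝ),
    ∑ r ∈ range N, 1 / (1 + |(r : ℝ) - x|) ^ 2 ≤ C := by
  have hs : Summable (fun n : ℤ => 1 / (1 + |(n : ℝ)|) ^ 2) := by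
    refine Summable.of_nonneg_of_le (fun n => by positivity) (fun n => ?_)
      ((Real.summable_one_div_int_add_rpow (1 / 2) 2).2 (by norm_num))
    have h0 : (0 : ℝ) < |(n : ℝ) + 1 / 2| := by
      rw [abs_pos]
      intro h
      have : ((2 * n + 1 : ℤ) : ℝ) = 0 := by push_cast; linarith
      have := Int.cast_eq_zero.1 this
      omega
    rw [show (2 : ℝ) = ((2 : ℕ) : ℝ) by norm_num, Real.rpow_natCast]
    refine one_div_le_one_div_of_le (by positivity) ?_
    gcongr
    refine (abs_add_le _ _).trans ?_
    rw [add_comm]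
    gcongr
    rw [abs_of_pos (by norm_num)]
    norm_num
  refine ⟨1 + 4 * ∑' n : ℤ, 1 / (1 + |(n : ℝ)|) ^ 2, ?_, ?_⟩
  · have : 0 ≤ ∑' n : ℤ, 1 / (1 + |(n : ℝ)|) ^ 2 := tsum_nonneg fun n => by positivity
    linarith
  intro N x
  set n := ⌊x⌋
  calc _ ≤ ∑ r ∈ range N, 4 * (1 / (1 + |(((r : ℤ) - n : ℤ) : ℝ)|) ^ 2) := by
        refine sum_le_sum fun r _ => ?_
        rw [mul_one_div, div_le_div_iff₀ (by positivity) (by positivity), one_mul]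
        have h1 : |(((r : ℤ) - n : ℤ) : ℝ)| ≤ |(r : ℝ) - x| + 1 := by
          have e : (((r : ℤ) - n : ℤ) : ℝ) = (r - x) + (x - n) := by push_cast; ring
          rw [e]
          refine (abs_add_le _ _).trans ?_
          gcongr
          rw [abs_of_nonneg (sub_nonneg.2 (Int.floor_le x))]
          linarith [Int.lt_floor_add_one x]
        have h2 : 1 + |(((r : ℤ) - n : ℤ) : ℝ)| ≤ 2 * (1 + |(r : ℝ) - x|) := by
          linarith [abs_nonneg ((r : ℝ) - x)]
        calc _ ≤ (2 * (1 + |(r : ℝ) - x|)) ^ 2 := by gcongr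
          _ = _ := by ring
    _ = 4 * ∑ m ∈ (range N).image (fun r : ℕ => (r : ℤ) - n), 1 / (1 + |(m : ℝ)|) ^ 2 := by
        rw [sum_image (by intro a _ b _ h; simpa using h), mul_sum]
    _ ≤ 4 * ∑' n : ℤ, 1 / (1 + |(n : ℝ)|) ^ 2 := by
        gcongr
        exact hs.sum_le_tsum _ fun _ _ => by positivity
    _ ≤ _ := by linarith

lemma exists_sum_major_arcs_le : ∃ C : ℝ, 1 ≤ C ∧ ∀ (N M : ℕ),
    ∑ r ∈ range N, ∑ q ∈ Icc 1 M, ∑ a ∈ Icc (-(2 * q : ℤ)) (2 * q),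
      1 / (q : ℝ) ^ 4 * (1 / (1 + |(r : ℝ) - a * N / q|) ^ 2) ≤ C := by
  obtain ⟨C, hC1, hC⟩ := exists_sum_one_div_one_add_abs_sub_sq_le
  have hs : Summable (fun n : ℕ => 1 / (n : ℝ) ^ 2) := Real.summable_one_div_nat_pow.2 (by norm_num)
  have hs0 : 0 ≤ ∑' n : ℕ, 1 / (n : ℝ) ^ 2 := tsum_nonneg fun n => by positivity
  refine ⟨1 + 5 * C * ∑' n : ℕ, 1 / (n : ℝ) ^ 2, by
    have : 0 ≤ 5 * C * ∑' n : ℕ, 1 / (n : ℝ) ^ 2 := by positivity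
    linarith, ?_⟩
  intro N M
  rw [sum_comm]
  calc _ ≤ ∑ q ∈ Icc 1 M, 5 * C * (1 / (q : ℝ) ^ 2) := by
        refine sum_le_sum fun q hq => ?_
        have hq1 : (1 : ℝ) ≤ q := by exact_mod_cast (mem_Icc.1 hq).1
        rw [sum_comm]
        calc _ ≤ ∑ a ∈ Icc (-(2 * q : ℤ)) (2 * q), 1 / (q : ℝ) ^ 4 * C := by
              refine sum_le_sum fun a _ => ?_
              rw [← mul_sum]
              gcongr
              exact hC N _
          _ = (4 * q + 1) * (1 / (q : ℝ) ^ 4 * C) := by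
              rw [sum_const, Int.card_Icc, nsmul_eq_mul]
              congr 1
              have : (2 * (q : ℤ) + 1 - -(2 * q)).toNat = 4 * q + 1 := by omega
              rw [this]; push_cast; ring
          _ ≤ (5 * (q : ℝ) ^ 2) * (1 / (q : ℝ) ^ 4 * C) := by
              gcongr
              nlinarith
          _ = _ := by field_simp
    _ = 5 * C * ∑ q ∈ Icc 1 M, 1 / (q : ℝ) ^ 2 := by rw [mul_sum]
    _ ≤ 5 * C * ∑' n : ℕ, 1 / (n : ℝ) ^ 2 := by
        gcongr
        exact hs.sum_le_tsum _ fun _ _ => by positivity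
    _ ≤ _ := by linarith

lemma lam_le_sieveWeight {A : ℝ} {L c R z : ℕ} (hL : 1 ≤ L) (hR : 1 ≤ R) (hA0 : 0 ≤ A)
    (hA : Real.log (L * z + c) ≤ A * Real.log R) :
    lam c L z ≤ A * sieveWeight L R (L * z + c) + if z ≤ R then (R : ℝ) else 0 := by
  have hs := sieveWeight_nonneg L R (L * z + c)
  have hR1 : (1 : ℝ) ≤ R := by exact_mod_cast hR
  have hL0 : (0 : ℝ) < L := by exact_mod_cast hL
  have hφ : (L.totient : ℝ) / L ≤ 1 := by
    rw [div_le_one hL0]; exact_mod_cast Nat.totient_le L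
  have hite : (0 : ℝ) ≤ if z ≤ R then (R : ℝ) else 0 := by split_ifs <;> linarith
  have hAs : 0 ≤ A * sieveWeight L R (L * z + c) := by positivity
  unfold lam
  split_ifs with hp hz
  · by_cases hlarge : R < L * z + c
    · rw [sieveWeight_eq_sieveMass hR hp hlarge]
      have h1 := mul_le_mul_of_nonneg_left (totient_div_mul_log_le_sieveMass hL R) hA0
      have h2 : (L.totient : ℝ) / L * Real.log (L * z + c) ≤
        (L.totient : ℝ) / L * (A * Real.log R) := by gcongr
      linarith
    · have h1 : (L * z + c : ℝ) ≤ R := by exact_mod_cast not_lt.1 hlarge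
      have h2 : (1 : ℝ) ≤ L * z + c := by exact_mod_cast hp.one_lt.le
      have h3 : (L.totient : ℝ) / L * Real.log (L * z + c) ≤ 1 * Real.log (L * z + c) :=
        mul_le_mul_of_nonneg_right hφ (Real.log_nonneg h2)
      have h4 := Real.log_le_self (by linarith : (0 : ℝ) ≤ L * z + c)
      linarith
  · have hlarge : R < L * z + c := by nlinarith
    rw [sieveWeight_eq_sieveMass hR hp hlarge]
    have h1 := mul_le_mul_of_nonneg_left (totient_div_mul_log_le_sieveMass hL R) hA0
    have h2 : (L.totient : ℝ) / L * Real.log (L * z + c) ≤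
      (L.totient : ℝ) / L * (A * Real.log R) := by gcongr
    linarith
  · linarith
  · linarith

/-- One term of the restriction sum. -/
lemma norm_pow_le_major_sum {k N M r : ℕ} (hk : 1 ≤ k) (hN : 1 ≤ N) {A D E g : ℝ} {co : ℕ → ℤ}
    (hA : 1 ≤ A) (hD : 0 ≤ D) (hE : 0 ≤ E) (hg : 0 ≤ g) (hNM : (N : ℝ) ≤ A * (co k * (M : ℝ) ^ k))
    (h : g ≤ E ∨ ∃ (a : ℤ) (q : ℕ), 1 ≤ q ∧ q ≤ M ∧ |a| ≤ 2 * q ∧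
        g ≤ D * (q : ℝ) ^ (-(1 / 2 ^ (k + 1) : ℝ)) *
            (1 + co k * (M : ℝ) ^ k * |(r : ℝ) / N - a / q|) ^ (-(1 / k : ℝ)) + E) :
    g ^ (k * 2 ^ (k + 3)) ≤ 2 ^ (k * 2 ^ (k + 3)) * E ^ (k * 2 ^ (k + 3)) +
      2 ^ (k * 2 ^ (k + 3)) * A ^ 2 * D ^ (k * 2 ^ (k + 3)) *
        ∑ q ∈ Icc 1 M, ∑ a ∈ Icc (-(2 * q : ℤ)) (2 * q),
          1 / (q : ℝ) ^ 4 * (1 / (1 + |(r : ℝ) - a * N / q|) ^ 2) := by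
  set s := k * 2 ^ (k + 3) with hs
  have hk0 : (0 : ℝ) < k := by exact_mod_cast hk
  have hN0 : (0 : ℝ) < N := by exact_mod_cast hN
  have hE2 : E ^ s ≤ 2 ^ s * E ^ s := by
    have : (1 : ℝ) ≤ 2 ^ s := one_le_pow₀ (by norm_num)
    nlinarith [pow_nonneg hE s]
  rcases h with h | ⟨a, q, hq1, hqM, haq, h⟩
  · have h1 : g ^ s ≤ E ^ s := by gcongr
    refine (h1.trans hE2).trans (le_add_of_nonneg_right ?_)
    positivity
  have hq0 : (0 : ℝ) < q := by exact_mod_cast hq1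
  have hq1' : (1 : ℝ) ≤ q := by exact_mod_cast hq1
  have hcM : (0 : ℝ) ≤ co k * (M : ℝ) ^ k := by
    by_contra hneg
    push Not at hneg
    nlinarith
  set y := co k * (M : ℝ) ^ k * |(r : ℝ) / N - a / q| with hy
  have hy0 : 0 ≤ y := by positivity
  have hyA : 1 + |(r : ℝ) - a * N / q| ≤ A * (1 + y) := by
    have e : |(r : ℝ) - a * N / q| = N * |(r : ℝ) / N - a / q| := by
      rw [← abs_of_pos hN0, ← abs_mul, abs_of_pos hN0]
      congr 1
      field_simp
    have h1 : N * |(r : ℝ) / N - a / q| ≤ A * (co k * (M : ℝ) ^ k) * |(r : ℝ) / N - a / q| := by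
      gcongr
    rw [e]
    have h2 : A * (1 + y) = A + A * (co k * (M : ℝ) ^ k) * |(r : ℝ) / N - a / q| := by
      rw [hy]; ring
    linarith
  have hqpow : ((q : ℝ) ^ (-(1 / 2 ^ (k + 1) : ℝ))) ^ s ≤ 1 / (q : ℝ) ^ 4 := by
    have e0 : 1 / (q : ℝ) ^ 4 = (q : ℝ) ^ (-((4 : ℕ) : ℝ)) := by
      rw [Real.rpow_neg hq0.le, Real.rpow_natCast, one_div]
    rw [← Real.rpow_natCast, ← Real.rpow_mul hq0.le, e0]
    refine Real.rpow_le_rpow_of_exponent_le hq1' ?_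
    rw [hs]
    push_cast
    have : (1 / 2 ^ (k + 1) : ℝ) * (k * 2 ^ (k + 3)) = 4 * k := by
      rw [pow_add, pow_add]; field_simp; norm_num
    have hk1 : (1 : ℝ) ≤ k := by exact_mod_cast hk
    linarith
  have hypow : ((1 + y) ^ (-(1 / k : ℝ))) ^ s ≤ A ^ 2 * (1 / (1 + |(r : ℝ) - a * N / q|) ^ 2) := by
    have h1 : ((1 + y) ^ (-(1 / k : ℝ))) ^ s ≤ 1 / (1 + y) ^ 2 := by
      have e0 : 1 / (1 + y) ^ 2 = (1 + y) ^ (-((2 : ℕ) : ℝ)) := by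
        rw [Real.rpow_neg (by positivity), Real.rpow_natCast, one_div]
      rw [← Real.rpow_natCast, ← Real.rpow_mul (by positivity), e0]
      refine Real.rpow_le_rpow_of_exponent_le (by linarith) ?_
      rw [hs]
      push_cast
      have e : (1 / k : ℝ) * (k * 2 ^ (k + 3)) = 2 ^ (k + 3) := by field_simp
      have : (2 : ℝ) ^ 1 ≤ 2 ^ (k + 3) := pow_le_pow_right₀ (by norm_num) (by omega)
      linarith
    refine h1.trans ?_
    rw [mul_one_div, div_le_div_iff₀ (by positivity) (by positivity), one_mul, ← mul_pow]
    gcongr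
  have hmem : 1 / (q : ℝ) ^ 4 * (1 / (1 + |(r : ℝ) - a * N / q|) ^ 2) ≤
      ∑ q ∈ Icc 1 M, ∑ a ∈ Icc (-(2 * q : ℤ)) (2 * q),
          1 / (q : ℝ) ^ 4 * (1 / (1 + |(r : ℝ) - a * N / q|) ^ 2) := by
    have h1 := single_le_sum (f := fun a : ℤ =>
      1 / (q : ℝ) ^ 4 * (1 / (1 + |(r : ℝ) - a * N / q|) ^ 2))
      (s := Icc (-(2 * q : ℤ)) (2 * q)) (fun _ _ => by positivity)
      (mem_Icc.2 (abs_le.1 haq))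
    have h2 := single_le_sum (f := fun q : ℕ => ∑ a ∈ Icc (-(2 * q : ℤ)) (2 * q),
      1 / (q : ℝ) ^ 4 * (1 / (1 + |(r : ℝ) - a * N / q|) ^ 2))
      (s := Icc 1 M) (fun _ _ => by positivity) (mem_Icc.2 ⟨hq1, hqM⟩)
    exact h1.trans h2
  calc g ^ s ≤ (D * (q : ℝ) ^ (-(1 / 2 ^ (k + 1) : ℝ)) * (1 + y) ^ (-(1 / k : ℝ)) + E) ^ s := by
        gcongr
    _ ≤ 2 ^ (s - 1) * ((D * (q : ℝ) ^ (-(1 / 2 ^ (k + 1) : ℝ)) * (1 + y) ^ (-(1 / k : ℝ))) ^ s +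
        E ^ s) := add_pow_le (by positivity) hE s
    _ ≤ 2 ^ s * ((D * (q : ℝ) ^ (-(1 / 2 ^ (k + 1) : ℝ)) * (1 + y) ^ (-(1 / k : ℝ))) ^ s +
        E ^ s) := by
        gcongr
        · norm_num
        · omega
    _ = 2 ^ s * E ^ s + 2 ^ s * D ^ s * (((q : ℝ) ^ (-(1 / 2 ^ (k + 1) : ℝ))) ^ s *
        ((1 + y) ^ (-(1 / k : ℝ))) ^ s) := by rw [mul_pow, mul_pow]; ring
    _ ≤ 2 ^ s * E ^ s + 2 ^ s * D ^ s * (1 / (q : ℝ) ^ 4 *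
        (A ^ 2 * (1 / (1 + |(r : ℝ) - a * N / q|) ^ 2))) := by gcongr
    _ = 2 ^ s * E ^ s + 2 ^ s * A ^ 2 * D ^ s * (1 / (q : ℝ) ^ 4 *
        (1 / (1 + |(r : ℝ) - a * N / q|) ^ 2)) := by ring
    _ ≤ _ := by gcongr

set_option maxHeartbeats 1000000 in
/-- A nonnegative majorant for the primes in a progression whose polynomial exponential sums
satisfy a restriction estimate. -/
theorem exists_prime_majorant {k : ℕ} (hk : 1 ≤ k) {A : ℝ} (hA : 1 ≤ A) : ∃ C : ℝ, 1 ≤ C ∧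
    ∀ᶠ M : ℕ in Filter.atTop, ∀ (co : ℕ → ℤ) (L c N : ℕ), LocallyAdmissible co k L → 1 ≤ L →
      (L : ℝ) ≤ (M : ℝ) ^ (1 / 2 ^ (k + 10) : ℝ) → (c : ℝ) ≤ (M : ℝ) ^ (1 / 2 ^ (k + 10) : ℝ) →
      (∀ j ∈ Icc 1 k, |(co j : ℝ)| ≤ (M : ℝ) ^ (1 / 2 ^ (k + 10) : ℝ)) → 1 ≤ N →
      (N : ℝ) ≤ A * (co k * (M : ℝ) ^ k) →
      ∃ B : ℕ → ℝ, (∀ z, 0 ≤ B z) ∧ (∀ z ≤ M, lam c L z ≤ B z) ∧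
        ∑ r ∈ range N, ‖∑ z ∈ range (M + 1), (B z : ℂ) * eC ((r : ℝ) / N * polyVal co k z)‖ ^
          (k * 2 ^ (k + 3)) ≤ C * (M : ℝ) ^ (k * 2 ^ (k + 3)) := by
  obtain ⟨C₀, hC₀1, hC₀⟩ := exists_norm_sievePolySum_le hk
  obtain ⟨Z, hZ1, hZ⟩ := exists_sum_major_arcs_le
  have hk1 : (1 : ℝ) ≤ k := by exact_mod_cast hk
  have h2k : (2 : ℝ) ^ 1 ≤ 2 ^ k := pow_le_pow_right₀ (by norm_num) hk
  set κ : ℝ := 1 / 2 ^ (k + 10) with hκ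
  set η : ℝ := 1 / (5 * 2 ^ k) with hη
  have hκ0 : 0 < κ := by positivity
  have hκ1 : κ ≤ 1 / 2048 := by
    rw [hκ, pow_add]
    refine one_div_le_one_div_of_le (by norm_num) ?_
    linarith
  have hη1 : η ≤ 1 / 10 := by
    refine one_div_le_one_div_of_le (by norm_num) ?_
    linarith
  set s := k * 2 ^ (k + 3) with hs
  have hηs : η * s = 8 / 5 * k := by
    rw [hη, hs]; push_cast; rw [pow_add]; field_simp; norm_num
  set A₁ : ℝ := 6 / κ with hA₁
  have hA₁0 : 0 < A₁ := by positivity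
  refine ⟨1 + 2 ^ s * (A₁ + 1) ^ s + 2 ^ s * A ^ 2 * (A₁ * C₀) ^ s * Z, by
    have : 0 ≤ 2 ^ s * (A₁ + 1) ^ s + 2 ^ s * A ^ 2 * (A₁ * C₀) ^ s * Z := by positivity
    linarith, ?_⟩
  filter_upwards [hC₀, Filter.eventually_ge_atTop 2,
    eventually_const_mul_rpow_le 2 (show κ / 2 < κ by linarith),
    eventually_const_mul_rpow_le 2 (show 2 * κ < 1 - η by linarith),
    eventually_const_mul_rpow_le A (show (k : ℝ) + κ + (1 - η) * s < s by linarith)]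
    with M hM hM2 hM3 hM4 hM5
  intro co L c N hco hL hLM hcM hH hN hNM
  have hM0 : (0 : ℝ) < M := by positivity
  have hM2' : (2 : ℝ) ≤ M := by exact_mod_cast hM2
  have hM1 : (1 : ℝ) ≤ M := by linarith
  set R := ⌊(M : ℝ) ^ κ⌋₊ with hR
  have hRM : (R : ℝ) ≤ (M : ℝ) ^ κ := Nat.floor_le (by positivity)
  have hRM' : (M : ℝ) ^ κ < R + 1 := Nat.lt_floor_add_one _
  have hR1 : 1 ≤ R := Nat.le_floor (by simpa using Real.one_le_rpow hM1 hκ0.le)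
  have hR1' : (1 : ℝ) ≤ R := by exact_mod_cast hR1
  have hκM : (M : ℝ) ^ κ ≤ M := by
    calc _ ≤ (M : ℝ) ^ (1 : ℝ) := Real.rpow_le_rpow_of_exponent_le hM1 (by linarith)
      _ = M := Real.rpow_one _
  have hlogR : κ / 2 * Real.log M ≤ Real.log R := by
    rw [← Real.log_rpow hM0]
    refine Real.log_le_log (by positivity) ?_
    have := Real.one_le_rpow hM1 (by linarith : 0 ≤ κ / 2)
    linarith
  set J : ℕ → ℝ := fun z => if z ≤ R then (R : ℝ) else 0 with hJ
  have hJ0 : ∀ z, 0 ≤ J z := fun z => by simp only [hJ]; split_ifs <;> positivity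
  refine ⟨fun z => A₁ * sieveWeight L R (L * z + c) + J z, fun z =>
    add_nonneg (mul_nonneg hA₁0.le (sieveWeight_nonneg ..)) (hJ0 z), fun z hz => ?_, ?_⟩
  · refine lam_le_sieveWeight hL hR1 hA₁0.le ?_
    have h1 : A₁ * Real.log R ≥ 3 * Real.log M := by
      calc 3 * Real.log M = A₁ * (κ / 2 * Real.log M) := by rw [hA₁]; field_simp; ring
        _ ≤ _ := by gcongr
    refine le_trans ?_ h1
    have hzM : (z : ℝ) ≤ M := by exact_mod_cast hz
    have h2 : (L * z + c : ℝ) ≤ (M : ℝ) ^ 3 := by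
      calc (L * z + c : ℝ) ≤ M * M + M := by
            gcongr
            · exact_mod_cast hLM.trans hκM
            · exact_mod_cast hcM.trans hκM
        _ ≤ _ := by nlinarith [mul_nonneg hM0.le hM0.le]
    rcases (by positivity : (0 : ℝ) ≤ L * z + c).eq_or_lt with h0 | h0
    · rw [← h0, Real.log_zero]
      have := Real.log_nonneg hM1
      linarith
    · refine (Real.log_le_log h0 h2).trans ?_
      rw [Real.log_pow]; norm_num
  · set E := (A₁ + 1) * (M : ℝ) ^ (1 - η) with hE
    have hJsum : ∑ z ∈ range (M + 1), J z ≤ (M : ℝ) ^ (1 - η) := by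
      calc ∑ z ∈ range (M + 1), J z = ∑ z ∈ (range (M + 1)).filter (· ≤ R), (R : ℝ) := by
            rw [sum_filter]
        _ ≤ ∑ z ∈ range (R + 1), (R : ℝ) := by
            refine sum_le_sum_of_subset_of_nonneg (fun z hz => ?_) fun _ _ _ => by positivity
            rw [mem_filter] at hz
            rw [mem_range]; omega
        _ = (R + 1) * R := by rw [sum_const, card_range, nsmul_eq_mul]; push_cast; rfl
        _ ≤ 2 * (R : ℝ) ^ 2 := by nlinarith
        _ ≤ 2 * ((M : ℝ) ^ κ) ^ 2 := by gcongr
        _ = 2 * (M : ℝ) ^ (2 * κ) := by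
            rw [← Real.rpow_natCast, ← Real.rpow_mul hM0.le, mul_comm κ]; norm_num
        _ ≤ _ := hM4
    have hG : ∀ θ : ℝ, ‖∑ z ∈ range (M + 1), ((A₁ * sieveWeight L R (L * z + c) + J z : ℝ) : ℂ) *
        eC (θ * polyVal co k z)‖ ≤ A₁ * ‖sievePolySum co k L R c (M + 1) θ‖ +
          (M : ℝ) ^ (1 - η) := by
      intro θ
      have e1 : ∑ z ∈ range (M + 1), ((A₁ * sieveWeight L R (L * z + c) + J z : ℝ) : ℂ) *
          eC (θ * polyVal co k z) = (A₁ : ℂ) * sievePolySum co k L R c (M + 1) θ +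
          ∑ z ∈ range (M + 1), (J z : ℂ) * eC (θ * polyVal co k z) := by
        rw [sievePolySum, mul_sum, ← sum_add_distrib]
        refine sum_congr rfl fun z _ => ?_
        push_cast; ring
      rw [e1]
      refine (norm_add_le _ _).trans (add_le_add ?_ ?_)
      · rw [norm_mul, Complex.norm_real, Real.norm_of_nonneg hA₁0.le]
      · refine (norm_sum_le _ _).trans (le_trans (le_of_eq ?_) hJsum)
        refine sum_congr rfl fun z _ => ?_
        rw [norm_mul, norm_eC, mul_one, Complex.norm_real, Real.norm_of_nonneg (hJ0 z)]
    have hterm : ∀ r ∈ range N, ‖∑ z ∈ range (M + 1),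
        ((A₁ * sieveWeight L R (L * z + c) + J z : ℝ) : ℂ) *
          eC ((r : ℝ) / N * polyVal co k z)‖ ^ s ≤
        2 ^ s * E ^ s + 2 ^ s * A ^ 2 * (A₁ * C₀ * M) ^ s *
        ∑ q ∈ Icc 1 M, ∑ a ∈ Icc (-(2 * q : ℤ)) (2 * q),
          1 / (q : ℝ) ^ 4 * (1 / (1 + |(r : ℝ) - a * N / q|) ^ 2) := by
      intro r hr
      have hN0 : (0 : ℝ) < N := by exact_mod_cast hN
      have hrN : (r : ℝ) ≤ N := by exact_mod_cast (mem_range.1 hr).le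
      refine norm_pow_le_major_sum hk hN hA (by positivity) (by positivity) (norm_nonneg _) hNM ?_
      have hθ : |(r : ℝ) / N| ≤ 1 := by
        rw [abs_of_nonneg (by positivity), div_le_one hN0]; exact hrN
      have hGr := hG ((r : ℝ) / N)
      rcases hM co L R c hco hR1 hRM hH _ hθ with h | ⟨a, q, h1, h2, h3, h4⟩
      · left
        calc _ ≤ A₁ * (M : ℝ) ^ (1 - η) + (M : ℝ) ^ (1 - η) := hGr.trans (by gcongr)
          _ = E := by rw [hE]; ring
      · right
        refine ⟨a, q, h1, h2, h3, hGr.trans ?_⟩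
        have h5 := mul_le_mul_of_nonneg_left h4 hA₁0.le
        rw [hE]
        linarith
    have hNpow : (N : ℝ) * (M : ℝ) ^ ((1 - η) * s) ≤ (M : ℝ) ^ s := by
      have h1 : (N : ℝ) ≤ A * ((M : ℝ) ^ κ * (M : ℝ) ^ k) := by
        refine hNM.trans ?_
        gcongr
        exact (le_abs_self _).trans (hH k (by simp [hk]))
      calc _ ≤ A * ((M : ℝ) ^ κ * (M : ℝ) ^ k) * (M : ℝ) ^ ((1 - η) * s) := by gcongr
        _ = A * (M : ℝ) ^ ((k : ℝ) + κ + (1 - η) * s) := by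
            rw [← Real.rpow_natCast (M : ℝ) k, mul_assoc, ← Real.rpow_add hM0, ← Real.rpow_add hM0]
            ring_nf
        _ ≤ _ := by rw [← Real.rpow_natCast (M : ℝ) s]; exact hM5
    have hEs : E ^ s = (A₁ + 1) ^ s * (M : ℝ) ^ ((1 - η) * s) := by
      rw [hE, mul_pow, Real.rpow_mul hM0.le, Real.rpow_natCast]
    calc _ ≤ ∑ r ∈ range N, (2 ^ s * E ^ s + 2 ^ s * A ^ 2 * (A₁ * C₀ * M) ^ s *
        ∑ q ∈ Icc 1 M, ∑ a ∈ Icc (-(2 * q : ℤ)) (2 * q),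
          1 / (q : ℝ) ^ 4 * (1 / (1 + |(r : ℝ) - a * N / q|) ^ 2)) := sum_le_sum hterm
      _ = 2 ^ s * (A₁ + 1) ^ s * (N * (M : ℝ) ^ ((1 - η) * s)) +
          2 ^ s * A ^ 2 * (A₁ * C₀ * M) ^ s *
        ∑ r ∈ range N, ∑ q ∈ Icc 1 M, ∑ a ∈ Icc (-(2 * q : ℤ)) (2 * q),
          1 / (q : ℝ) ^ 4 * (1 / (1 + |(r : ℝ) - a * N / q|) ^ 2) := by
          rw [sum_add_distrib, sum_const, card_range, nsmul_eq_mul, hEs]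
          congr 1
          · ring
          · exact (mul_sum _ _ _).symm
      _ ≤ 2 ^ s * (A₁ + 1) ^ s * (M : ℝ) ^ s + 2 ^ s * A ^ 2 * (A₁ * C₀ * M) ^ s * Z := by
          gcongr
          exact hZ N M
      _ = (2 ^ s * (A₁ + 1) ^ s + 2 ^ s * A ^ 2 * (A₁ * C₀) ^ s * Z) * (M : ℝ) ^ s := by
          rw [mul_pow (A₁ * C₀)]; ring
      _ ≤ _ := by gcongr; linarith

theorem stdAddChar_intCast_eq_eC {N : ℕ} [NeZero N] (j : ℤ) :
    ZMod.stdAddChar (j : ZMod N) = eC (j / N) := by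
  rw [ZMod.stdAddChar_coe, eC]
  push_cast
  ring_nf

theorem sum_Icc_one_natCast {N : ℕ} [NeZero N] {E : Type*} [AddCommMonoid E] (g : ZMod N → E) :
    ∑ x ∈ Icc 1 N, g (x : ZMod N) = ∑ x : ZMod N, g x := by
  have hN : 0 < N := NeZero.pos N
  refine sum_bij (fun x _ => (x : ZMod N)) (fun _ _ => mem_univ _) ?_ ?_ (fun _ _ => rfl)
  · intro x hx y hy h
    rw [mem_Icc] at hx hy
    have h2 := (ZMod.natCast_eq_natCast_iff x y N).1 h
    have h3 : (x - 1) + 1 ≡ (y - 1) + 1 [MOD N] := by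
      rwa [Nat.sub_add_cancel hx.1, Nat.sub_add_cancel hy.1]
    have h4 := (Nat.ModEq.add_right_cancel' 1 h3).eq_of_lt_of_lt (by omega) (by omega)
    omega
  · intro y _
    by_cases hy : y.val = 0
    · refine ⟨N, by simp; omega, ?_⟩
      rw [ZMod.natCast_self, ← (ZMod.val_eq_zero y).1 hy]
    · refine ⟨y.val, ?_, ZMod.natCast_zmod_val y⟩
      have := ZMod.val_lt y
      rw [mem_Icc]; omega

theorem sum_range_natCast {N : ℕ} [NeZero N] {E : Type*} [AddCommMonoid E] (g : ZMod N → E) :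
    ∑ x ∈ range N, g (x : ZMod N) = ∑ x : ZMod N, g x := by
  refine sum_bij (fun x _ => (x : ZMod N)) (fun _ _ => mem_univ _) ?_ ?_ (fun _ _ => rfl)
  · intro x hx y hy h
    rw [mem_range] at hx hy
    exact ((ZMod.natCast_eq_natCast_iff x y N).1 h).eq_of_lt_of_lt hx hy
  · intro y _
    exact ⟨y.val, mem_range.2 (ZMod.val_lt y), ZMod.natCast_zmod_val y⟩

theorem dft_eq_sum_stdAddChar {N : ℕ} [NeZero N] (f : ZMod N → ℝ) (r : ZMod N) :
    dft N f r = ∑ x : ZMod N, (f x : ℂ) * ZMod.stdAddChar (-(x * r)) := by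
  rw [dft, ← sum_Icc_one_natCast (fun x : ZMod N => (f x : ℂ) * ZMod.stdAddChar (-(x * r)))]
  refine sum_congr rfl fun x _ => ?_
  have : -((x : ZMod N) * r) = ((-(x * r.val : ℤ) : ℤ) : ZMod N) := by
    push_cast
    rw [ZMod.natCast_zmod_val]
  rw [this, stdAddChar_intCast_eq_eC]
  push_cast
  rfl

theorem sum_norm_dft_sq {N : ℕ} [NeZero N] (f : ZMod N → ℝ) :
    ∑ r : ZMod N, ‖dft N f r‖ ^ 2 = N * ∑ x : ZMod N, f x ^ 2 := by
  have hort (x y : ZMod N) : ∑ r : ZMod N, (ZMod.stdAddChar (r * (y - x)) : ℂ)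
      = if y = x then (N : ℂ) else 0 := by
    rw [AddChar.sum_mulShift _ (ZMod.isPrimitive_stdAddChar N)]
    simp [sub_eq_zero, ZMod.card]
  have key : ((∑ r : ZMod N, ‖dft N f r‖ ^ 2 : ℝ) : ℂ) = ((N * ∑ x : ZMod N, f x ^ 2 : ℝ) : ℂ) := by
    push_cast
    have h1 (r : ZMod N) : ((‖dft N f r‖ : ℂ)) ^ 2 =
        ∑ x : ZMod N, ∑ y : ZMod N, (f x : ℂ) * f y * ZMod.stdAddChar (r * (y - x)) := by
      rw [← Complex.mul_conj', dft_eq_sum_stdAddChar, map_sum, sum_mul_sum]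
      refine sum_congr rfl fun x _ => sum_congr rfl fun y _ => ?_
      rw [map_mul, Complex.conj_ofReal, ← AddChar.map_neg_eq_conj,
        show r * (y - x) = -(x * r) + -(-(y * r)) by ring, AddChar.map_add_eq_mul]
      ring
    rw [sum_congr rfl fun r _ => h1 r, sum_comm, mul_sum]
    refine sum_congr rfl fun x _ => ?_
    rw [sum_comm]
    simp_rw [← mul_sum, hort]
    simp
    ring
  exact_mod_cast key

theorem dft_convolution {N : ℕ} [NeZero N] (f g : ZMod N → ℝ) (r : ZMod N) :
    dft N (fun x => ∑ y, f y * g (x - y)) r = dft N f r * dft N g r := by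
  simp_rw [dft_eq_sum_stdAddChar]
  push_cast
  simp_rw [sum_mul]
  rw [sum_comm]
  refine sum_congr rfl fun y _ => ?_
  rw [mul_sum, ← Equiv.sum_comp (Equiv.addRight y)]
  refine sum_congr rfl fun x _ => ?_
  rw [Equiv.coe_addRight, add_sub_cancel_right,
    show -((x + y) * r) = -(y * r) + -(x * r) by ring, AddChar.map_add_eq_mul]
  ring

theorem exists_dft_eq_pow {N : ℕ} [NeZero N] {f F : ZMod N → ℝ} (h : ∀ x, |f x| ≤ F x) (s : ℕ) :
    ∃ g G : ZMod N → ℝ, (∀ r, dft N g r = dft N f r ^ s) ∧ (∀ r, dft N G r = dft N F r ^ s) ∧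
      ∀ x, |g x| ≤ G x := by
  induction s with
  | zero =>
    have h1 (r : ZMod N) : dft N (fun x => if x = 0 then 1 else 0) r = 1 := by
      rw [dft_eq_sum_stdAddChar, sum_eq_single 0] <;> simp +contextual
    refine ⟨fun x => if x = 0 then 1 else 0, fun x => if x = 0 then 1 else 0, by simp [h1],
      by simp [h1], fun x => ?_⟩
    by_cases hx : x = 0 <;> simp [hx]
  | succ s ih =>
    obtain ⟨g, G, hg, hG, hgG⟩ := ih
    refine ⟨fun x => ∑ y, g y * f (x - y), fun x => ∑ y, G y * F (x - y), fun r => ?_,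
      fun r => ?_, fun x => ?_⟩
    · rw [dft_convolution, hg, pow_succ]
    · rw [dft_convolution, hG, pow_succ]
    · refine (abs_sum_le_sum_abs _ _).trans (sum_le_sum fun y _ => ?_)
      rw [abs_mul]
      exact mul_le_mul (hgG y) (h _) (abs_nonneg _) ((abs_nonneg _).trans (hgG y))

/-- Even moments of the Fourier transform are monotone under pointwise domination. -/
theorem sum_norm_dft_pow_le {N : ℕ} [NeZero N] {f F : ZMod N → ℝ} (h : ∀ x, |f x| ≤ F x) (s : ℕ) :
    ∑ r : ZMod N, ‖dft N f r‖ ^ (2 * s) ≤ ∑ r : ZMod N, ‖dft N F r‖ ^ (2 * s) := by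
  obtain ⟨g, G, hg, hG, hgG⟩ := exists_dft_eq_pow h s
  have e (a : ℂ) : ‖a‖ ^ (2 * s) = ‖a ^ s‖ ^ 2 := by rw [norm_pow, ← pow_mul, mul_comm]
  simp_rw [e, ← hg, ← hG, sum_norm_dft_sq]
  refine mul_le_mul_of_nonneg_left (sum_le_sum fun x _ => ?_) (Nat.cast_nonneg N)
  exact sq_le_sq' (by linarith [(abs_le.1 (hgG x)).1]) ((le_abs_self _).trans (hgG x))

/-- The `q`-th moment of the Fourier transform of a weighted push-forward along
`z ↦ K * P z`, where `K` is invertible. -/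
theorem sum_norm_dft_pushforward_pow {N : ℕ} [NeZero N] {K : ℤ} (hK : IsUnit (K : ZMod N))
    (P : ℕ → ℤ) (β : ℕ → ℝ) (S : Finset ℕ) (q : ℕ) :
    ∑ r : ZMod N, ‖dft N (fun x => ∑ z ∈ S, if ((K * P z : ℤ) : ZMod N) = x then β z else 0) r‖ ^ q
      = ∑ r ∈ range N, ‖∑ z ∈ S, (β z : ℂ) * eC ((r : ℝ) / N * P z)‖ ^ q := by
  have h1 (r : ZMod N) :
      dft N (fun x => ∑ z ∈ S, if ((K * P z : ℤ) : ZMod N) = x then β z else 0) r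
        = ∑ z ∈ S, (β z : ℂ) * ZMod.stdAddChar ((P z : ZMod N) * (-(K : ZMod N) * r)) := by
    rw [dft_eq_sum_stdAddChar]
    push_cast
    simp_rw [sum_mul]
    rw [sum_comm]
    refine sum_congr rfl fun z _ => ?_
    rw [sum_eq_single ((K : ZMod N) * P z)]
    · rw [if_pos rfl]
      congr 2
      ring
    · intro x _ hx
      rw [if_neg (Ne.symm hx)]
      simp
    · simp
  obtain ⟨u, hu⟩ := hK.neg
  simp_rw [h1, ← hu]
  rw [← Equiv.sum_comp (Units.mulLeft u).symm]
  rw [← sum_range_natCast]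
  refine sum_congr rfl fun r _ => ?_
  congr 2
  refine sum_congr rfl fun z _ => ?_
  congr 1
  have : (P z : ZMod N) * (↑u * (Units.mulLeft u).symm (r : ZMod N)) =
      ((P z * r : ℤ) : ZMod N) := by
    simp
  rw [this, stdAddChar_intCast_eq_eC]
  congr 1
  push_cast
  ring

theorem exists_abs_coeff_taylor_le (ψ : Polynomial ℤ) : ∃ D : ℕ, 1 ≤ D ∧ ∀ b W : ℕ, b < W →
    ∀ j, |(Polynomial.taylor (b : ℤ) ψ).coeff j| ≤ D * (W : ℤ) ^ ψ.natDegree := by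
  set k := ψ.natDegree with hk
  refine ⟨1 + ∑ j ∈ range (k + 1), ∑ i ∈ range (k + 1),
    ((Polynomial.hasseDeriv j ψ).coeff i).natAbs, by omega, fun b W hbW j => ?_⟩
  by_cases hj : k < j
  · rw [Polynomial.coeff_eq_zero_of_natDegree_lt (by rwa [Polynomial.natDegree_taylor])]
    rw [abs_zero]
    positivity
  have hdeg : (Polynomial.hasseDeriv j ψ).natDegree < k + 1 := by
    have := Polynomial.natDegree_hasseDeriv_le ψ j
    omega
  have hW : (1 : ℤ) ≤ W := by exact_mod_cast (by omega : 1 ≤ W)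
  have hb : (b : ℤ) ≤ W := by exact_mod_cast hbW.le
  rw [Polynomial.taylor_coeff, Polynomial.eval_eq_sum_range' hdeg]
  calc |∑ i ∈ range (k + 1), (Polynomial.hasseDeriv j ψ).coeff i * (b : ℤ) ^ i|
      ≤ ∑ i ∈ range (k + 1), |(Polynomial.hasseDeriv j ψ).coeff i| * (W : ℤ) ^ k := by
        refine (abs_sum_le_sum_abs _ _).trans (sum_le_sum fun i hi => ?_)
        rw [abs_mul, abs_of_nonneg (by positivity : (0 : ℤ) ≤ (b : ℤ) ^ i)]
        gcongr
        exact (pow_le_pow_left₀ (by positivity) hb i).trans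
          (pow_le_pow_right₀ hW (by rw [mem_range] at hi; omega))
    _ = (∑ i ∈ range (k + 1), (((Polynomial.hasseDeriv j ψ).coeff i).natAbs : ℤ)) *
          (W : ℤ) ^ k := by
        rw [sum_mul]
        simp
    _ ≤ _ := by
        gcongr
        have := single_le_sum (f := fun j => ∑ i ∈ range (k + 1),
          ((Polynomial.hasseDeriv j ψ).coeff i).natAbs) (fun _ _ => Nat.zero_le _)
          (mem_range.2 (by omega : j < k + 1))
        exact_mod_cast (by omega)

/-- The polynomial `(ψ(Wx+b) - ψ(b)) / W` written as `K` times an integer polynomial. -/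
theorem exists_coeff_shifted_polynomial {ψ : Polynomial ℤ} {k b W K D : ℕ} (hk : ψ.natDegree = k)
    (hk1 : 1 ≤ k) (hK : 0 < K) (hW : 0 < W)
    (hD : ∀ j, |(Polynomial.taylor (b : ℤ) ψ).coeff j| ≤ D * (W : ℤ) ^ k)
    (hKW : (K : ℤ) ∣ W) (hKd : (K : ℤ) ∣ ψ.derivative.eval (b : ℤ)) :
    ∃ co : ℕ → ℤ,
      (∀ x : ℤ, (ψ.eval ((W : ℤ) * x + b) - ψ.eval (b : ℤ)) / W = K * polyVal co k x) ∧
      K * co 1 = ψ.derivative.eval (b : ℤ) ∧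
      K * co k = ψ.leadingCoeff * (W : ℤ) ^ (k - 1) ∧
      (∀ j, 2 ≤ j → (W / K : ℤ) ∣ co j) ∧
      ∀ j ∈ Icc 1 k, |co j| ≤ D * (W : ℤ) ^ (2 * k) := by
  set t := (Polynomial.taylor (b : ℤ) ψ).coeff with ht
  have hW1 : (1 : ℤ) ≤ W := by exact_mod_cast hW
  have hK1 : (1 : ℤ) ≤ K := by exact_mod_cast hK
  have hW0 : (W : ℤ) ≠ 0 := by omega
  have hK0 : (K : ℤ) ≠ 0 := by omega
  have ht1 : t 1 = ψ.derivative.eval (b : ℤ) := Polynomial.taylor_coeff_one _ _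
  have htk : t k = ψ.leadingCoeff := by
    rw [ht, ← hk, Polynomial.coeff_taylor_natDegree]
  have hdvd (j : ℕ) (hj : 1 ≤ j) : (K : ℤ) ∣ t j * (W : ℤ) ^ (j - 1) := by
    rcases hj.eq_or_lt with rfl | hj
    · rw [ht1]
      exact hKd.mul_right _
    · exact ((hKW.trans (dvd_pow_self _ (by omega)))).mul_left _
  have hco (j : ℕ) (hj : 1 ≤ j) :
      (K : ℤ) * (t j * (W : ℤ) ^ (j - 1) / K) = t j * (W : ℤ) ^ (j - 1) :=
    Int.mul_ediv_cancel' (hdvd j hj)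
  refine ⟨fun j => t j * (W : ℤ) ^ (j - 1) / K, fun x => ?_, ?_, ?_, fun j hj => ?_,
    fun j hj => ?_⟩
  · refine Int.ediv_eq_of_eq_mul_right hW0 ?_
    rw [← Polynomial.taylor_eval, Polynomial.eval_eq_sum_range, Polynomial.natDegree_taylor, hk,
      sum_range_eq_add_Ico _ (by omega), ← ht, show t 0 = ψ.eval (b : ℤ) from
      Polynomial.taylor_coeff_zero _ _, pow_zero, mul_one, add_sub_cancel_left, polyVal, mul_sum,
      mul_sum]
    refine sum_congr (by ext; simp) fun j hj => ?_
    have h1 : 1 ≤ j := (mem_Icc.1 hj).1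
    rw [← mul_assoc (K : ℤ), hco j h1, mul_pow]
    obtain ⟨i, rfl⟩ := Nat.exists_eq_add_of_le' h1
    simp only [Nat.add_sub_cancel]
    ring
  · simp only
    rw [hco 1 le_rfl, ht1]
    simp
  · simp only
    rw [hco k hk1, htk]
  · obtain ⟨i, rfl⟩ := Nat.exists_eq_add_of_le' hj
    obtain ⟨q, hq⟩ := hKW
    simp only [show i + 2 - 1 = i + 1 by omega]
    refine ⟨t (i + 2) * (W : ℤ) ^ i, ?_⟩
    refine Int.ediv_eq_of_eq_mul_right hK0 ?_
    have : (W : ℤ) / K = q := by rw [hq, Int.mul_ediv_cancel_left _ hK0]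
    rw [this, pow_succ]
    nth_rewrite 2 [hq]
    ring
  · rw [mem_Icc] at hj
    have h1 : |t j * (W : ℤ) ^ (j - 1) / K| ≤ |t j * (W : ℤ) ^ (j - 1)| := by
      rw [← hco j hj.1, Int.mul_ediv_cancel_left _ hK0, abs_mul,
        abs_of_nonneg (by omega : (0 : ℤ) ≤ K)]
      exact le_mul_of_one_le_left (abs_nonneg _) hK1
    refine h1.trans ?_
    rw [abs_mul, abs_of_nonneg (by positivity : (0 : ℤ) ≤ (W : ℤ) ^ (j - 1))]
    calc _ ≤ (D * (W : ℤ) ^ k) * (W : ℤ) ^ k := by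
          gcongr
          · exact hD j
          · omega
      _ = _ := by ring

theorem dvd_prod_prime_pow_iff {p w : ℕ} (hp : p.Prime) (hw : 1 ≤ w) :
    p ∣ ∏ q ∈ (range (w + 1)).filter Nat.Prime, q ^ w ↔ p ≤ w := by
  constructor
  · intro h
    obtain ⟨q, hq, hpq⟩ := (Prime.dvd_finsetProd_iff hp.prime _).1 h
    rw [mem_filter, mem_range] at hq
    rw [(Nat.prime_dvd_prime_iff_eq hp hq.2).1 (hp.dvd_of_dvd_pow hpq)]
    omega
  · intro h
    refine (dvd_pow_self p (by omega : w ≠ 0)).trans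
      (dvd_prod_of_mem (fun q => q ^ w) (mem_filter.2 ⟨mem_range.2 (by omega), hp⟩))

theorem locallyAdmissible_shifted {k w W W₀ K : ℕ} {co : ℕ → ℤ} {a d : ℤ}
    (hW : W = ∏ p ∈ (range (w + 1)).filter Nat.Prime, p ^ w) (hw : 1 ≤ w) (hW0 : 0 < W₀)
    (hW0w : W₀ ≤ w) (hKw : K < w) (hK : 0 < K) (ha : 0 < a) (haw : a ≤ w)
    (hgcd : Int.gcd d W = K) (h1 : K * co 1 = d) (hlead : K * co k = a * (W : ℤ) ^ (k - 1))
    (hco : ∀ j, 2 ≤ j → (W / K : ℤ) ∣ co j) : LocallyAdmissible co k (W * W₀) := by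
  have hWpos : 0 < W := by
    rw [hW]
    exact prod_pos fun p hp => pow_pos (mem_filter.1 hp).2.pos _
  have hpW (p : ℕ) (hp : p.Prime) : p ∣ W ↔ p ≤ w := by
    rw [hW]
    exact dvd_prod_prime_pow_iff hp hw
  have hpL (p : ℕ) (hp : p.Prime) : p ∣ W * W₀ ↔ p ≤ w := by
    rw [hp.dvd_mul, hpW p hp]
    exact ⟨fun h => h.elim id fun h => (Nat.le_of_dvd hW0 h).trans hW0w, Or.inl⟩
  obtain ⟨q, hq⟩ : K ∣ W := by
    have : (K : ℤ) ∣ W := hgcd ▸ Int.gcd_dvd_right _ _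
    exact_mod_cast this
  have hK0 : (K : ℤ) ≠ 0 := by exact_mod_cast hK.ne'
  have hquot : (W : ℤ) / K = q := by
    rw [hq]
    push_cast
    exact Int.mul_ediv_cancel_left _ hK0
  have hpq (p : ℕ) (hp : p.Prime) (hpw : p ≤ w) : p ∣ q := by
    by_contra hn
    have hcop : Nat.Coprime (p ^ w) q :=
      Nat.Coprime.pow_left _ ((Nat.Prime.coprime_iff_not_dvd hp).2 hn)
    have : p ^ w ∣ W := by
      rw [hW]
      exact dvd_prod_of_mem (fun q => q ^ w) (mem_filter.2 ⟨mem_range.2 (by omega), hp⟩)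
    rw [hq] at this
    have := Nat.le_of_dvd hK (hcop.dvd_of_dvd_mul_right this)
    have := Nat.lt_pow_self hp.one_lt (n := w)
    omega
  refine ⟨?_, fun p hp hpd j hj _ => ?_, fun p hp hpd hpc => ?_, fun p hp hpd hpc => ?_⟩
  · have : 0 < (K : ℤ) * co k := by
      rw [hlead]
      positivity
    exact pos_of_mul_pos_right this (by positivity)
  · have := hco j hj
    rw [hquot] at this
    exact (Int.natCast_dvd_natCast.2 (hpq p hp ((hpL p hp).1 hpd))).trans this
  · have h2 : ((K * p : ℕ) : ℤ) ∣ Int.gcd d W := by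
      refine Int.dvd_coe_gcd ?_ ?_
      · rw [← h1]
        push_cast
        exact mul_dvd_mul_left _ hpc
      · rw [hq]
        exact_mod_cast mul_dvd_mul_left K (hpq p hp ((hpL p hp).1 hpd))
    rw [hgcd] at h2
    have := Nat.le_of_dvd hK (Int.natCast_dvd_natCast.1 h2)
    have := hp.two_le
    nlinarith
  · have h2 : (p : ℤ) ∣ a * (W : ℤ) ^ (k - 1) := by
      rw [← hlead]
      exact hpc.mul_left _
    have hpw : ¬ p ≤ w := fun h => hpd ((hpL p hp).2 h)
    rcases (Nat.prime_iff_prime_int.1 hp).dvd_or_dvd h2 with h | h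
    · have := Int.le_of_dvd ha h
      omega
    · have := (Nat.prime_iff_prime_int.1 hp).dvd_of_dvd_pow h
      exact hpw ((hpW p hp).1 (by exact_mod_cast this))

section Growth

variable {co : ℕ → ℤ} {k M : ℕ} {H : ℝ}

theorem polyVal_add_one_le (hk : 1 ≤ k) (hM : 1 ≤ M) (hpos : 0 < co k)
    (hH : ∀ j ∈ Icc 1 k, |(co j : ℝ)| ≤ H) (hHM : k ^ 2 * 2 ^ k * H ≤ M) :
    (polyVal co k ((M + 1 : ℕ) : ℤ) : ℝ) ≤ (2 ^ k + 1) * (co k * (M : ℝ) ^ k) := by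
  have hM1 : (1 : ℝ) ≤ M := by exact_mod_cast hM
  have hc : (1 : ℝ) ≤ co k := by exact_mod_cast hpos
  have hk1 : (1 : ℝ) ≤ k := by exact_mod_cast hk
  have hH0 : 0 ≤ H := (abs_nonneg _).trans (hH k (by simp [hk]))
  have h1 := (abs_le.1 (abs_polyVal_sub_le hk (by omega) hH (le_refl (M + 1)))).2
  have h2 : (((M + 1 : ℕ) : ℝ)) ≤ 2 * M := by push_cast; linarith
  have h3 : (co k : ℝ) * ((M + 1 : ℕ) : ℝ) ^ k ≤ co k * (2 * (M : ℝ)) ^ k := by gcongr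
  have h4 : k * H * ((M + 1 : ℕ) : ℝ) ^ (k - 1) ≤ (M : ℝ) ^ k := by
    calc k * H * ((M + 1 : ℕ) : ℝ) ^ (k - 1) ≤ k * H * (2 * (M : ℝ)) ^ (k - 1) := by gcongr
      _ = (k * 2 ^ (k - 1) * H) * (M : ℝ) ^ (k - 1) := by rw [mul_pow]; ring
      _ ≤ (k ^ 2 * 2 ^ k * H) * (M : ℝ) ^ (k - 1) := by
          gcongr
          · nlinarith
          · norm_num
          · omega
      _ ≤ M * (M : ℝ) ^ (k - 1) := by gcongr
      _ = (M : ℝ) ^ k := by rw [← pow_succ', Nat.sub_add_cancel hk]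
  have h5 : (M : ℝ) ^ k ≤ co k * (M : ℝ) ^ k := le_mul_of_one_le_left (by positivity) hc
  rw [mul_pow] at h3
  nlinarith

theorem le_polyVal (hk : 1 ≤ k) (hM : 1 ≤ M) (hpos : 0 < co k)
    (hH : ∀ j ∈ Icc 1 k, |(co j : ℝ)| ≤ H) (hHM : k ^ 2 * 2 ^ k * H ≤ M) :
    co k * (M : ℝ) ^ k / 2 ≤ (polyVal co k M : ℝ) := by
  have hc : (1 : ℝ) ≤ co k := by exact_mod_cast hpos
  have hk1 : (1 : ℝ) ≤ k := by exact_mod_cast hk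
  have hH0 : 0 ≤ H := (abs_nonneg _).trans (hH k (by simp [hk]))
  have h1 := (abs_le.1 (abs_polyVal_sub_le hk hM hH (le_refl M))).1
  have h4 : k * H * (M : ℝ) ^ (k - 1) ≤ (M : ℝ) ^ k / 2 := by
    have : 2 * (k * H) ≤ M := by
      refine le_trans ?_ hHM
      have h2 : (2 : ℝ) ^ 1 ≤ 2 ^ k := pow_le_pow_right₀ (by norm_num) hk
      have h3 : (k : ℝ) ≤ k ^ 2 := by nlinarith
      calc 2 * (k * H) = k * 2 ^ 1 * H := by ring
        _ ≤ k ^ 2 * 2 ^ k * H := by gcongr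
    calc k * H * (M : ℝ) ^ (k - 1) = 2 * (k * H) * (M : ℝ) ^ (k - 1) / 2 := by ring
      _ ≤ M * (M : ℝ) ^ (k - 1) / 2 := by gcongr
      _ = (M : ℝ) ^ k / 2 := by rw [← pow_succ', Nat.sub_add_cancel hk]
  have h5 : (M : ℝ) ^ k ≤ co k * (M : ℝ) ^ k := le_mul_of_one_le_left (by positivity) hc
  linarith

theorem abs_polyVal_add_one_sub_le_lead (hk : 1 ≤ k) (hM : 1 ≤ M) (hpos : 0 < co k)
    (hH : ∀ j ∈ Icc 1 k, |(co j : ℝ)| ≤ H) (hHM : k ^ 2 * 2 ^ k * H ≤ M) {z : ℕ} (hz : z + 1 ≤ M) :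
    |((polyVal co k (z + 1) - polyVal co k z : ℤ) : ℝ)| ≤
      (k + 1) * (co k * (M : ℝ) ^ (k - 1)) := by
  have hM1 : (1 : ℝ) ≤ M := by exact_mod_cast hM
  have hc : (1 : ℝ) ≤ co k := by exact_mod_cast hpos
  have hH0 : 0 ≤ H := (abs_nonneg _).trans (hH k (by simp [hk]))
  obtain ⟨d, rfl⟩ := Nat.exists_eq_add_of_le' hk
  have hz' : (z : ℝ) + 1 ≤ M := by exact_mod_cast hz
  have hlow := abs_polyVal_add_one_sub_le (co := co) (k := d) hM
    (fun j hj => hH j (by rw [mem_Icc] at *; omega)) hz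
  have hlow2 : (d : ℝ) ^ 2 * H * (M : ℝ) ^ (d - 1) ≤ co (d + 1) * (M : ℝ) ^ d := by
    rcases Nat.eq_zero_or_pos d with rfl | hd
    · simp
      linarith
    · calc (d : ℝ) ^ 2 * H * (M : ℝ) ^ (d - 1)
          ≤ ((d + 1 : ℕ) : ℝ) ^ 2 * 2 ^ (d + 1) * H * (M : ℝ) ^ (d - 1) := by
            gcongr
            have h1 : (1 : ℝ) ≤ 2 ^ (d + 1) := one_le_pow₀ (by norm_num)
            have h2 : (d : ℝ) ^ 2 ≤ ((d + 1 : ℕ) : ℝ) ^ 2 := by gcongr; omega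
            nlinarith [sq_nonneg (d : ℝ)]
        _ ≤ M * (M : ℝ) ^ (d - 1) := by gcongr
        _ = (M : ℝ) ^ d := by rw [← pow_succ', Nat.sub_add_cancel hd]
        _ ≤ _ := le_mul_of_one_le_left (by positivity) hc
  have hsplit (x : ℤ) : polyVal co (d + 1) x = polyVal co d x + co (d + 1) * x ^ (d + 1) := by
    rw [polyVal, sum_Icc_succ_top (by omega)]
    rfl
  have hpw0 : (0 : ℝ) ≤ ((z : ℝ) + 1) ^ (d + 1) - (z : ℝ) ^ (d + 1) :=
    sub_nonneg.2 (by gcongr; linarith)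
  have hpw := add_one_pow_sub_pow_le (d + 1) (Nat.cast_nonneg (α := ℝ) z)
  have hpw2 : ((z : ℝ) + 1) ^ (d + 1) - (z : ℝ) ^ (d + 1) ≤ (d + 1) * (M : ℝ) ^ d := by
    refine hpw.trans ?_
    push_cast
    gcongr
  calc |((polyVal co (d + 1) (z + 1) - polyVal co (d + 1) z : ℤ) : ℝ)|
      = |((polyVal co d (z + 1) - polyVal co d z : ℤ) : ℝ) +
          co (d + 1) * (((z : ℝ) + 1) ^ (d + 1) - (z : ℝ) ^ (d + 1))| := by
        rw [hsplit, hsplit]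
        push_cast
        ring_nf
    _ ≤ co (d + 1) * (M : ℝ) ^ d + co (d + 1) * ((d + 1) * (M : ℝ) ^ d) := by
        refine (abs_add_le _ _).trans (add_le_add (hlow.trans hlow2) ?_)
        rw [abs_mul, abs_of_nonneg hpw0, abs_of_nonneg (by linarith : (0 : ℝ) ≤ co (d + 1))]
        gcongr
    _ = _ := by
        rw [Nat.add_sub_cancel]
        push_cast
        ring

end Growth

/-- Moment estimate for the weighted indicator of the polynomial values `K * P z`, `z ≤ M`, in
terms of the coefficients of `P`. -/
theorem exists_moment_bound {k : ℕ} (hk : 1 ≤ k) :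
    ∃ C : ℝ, 0 < C ∧ ∀ᶠ M : ℕ in Filter.atTop,
      ∀ (co : ℕ → ℤ) (L c N K : ℕ) [NeZero N] (𝔞 : ZMod N → ℝ),
      LocallyAdmissible co k L → 1 ≤ L →
      (L : ℝ) ≤ (M : ℝ) ^ (1 / 2 ^ (k + 10) : ℝ) → (c : ℝ) ≤ (M : ℝ) ^ (1 / 2 ^ (k + 10) : ℝ) →
      (∀ j ∈ Icc 1 k, |(co j : ℝ)| ≤ (M : ℝ) ^ (1 / 2 ^ (k + 10) : ℝ)) →
      0 < K → IsUnit (K : ZMod N) → (N : ℤ) ≤ polyVal co k ((M + 1 : ℕ) : ℤ) →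
      (∀ z : ℕ, 1 ≤ z → z ≤ M → 𝔞 ((K * polyVal co k z : ℤ) : ZMod N) =
        ((K * polyVal co k z - K * polyVal co k ((z : ℤ) - 1) : ℤ) : ℝ) * lam c L z /
          ((K * polyVal co k M : ℤ) : ℝ)) →
      (∀ x, (¬ ∃ z : ℕ, 1 ≤ z ∧ z ≤ M ∧ x = ((K * polyVal co k z : ℤ) : ZMod N)) → 𝔞 x = 0) →
      ∑ r : ZMod N, ‖dft N 𝔞 r‖ ^ (k * 2 ^ (k + 3)) ≤ C := by
  obtain ⟨C, hC, hev⟩ := exists_prime_majorant hk (A := 2 ^ k + 1)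
    (by linarith [pow_pos (two_pos (α := ℝ)) k])
  set q := k * 2 ^ (k + 3) with hq
  set κ : ℝ := 1 / 2 ^ (k + 10) with hκ
  have hκ1 : κ < 1 := by
    rw [hκ, div_lt_one (by positivity)]
    exact one_lt_pow₀ (by norm_num) (by omega)
  refine ⟨(2 * (k + 1)) ^ q * C, by positivity, ?_⟩
  filter_upwards [hev, eventually_const_mul_rpow_le (k ^ 2 * 2 ^ k) hκ1,
    Filter.eventually_ge_atTop 1] with M hM hMκ hM1
  intro co L c N K _ 𝔞 hadm hL hLM hcM hco hK hKu hN h𝔞 h𝔞0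
  rw [Real.rpow_one] at hMκ
  have hM0 : (0 : ℝ) < M := by exact_mod_cast hM1
  have hK0 : (0 : ℝ) < K := by exact_mod_cast hK
  have hlead : (0 : ℝ) < co k := by exact_mod_cast hadm.pos
  have hN1 : (N : ℝ) ≤ (2 ^ k + 1) * (co k * (M : ℝ) ^ k) :=
    le_trans (by exact_mod_cast hN) (polyVal_add_one_le hk hM1 hadm.pos hco hMκ)
  obtain ⟨B, hB0, hB, hBsum⟩ := hM co L c N hadm hL hLM hcM hco (NeZero.pos N) hN1
  set β : ℕ → ℝ := fun z => 2 * (k + 1) / M * B z with hβ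
  have hβ0 (z : ℕ) : 0 ≤ β z := mul_nonneg (by positivity) (hB0 z)
  have hdom (x : ZMod N) : |𝔞 x| ≤ ∑ z ∈ range (M + 1),
      if (((K : ℤ) * polyVal co k z : ℤ) : ZMod N) = x then β z else 0 := by
    by_cases hx : ∃ z : ℕ, 1 ≤ z ∧ z ≤ M ∧ x = ((K * polyVal co k z : ℤ) : ZMod N)
    · obtain ⟨z, hz1, hzM, rfl⟩ := hx
      rw [h𝔞 z hz1 hzM]
      refine le_trans ?_ (single_le_sum (fun y _ => ?_) (mem_range.2 (by omega : z < M + 1)))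
      · rw [if_pos rfl]
        obtain ⟨y, rfl⟩ := Nat.exists_eq_add_of_le' hz1
        have hdiff := abs_polyVal_add_one_sub_le_lead hk hM1 hadm.pos hco hMκ hzM
        have hbig := le_polyVal hk hM1 hadm.pos hco hMκ
        have hlam0 : 0 ≤ lam c L (y + 1) := by
          rw [lam]
          split_ifs
          · exact mul_nonneg (by positivity)
              (by exact_mod_cast Real.log_natCast_nonneg (L * (y + 1) + c))
          · exact le_rfl
        have hMk : (M : ℝ) ^ k = M * (M : ℝ) ^ (k - 1) := by
          rw [← pow_succ', Nat.sub_add_cancel hk]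
        have hden : 0 < co k * (M : ℝ) ^ k / 2 := by positivity
        rw [abs_div, abs_mul, abs_of_nonneg hlam0]
        have e1 : |((K * polyVal co k ((y + 1 : ℕ) : ℤ) -
            K * polyVal co k (((y + 1 : ℕ) : ℤ) - 1) : ℤ) : ℝ)| =
            K * |((polyVal co k (y + 1) - polyVal co k y : ℤ) : ℝ)| := by
          rw [← mul_sub, Int.cast_mul, abs_mul]
          push_cast
          rw [add_sub_cancel_right, abs_of_pos hK0]
        have e2 : |((K * polyVal co k M : ℤ) : ℝ)| = K * (polyVal co k M : ℝ) := by
          push_cast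
          exact abs_of_pos (mul_pos hK0 (hden.trans_le hbig))
        rw [e1, e2]
        calc _ ≤ K * ((k + 1) * (co k * (M : ℝ) ^ (k - 1))) * B (y + 1) /
              (K * (co k * (M : ℝ) ^ k / 2)) := by
              have hBy := hB0 (y + 1)
              gcongr
              exact hB _ hzM
          _ = β (y + 1) := by
              rw [hβ, hMk]
              field_simp
      · split_ifs
        · exact hβ0 y
        · exact le_rfl
    · rw [h𝔞0 x hx, abs_zero]
      refine sum_nonneg fun z _ => ?_
      split_ifs
      · exact hβ0 z
      · exact le_rfl
  have hq2 : q = 2 * (k * 2 ^ (k + 2)) := by rw [hq]; ring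
  calc ∑ r : ZMod N, ‖dft N 𝔞 r‖ ^ q
      ≤ ∑ r : ZMod N, ‖dft N (fun x => ∑ z ∈ range (M + 1),
          if (((K : ℤ) * polyVal co k z : ℤ) : ZMod N) = x then β z else 0) r‖ ^ q := by
        rw [hq2]
        exact sum_norm_dft_pow_le hdom _
    _ = ∑ r ∈ range N, ‖∑ z ∈ range (M + 1), (β z : ℂ) *
          eC ((r : ℝ) / N * polyVal co k z)‖ ^ q :=
        sum_norm_dft_pushforward_pow (by simpa using hKu) (fun z => polyVal co k z) β _ q
    _ = (2 * (k + 1) / M) ^ q * ∑ r ∈ range N, ‖∑ z ∈ range (M + 1), (B z : ℂ) *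
          eC ((r : ℝ) / N * polyVal co k z)‖ ^ q := by
        rw [mul_sum]
        refine sum_congr rfl fun r _ => ?_
        have e : ∑ z ∈ range (M + 1), (β z : ℂ) * eC ((r : ℝ) / N * polyVal co k z) =
            ((2 * (k + 1) / M : ℝ) : ℂ) * ∑ z ∈ range (M + 1), (B z : ℂ) *
              eC ((r : ℝ) / N * polyVal co k z) := by
          rw [mul_sum]
          refine sum_congr rfl fun z _ => ?_
          rw [hβ]
          push_cast
          ring
        rw [e, norm_mul, Complex.norm_real, Real.norm_of_nonneg (by positivity), mul_pow]
    _ ≤ (2 * (k + 1) / M) ^ q * (C * (M : ℝ) ^ q) := by gcongr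
    _ = _ := by
        rw [div_pow]
        field_simp

theorem tendsto_floor_log_log_log_log : Filter.Tendsto
    (fun n : ℕ => ⌊Real.log (Real.log (Real.log (Real.log n)))⌋₊) Filter.atTop Filter.atTop :=
  tendsto_nat_floor_atTop.comp (Real.tendsto_log_atTop.comp (Real.tendsto_log_atTop.comp
    (Real.tendsto_log_atTop.comp (Real.tendsto_log_atTop.comp tendsto_natCast_atTop_atTop))))

theorem prod_prime_pow_le_exp {w : ℕ} (hw : 4 ≤ w) :
    ((∏ p ∈ (range (w + 1)).filter Nat.Prime, p ^ w : ℕ) : ℝ) ≤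
      Real.exp (Real.exp (Real.exp w)) := by
  have hw4 : (4 : ℝ) ≤ w := by exact_mod_cast hw
  have h1 : ∏ p ∈ (range (w + 1)).filter Nat.Prime, p ^ w ≤ (w ^ w) ^ (w + 1) := by
    calc ∏ p ∈ (range (w + 1)).filter Nat.Prime, p ^ w
        ≤ (w ^ w) ^ ((range (w + 1)).filter Nat.Prime).card := by
          refine prod_le_pow_card _ _ _ fun p hp => Nat.pow_le_pow_left ?_ w
          have := mem_range.1 (mem_filter.1 hp).1
          omega
      _ ≤ _ := by
          refine Nat.pow_le_pow_right (by positivity) ((card_filter_le _ _).trans ?_)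
          rw [card_range]
  have hlin := Real.add_one_le_exp (w : ℝ)
  have hquad := Real.quadratic_le_exp_of_nonneg (by linarith : (0 : ℝ) ≤ w)
  calc ((∏ p ∈ (range (w + 1)).filter Nat.Prime, p ^ w : ℕ) : ℝ)
      ≤ (((w ^ w) ^ (w + 1) : ℕ) : ℝ) := by exact_mod_cast h1
    _ = (w : ℝ) ^ (w * (w + 1)) := by push_cast; rw [pow_mul]
    _ ≤ (Real.exp w) ^ (w * (w + 1)) := by gcongr; linarith
    _ = Real.exp (w * (w + 1) * w) := by rw [← Real.exp_nat_mul]; push_cast; ring_nf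
    _ ≤ Real.exp (Real.exp w ^ 3) := by
        gcongr
        calc (w : ℝ) * (w + 1) * w ≤ (w + 1) ^ 3 := by nlinarith
          _ ≤ _ := by gcongr
    _ = Real.exp (Real.exp (3 * w)) := by rw [← Real.exp_nat_mul]; norm_num
    _ ≤ _ := by gcongr; nlinarith

theorem eventually_prod_prime_pow_le {ε : ℝ} (hε : 0 < ε) :
    ∀ᶠ n : ℕ in Filter.atTop, ∀ w : ℕ,
      w = ⌊Real.log (Real.log (Real.log (Real.log n)))⌋₊ →
      ((∏ p ∈ (range (w + 1)).filter Nat.Prime, p ^ w : ℕ) : ℝ) ≤ (n : ℝ) ^ ε := by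
  have ht1 := Real.tendsto_log_atTop.comp (tendsto_natCast_atTop_atTop (R := ℝ))
  have ht2 := Real.tendsto_log_atTop.comp ht1
  have ht3 := Real.tendsto_log_atTop.comp ht2
  filter_upwards [ht1.eventually_gt_atTop 0, ht2.eventually_gt_atTop 0, ht3.eventually_gt_atTop 0,
    tendsto_floor_log_log_log_log.eventually_ge_atTop 4,
    tendsto_natCast_atTop_atTop.eventually ((isLittleO_log_rpow_atTop hε).bound one_pos)]
    with n h1 h2 h3 h4 h5 w hw
  simp only [Function.comp] at h1 h2 h3
  rw [← hw] at h4
  have hwle : (w : ℝ) ≤ Real.log (Real.log (Real.log (Real.log n))) := by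
    rw [hw]
    exact Nat.floor_le (by
      by_contra hneg
      rw [hw, Nat.floor_of_nonpos (by linarith)] at h4
      omega)
  have e1 : Real.exp w ≤ Real.log (Real.log (Real.log n)) := (Real.le_log_iff_exp_le h3).1 hwle
  have e2 := (Real.le_log_iff_exp_le h2).1 e1
  have e3 := (Real.le_log_iff_exp_le h1).1 e2
  refine (prod_prime_pow_le_exp h4).trans (e3.trans ?_)
  rw [one_mul, Real.norm_of_nonneg h1.le, Real.norm_of_nonneg (by positivity)] at h5
  exact h5

theorem sum_rpow_le_sum_rpow {ι : Type*} (S : Finset ι) (y : ι → ℝ) (hy : ∀ i ∈ S, 0 ≤ y i)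
    {p : ℝ} (hp : 1 ≤ p) : ∑ i ∈ S, y i ^ p ≤ (∑ i ∈ S, y i) ^ p := by
  have hS : 0 ≤ ∑ i ∈ S, y i := sum_nonneg hy
  have e (x : ℝ) (hx : 0 ≤ x) : x ^ p = x * x ^ (p - 1) := by
    rw [← Real.rpow_one_add' hx (by linarith), add_sub_cancel]
  rw [e _ hS, sum_mul]
  refine sum_le_sum fun i hi => ?_
  rw [e _ (hy i hi)]
  have := single_le_sum hy hi
  have := hy i hi
  gcongr

theorem abs_polyVal_le {co : ℕ → ℤ} {k X : ℕ} {H : ℝ} (hX : 1 ≤ X)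
    (hH : ∀ j ∈ Icc 1 k, |(co j : ℝ)| ≤ H) : |(polyVal co k X : ℝ)| ≤ k * H * (X : ℝ) ^ k := by
  have hX1 : (1 : ℝ) ≤ X := by exact_mod_cast hX
  rw [polyVal]
  push_cast
  calc |∑ j ∈ Icc 1 k, (co j : ℝ) * (X : ℝ) ^ j| ≤ ∑ j ∈ Icc 1 k, H * (X : ℝ) ^ k := by
        refine (abs_sum_le_sum_abs _ _).trans (sum_le_sum fun j hj => ?_)
        rw [abs_mul, abs_of_nonneg (by positivity : (0 : ℝ) ≤ (X : ℝ) ^ j)]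
        have := hH j hj
        have h0 : 0 ≤ H := (abs_nonneg _).trans this
        gcongr
        exact (mem_Icc.1 hj).2
    _ = _ := by simp; ring

/-- A polynomial with coefficients at most `D * W ^ (2 * k)` needs a long argument to reach size
`n / W` if `W` is a small power of `n`. -/
theorem eventually_argument_large {k : ℕ} (hk : 1 ≤ k) (D K : ℕ) {κ : ℝ} (hκ : 0 < κ) (hκ1 : κ ≤ 1)
    (M₀ : ℕ) : ∀ᶠ n : ℕ in Filter.atTop, ∀ W : ℕ, 1 ≤ W → (W : ℝ) ≤ (n : ℝ) ^ (κ / (16 * k ^ 2)) →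
      ∀ N : ℕ, 2 * (n : ℝ) / W < N → K < N ∧ ∀ (co : ℕ → ℤ) (M : ℕ),
      (∀ j ∈ Icc 1 k, |(co j : ℝ)| ≤ D * (W : ℝ) ^ (2 * k)) →
      (N : ℤ) ≤ polyVal co k ((M + 1 : ℕ) : ℤ) →
      M₀ ≤ M ∧ D * (W : ℝ) ^ (2 * k) ≤ (M : ℝ) ^ κ := by
  have hk0 : (0 : ℝ) < k := by exact_mod_cast hk
  have hk1 : (1 : ℝ) ≤ k := by exact_mod_cast hk
  set ε : ℝ := κ / (16 * k ^ 2) with hε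
  have hε0 : 0 < ε := by positivity
  have hεk : 2 * k * ε = κ / (8 * k) := by rw [hε]; field_simp; norm_num
  have hκk : κ / (8 * k) < κ / (4 * k) := by
    gcongr
    norm_num
  have hκ8 : κ / (8 * k) ≤ 1 / 8 := by
    rw [div_le_div_iff₀ (by positivity) (by norm_num)]
    nlinarith
  have hε8 : ε ≤ 1 / 16 := by
    rw [hε, div_le_div_iff₀ (by positivity) (by norm_num)]
    nlinarith
  filter_upwards [Filter.eventually_ge_atTop 1,
    eventually_const_mul_rpow_le K (show ε < 1 by linarith),
    eventually_const_mul_rpow_le (k * D) (show κ / (8 * k) + ε < 1 / 2 by linarith),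
    eventually_const_mul_rpow_le D hκk,
    eventually_const_mul_rpow_le 2 (show 1 / (4 * k : ℝ) < 1 / (2 * k) by gcongr; norm_num),
    eventually_const_mul_rpow_le M₀ (show 0 < 1 / (4 * k : ℝ) by positivity)]
    with n hn h1 h2 h3 h4 h5 W hW hWn N hN
  have hn1 : (1 : ℝ) ≤ n := by exact_mod_cast hn
  have hn0 : (0 : ℝ) < n := by linarith
  have hW0 : (0 : ℝ) < W := by exact_mod_cast hW
  rw [div_lt_iff₀ hW0] at hN
  rw [Real.rpow_one] at h1
  rw [Real.rpow_zero, mul_one] at h5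
  refine ⟨?_, fun co M hco hNM => ?_⟩
  · have : (K : ℝ) * W < N * W := by
      calc (K : ℝ) * W ≤ K * (n : ℝ) ^ ε := by gcongr
        _ < _ := by linarith
    exact_mod_cast lt_of_mul_lt_mul_right this hW0.le
  have hWpow : (W : ℝ) ^ (2 * k) ≤ (n : ℝ) ^ (κ / (8 * k)) := by
    calc (W : ℝ) ^ (2 * k) ≤ ((n : ℝ) ^ ε) ^ (2 * k) := by gcongr
      _ = (n : ℝ) ^ (κ / (8 * k)) := by
          rw [← Real.rpow_natCast, ← Real.rpow_mul hn0.le, ← hεk]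
          push_cast
          ring_nf
  have hroot : (n : ℝ) ^ (1 / (2 * k) : ℝ) ≤ M + 1 := by
    have hs : (n : ℝ) ≤ (n : ℝ) ^ (1 / 2 : ℝ) * ((M : ℝ) + 1) ^ k := by
      have hP := abs_polyVal_le (X := M + 1) (by omega) hco
      have hNP : (N : ℝ) ≤ polyVal co k ((M + 1 : ℕ) : ℤ) := by exact_mod_cast hNM
      calc (n : ℝ) ≤ N * W := by linarith
        _ ≤ (k * (D * (W : ℝ) ^ (2 * k)) * ((M + 1 : ℕ) : ℝ) ^ k) * W := by
            gcongr
            exact hNP.trans ((le_abs_self _).trans hP)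
        _ ≤ (k * (D * (n : ℝ) ^ (κ / (8 * k))) * ((M + 1 : ℕ) : ℝ) ^ k) * (n : ℝ) ^ ε := by
            gcongr
        _ = k * D * (n : ℝ) ^ (κ / (8 * k) + ε) * ((M : ℝ) + 1) ^ k := by
            rw [Real.rpow_add hn0]
            push_cast
            ring
        _ ≤ _ := by gcongr
    have hs2 : (n : ℝ) ^ (1 / 2 : ℝ) ≤ ((M : ℝ) + 1) ^ k := by
      have hpos : 0 < (n : ℝ) ^ (1 / 2 : ℝ) := by positivity
      refine le_of_mul_le_mul_left ?_ hpos
      rw [← Real.rpow_add hn0]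
      norm_num
      norm_num at hs
      exact hs
    refine le_of_pow_le_pow_left₀ (by omega : k ≠ 0) (by positivity) ?_
    rw [← Real.rpow_natCast, ← Real.rpow_mul hn0.le]
    rwa [show 1 / (2 * k : ℝ) * k = 1 / 2 by field_simp]
  have hone : 1 ≤ (n : ℝ) ^ (1 / (4 * k) : ℝ) := Real.one_le_rpow hn1 (by positivity)
  have hMn : (n : ℝ) ^ (1 / (4 * k) : ℝ) ≤ M := by linarith
  refine ⟨by exact_mod_cast h5.trans hMn, ?_⟩
  calc D * (W : ℝ) ^ (2 * k) ≤ D * (n : ℝ) ^ (κ / (8 * k)) := by gcongr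
    _ ≤ (n : ℝ) ^ (κ / (4 * k)) := h3
    _ = ((n : ℝ) ^ (1 / (4 * k) : ℝ)) ^ κ := by
        rw [← Real.rpow_mul hn0.le]
        ring_nf
    _ ≤ (M : ℝ) ^ κ := by gcongr

theorem exists_moment_bound_shifted {k : ℕ} (hk : 1 ≤ k) :
    ∃ C : ℝ, 0 < C ∧
    ∀ ψ : Polynomial ℤ, ψ.natDegree = k → 0 < ψ.leadingCoeff →
    ∀ b₀ W₀ K : ℕ, 0 < b₀ → b₀ ≤ W₀ → 0 < K →
    ∀ᶠ n : ℕ in Filter.atTop,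
    ∀ (w W : ℕ),
      w = ⌊Real.log (Real.log (Real.log (Real.log n)))⌋₊ →
      W = ∏ p ∈ (Finset.range (w + 1)).filter Nat.Prime, p ^ w →
    ∀ (N : ℕ) [NeZero N], N.Prime → (2 * (n : ℝ)) / W < N →
    ∀ b : ℕ, b < W → Int.gcd (ψ.derivative.eval (b : ℤ)) (W : ℤ) = K →
    ∀ ψbW : ℤ → ℤ,
      (∀ x : ℤ, ψbW x = (ψ.eval ((W : ℤ) * x + (b : ℤ)) - ψ.eval (b : ℤ)) / (W : ℤ)) →
    ∀ M : ℕ, (∀ x : ℕ, ψbW (x : ℤ) < (K : ℤ) * N → x ≤ M) →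
    ∀ 𝔞 : ZMod N → ℝ,
      (∀ z : ℕ, 1 ≤ z → z ≤ M →
        𝔞 ((ψbW (z : ℤ) : ℤ) : ZMod N) =
          ((ψbW (z : ℤ) - ψbW ((z : ℤ) - 1) : ℤ) : ℝ) * lam (W₀ * b + b₀) (W * W₀) z /
            ((ψbW (M : ℤ) : ℤ) : ℝ)) →
      (∀ x : ZMod N, (¬ ∃ z : ℕ, 1 ≤ z ∧ z ≤ M ∧ x = ((ψbW (z : ℤ) : ℤ) : ZMod N)) →
        𝔞 x = 0) →
    ∑ r : ZMod N, ‖dft N 𝔞 r‖ ^ (k * 2 ^ (k + 3)) ≤ C := by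
  obtain ⟨C, hC0, hC⟩ := exists_moment_bound hk
  obtain ⟨M₀, hM₀⟩ := Filter.eventually_atTop.1 hC
  refine ⟨C, hC0, fun ψ hdeg hlc b₀ W₀ K hb₀ hbW₀ hK => ?_⟩
  obtain ⟨D, hD1, hD⟩ := exists_abs_coeff_taylor_le ψ
  set κ : ℝ := 1 / 2 ^ (k + 10) with hκ
  have hκ0 : 0 < κ := by positivity
  have hκ1 : κ ≤ 1 := (div_le_one (by positivity)).2 (one_le_pow₀ (by norm_num))
  have hk0 : (0 : ℝ) < k := by exact_mod_cast hk
  filter_upwards [eventually_argument_large hk (D + 2 * W₀) K hκ0 hκ1 M₀,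
    eventually_prod_prime_pow_le (show 0 < κ / (16 * k ^ 2) by positivity),
    tendsto_floor_log_log_log_log.eventually_gt_atTop K,
    tendsto_floor_log_log_log_log.eventually_ge_atTop W₀,
    tendsto_floor_log_log_log_log.eventually_ge_atTop ψ.leadingCoeff.toNat]
    with n hlarge hWn hKw hW₀w hlcw
  intro w W hw hW N _ hNp hN b hbW hgcd ψbW hψ M hM 𝔞 h𝔞 h𝔞0
  rw [← hw] at hKw hW₀w hlcw
  have hWpos : 1 ≤ W := by omega
  have hW1 : (1 : ℝ) ≤ W := by exact_mod_cast hWpos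
  obtain ⟨hKN, hlarge⟩ := hlarge W hWpos (by rw [hW]; exact hWn w hw) N hN
  obtain ⟨co, hco, h1, hlead, hdvd, hbound⟩ := exists_coeff_shifted_polynomial hdeg hk hK hWpos
    (fun j => by rw [← hdeg]; exact hD b W hbW j) (hgcd ▸ Int.gcd_dvd_right _ _)
    (hgcd ▸ Int.gcd_dvd_left _ _)
  have hψ' (x : ℤ) : ψbW x = K * polyVal co k x := by rw [hψ, hco]
  have hbound' : ∀ j ∈ Icc 1 k, |(co j : ℝ)| ≤ ((D + 2 * W₀ : ℕ) : ℝ) * (W : ℝ) ^ (2 * k) := by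
    intro j hj
    have h : |(co j : ℝ)| ≤ D * (W : ℝ) ^ (2 * k) := by exact_mod_cast hbound j hj
    refine h.trans ?_
    gcongr
    omega
  have hNM : (N : ℤ) ≤ polyVal co k ((M + 1 : ℕ) : ℤ) := by
    by_contra hlt
    have := hM (M + 1) (by
      rw [hψ']
      exact mul_lt_mul_of_pos_left (not_le.1 hlt) (by exact_mod_cast hK))
    omega
  obtain ⟨hMM₀, hHM⟩ := hlarge co M hbound' hNM
  have hadm : LocallyAdmissible co k (W * W₀) :=
    locallyAdmissible_shifted hW (by omega) (by omega) hW₀w hKw hK hlc (by omega) hgcd h1 hlead hdvd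
  have hWpow : W ≤ W ^ (2 * k) := Nat.le_self_pow (by omega) W
  have hL : W * W₀ ≤ (D + 2 * W₀) * W ^ (2 * k) := by
    rw [mul_comm]
    exact Nat.mul_le_mul (by omega) hWpow
  have hc : W₀ * b + b₀ ≤ (D + 2 * W₀) * W ^ (2 * k) := by
    calc W₀ * b + b₀ ≤ W₀ * W + W₀ * W :=
          add_le_add (Nat.mul_le_mul_left _ hbW.le) (hbW₀.trans (Nat.le_mul_of_pos_right _ hWpos))
      _ = (2 * W₀) * W := by ring
      _ ≤ _ := Nat.mul_le_mul (by omega) hWpow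
  have hunit : IsUnit (K : ZMod N) := by
    rw [ZMod.isUnit_iff_coprime, Nat.coprime_comm, hNp.coprime_iff_not_dvd]
    exact Nat.not_dvd_of_pos_of_lt hK hKN
  refine hM₀ M hMM₀ co (W * W₀) (W₀ * b + b₀) N K 𝔞 hadm (Nat.mul_pos hWpos (by omega))
    (le_trans (by exact_mod_cast hL) hHM) (le_trans (by exact_mod_cast hc) hHM)
    (fun j hj => (hbound' j hj).trans hHM) hK hunit hNM ?_ ?_
  · simpa only [hψ'] using h𝔞
  · simpa only [hψ'] using h𝔞0

/-- Restriction estimate (Lemma 2.6 of the paper): for every real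
`ρ ≥ k·2^{k+3}` there is a constant `C(ρ)` depending only on `ρ` such that, in
the setup of the paper and for all sufficiently large `n`,
`Σ_{r ∈ ℤ_N} |𝔞̃(r)|^ρ ≤ C(ρ)·K`. -/
theorem restriction_estimate (ρ : ℝ) :
    ∃ C : ℝ, 0 < C ∧
    ∀ k : ℕ, 1 ≤ k → ((k : ℝ) * 2 ^ (k + 3)) ≤ ρ →
    ∀ ψ : Polynomial ℤ, ψ.natDegree = k → 0 < ψ.leadingCoeff →
    ∀ m b₀ W₀ K : ℕ, 0 < m → 0 < b₀ → b₀ ≤ W₀ → Nat.gcd b₀ W₀ = 1 → 0 < K →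
    ∃ n₀ : ℕ, ∀ n : ℕ, n₀ ≤ n →
    ∀ (w W : ℕ),
      w = ⌊Real.log (Real.log (Real.log (Real.log n)))⌋₊ →
      W = ∏ p ∈ (Finset.range (w + 1)).filter Nat.Prime, p ^ w →
    ∀ (N : ℕ) [NeZero N], N.Prime →
      (2 * (n : ℝ)) / W < N → (N : ℝ) ≤ (2 + (1 / 10000 : ℝ) / ((K : ℝ) * m)) * n / W →
    ∀ b : ℕ, b < W →
      Nat.gcd (W₀ * b + b₀) (W * W₀) = 1 →
      Int.gcd (ψ.derivative.eval (b : ℤ)) (ψ.leadingCoeff * (W : ℤ) ^ (k - 1)) = K →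
      Int.gcd (ψ.derivative.eval (b : ℤ)) (W : ℤ) = K →
    ∀ ψbW : ℤ → ℤ,
      (∀ x : ℤ, ψbW x = (ψ.eval ((W : ℤ) * x + (b : ℤ)) - ψ.eval (b : ℤ)) / (W : ℤ)) →
    ∀ M : ℕ, ψbW (M : ℤ) < (K : ℤ) * N → (∀ x : ℕ, ψbW (x : ℤ) < (K : ℤ) * N → x ≤ M) →
    ∀ 𝔞 : ZMod N → ℝ,
      (∀ z : ℕ, 1 ≤ z → z ≤ M →
        𝔞 ((ψbW (z : ℤ) : ℤ) : ZMod N) =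
          ((ψbW (z : ℤ) - ψbW ((z : ℤ) - 1) : ℤ) : ℝ) * lam (W₀ * b + b₀) (W * W₀) z /
            ((ψbW (M : ℤ) : ℤ) : ℝ)) →
      (∀ x : ZMod N, (¬ ∃ z : ℕ, 1 ≤ z ∧ z ≤ M ∧ x = ((ψbW (z : ℤ) : ℤ) : ZMod N)) →
        𝔞 x = 0) →
    ∑ r : ZMod N, ‖dft N 𝔞 r‖ ^ (ρ : ℝ) ≤ C * K := by
  choose! C hC0 hC using fun (k : ℕ) (hk : 1 ≤ k) => exists_moment_bound_shifted hk
  set q : ℕ → ℕ := fun k => k * 2 ^ (k + 3) with hq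
  have hpos (k : ℕ) (hk : k ∈ Icc 1 ⌈ρ⌉₊) : 0 ≤ C k ^ (ρ / q k) :=
    Real.rpow_nonneg (hC0 k (mem_Icc.1 hk).1).le _
  refine ⟨1 + ∑ k ∈ Icc 1 ⌈ρ⌉₊, C k ^ (ρ / q k), by linarith [sum_nonneg hpos],
    fun k hk hkρ ψ hdeg hlc m b₀ W₀ K _ hb₀ hbW₀ _ hK => ?_⟩
  obtain ⟨n₀, hn₀⟩ := Filter.eventually_atTop.1 (hC k hk ψ hdeg hlc b₀ W₀ K hb₀ hbW₀ hK)
  refine ⟨n₀, fun n hn w W hw hW N _ hNp hN _ b hbW _ _ hgcd ψbW hψ M _ hM 𝔞 h𝔞 h𝔞0 => ?_⟩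
  have hbound := hn₀ n hn w W hw hW N hNp hN b hbW hgcd ψbW hψ M hM 𝔞 h𝔞 h𝔞0
  have hk1 : (1 : ℝ) ≤ k := by exact_mod_cast hk
  have hqk : (q k : ℝ) = k * 2 ^ (k + 3) := by rw [hq]; push_cast; ring
  have hq0 : (0 : ℝ) < q k := by rw [hqk]; positivity
  have hkmem : k ∈ Icc 1 ⌈ρ⌉₊ := by
    refine mem_Icc.2 ⟨hk, ?_⟩
    have h2 : (1 : ℝ) ≤ 2 ^ (k + 3) := one_le_pow₀ (by norm_num)
    have : (k : ℝ) ≤ ⌈ρ⌉₊ := le_trans (by nlinarith) (Nat.le_ceil ρ)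
    exact_mod_cast this
  have hK1 : (1 : ℝ) ≤ K := by exact_mod_cast hK
  calc ∑ r : ZMod N, ‖dft N 𝔞 r‖ ^ ρ
      = ∑ r : ZMod N, (‖dft N 𝔞 r‖ ^ q k) ^ (ρ / q k) := by
        refine sum_congr rfl fun r _ => ?_
        rw [← Real.rpow_natCast, ← Real.rpow_mul (norm_nonneg _), mul_div_cancel₀ _ hq0.ne']
    _ ≤ (∑ r : ZMod N, ‖dft N 𝔞 r‖ ^ q k) ^ (ρ / q k) :=
        sum_rpow_le_sum_rpow _ _ (fun _ _ => by positivity)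
          ((one_le_div hq0).2 (hqk ▸ hkρ))
    _ ≤ C k ^ (ρ / q k) := by
        gcongr
        exact div_nonneg ((hq0.le.trans (hqk.trans_le hkρ))) hq0.le
    _ ≤ 1 + ∑ k ∈ Icc 1 ⌈ρ⌉₊, C k ^ (ρ / q k) := by
        linarith [single_le_sum hpos hkmem]
    _ ≤ _ := le_mul_of_one_le_right (by linarith [sum_nonneg hpos]) hK1
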